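/- arXiv:1306.3315 — 8 statements merged into one kernel-verified Lean document; each statement's English description precedes it below -/
import Mathlib

section
/- Let x be a real number. The sequence of fractional parts (⟨k x⟩)_{k ≥ 1} is uniformly distributed modulo 1 if and only if x is irrational. -/
open MeasureTheory Filter

/-- A sequence `(u k)_{k ≥ 1}` of reals in `[0,1)` is uniformly distributed modulo 1 if for all
`0 ≤ a < b ≤ 1` the proportion of the first `N` terms lying in `[a,b)` tends to `b - a`. -/
def UnifDistribMod1 (u : ℕ → ℝ) : Prop :=
  ∀ a b : ℝ, 0 ≤ a → a < b → b ≤ 1 →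
    Tendsto
      (fun N : ℕ =>
        (∑ k ∈ Finset.Icc 1 N, (Set.Ico a b).indicator (fun _ => (1 : ℝ)) (u k)) / N)
      atTop (nhds (b - a))

open scoped Topology

/-- On a compact space, to check weak convergence of probability measures it suffices to test
against a family of continuous functions whose linear span is dense. -/
theorem tendsto_probabilityMeasure_of_topologicalClosure_span_eq_top {X ι : Type*}
    [TopologicalSpace X] [CompactSpace X] [MeasurableSpace X] [BorelSpace X] {L : Filter ι}
    {μs : ι → ProbabilityMeasure X} {μ : ProbabilityMeasure X} {S : Set C(X, ℂ)}
    (hS : (Submodule.span ℂ S).topologicalClosure = ⊤)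
    (h : ∀ f ∈ S, Tendsto (fun i => ∫ y, f y ∂(μs i : Measure X)) L
      (𝓝 (∫ y, f y ∂(μ : Measure X)))) :
    Tendsto μs L (𝓝 μ) := by
  have hf_int (ν : ProbabilityMeasure X) (f : C(X, ℂ)) : Integrable f (ν : Measure X) :=
    BoundedContinuousFunction.integrable _ (BoundedContinuousFunction.mkOfCompact f)
  have hlip (ν : ProbabilityMeasure X) :
      LipschitzWith 1 (fun f : C(X, ℂ) => ∫ y, f y ∂(ν : Measure X)) := by
    refine LipschitzWith.of_dist_le_mul fun f g => ?_
    rw [dist_eq_norm, ← integral_sub (hf_int ν f) (hf_int ν g)]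
    refine (norm_integral_le_of_norm_le_const (C := dist f g) (ae_of_all _ fun y => ?_)).trans ?_
    · rw [← dist_eq_norm]
      exact ContinuousMap.dist_apply_le_dist y
    · simp
  let V : Submodule ℂ C(X, ℂ) :=
    { carrier := {f | Tendsto (fun i => ∫ y, f y ∂(μs i : Measure X)) L
        (𝓝 (∫ y, f y ∂(μ : Measure X)))}
      add_mem' := fun {f g} hf hg => by
        simpa [integral_add (hf_int _ f) (hf_int _ g)] using Tendsto.add hf hg
      zero_mem' := by simp [tendsto_const_nhds]
      smul_mem' := fun c f hf => by
        simpa [integral_const_mul] using Tendsto.const_mul c hf }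
  have hV : IsClosed (V : Set C(X, ℂ)) :=
    (LipschitzWith.uniformEquicontinuous _ 1 fun i => hlip (μs i)).equicontinuous
      |>.isClosed_setOfPred_tendsto (hlip μ).continuous
  have htop : V = ⊤ :=
    top_unique (hS ▸ Submodule.topologicalClosure_minimal _ (Submodule.span_le.2 h) hV)
  refine (ProbabilityMeasure.tendsto_iff_forall_integral_rclike_tendsto ℂ).2 fun f => ?_
  exact (htop ▸ Submodule.mem_top : f.toContinuousMap ∈ V)

/-- The uniform probability measure on the terms `u 1, …, u (N + 1)`. -/
noncomputable def empiricalMeasure {X : Type*} [MeasurableSpace X] (u : ℕ → X) (N : ℕ) :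
    ProbabilityMeasure X :=
  ⟨((N + 1 : ℕ) : ENNReal)⁻¹ • ∑ k ∈ Finset.Icc 1 (N + 1), Measure.dirac (u k), ⟨by
    simpa using ENNReal.inv_mul_cancel (a := (N : ENNReal) + 1) (by simp) (by finiteness)⟩⟩

theorem coe_empiricalMeasure {X : Type*} [MeasurableSpace X] (u : ℕ → X) (N : ℕ) :
    (empiricalMeasure u N : Measure X) =
      ((N + 1 : ℕ) : ENNReal)⁻¹ • ∑ k ∈ Finset.Icc 1 (N + 1), Measure.dirac (u k) := rfl

theorem integral_empiricalMeasure {X E : Type*} [MeasurableSpace X] [MeasurableSingletonClass X]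
    [NormedAddCommGroup E] [NormedSpace ℝ E] [CompleteSpace E] (u : ℕ → X) (N : ℕ) (f : X → E) :
    ∫ y, f y ∂(empiricalMeasure u N : Measure X) =
      ((N + 1 : ℕ) : ℝ)⁻¹ • ∑ k ∈ Finset.Icc 1 (N + 1), f (u k) := by
  rw [coe_empiricalMeasure, integral_smul_measure, integral_finsetSum_measure]
  · simp only [integral_dirac, ENNReal.toReal_inv, ENNReal.toReal_natCast]
  · exact fun k _ => integrable_dirac (by finiteness)

instance : IsProbabilityMeasure (volume : Measure UnitAddCircle) := ⟨by simp⟩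

theorem UnitAddCircle.integral_fourier_of_ne_zero {n : ℤ} (hn : n ≠ 0) :
    ∫ y : UnitAddCircle, fourier n y = 0 :=
  integral_eq_zero_of_add_right_eq_neg (fourier_add_half_inv_index hn one_pos)

theorem fourier_coe_natCast_mul (n : ℤ) (x : ℝ) (k : ℕ) :
    fourier n (((k * x : ℝ)) : UnitAddCircle) = fourier n (x : UnitAddCircle) ^ k := by
  rw [fourier_coe_apply, fourier_coe_apply, ← Complex.exp_nat_mul]
  congr 1
  push_cast
  ring

theorem Irrational.fourier_coe_ne_one {x : ℝ} (hx : Irrational x) {n : ℤ} (hn : n ≠ 0) :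
    fourier n (x : UnitAddCircle) ≠ 1 := by
  intro h
  rw [fourier_apply, Circle.coe_eq_one, ← AddCircle.toCircle_zero (T := 1),
    (AddCircle.injective_toCircle one_ne_zero).eq_iff, ← AddCircle.coe_zsmul,
    AddCircle.coe_eq_zero_iff] at h
  obtain ⟨m, hm⟩ := h
  exact (hx.intCast_mul hn).ne_int m (by simpa using hm.symm)

/-- The Cesàro means of the powers of a point `z ≠ 1` in the closed unit disc tend to `0`. -/
theorem tendsto_inv_smul_sum_pow_of_ne_one {z : ℂ} (hz : ‖z‖ ≤ 1) (hz1 : z ≠ 1) :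
    Tendsto (fun N : ℕ => ((N + 1 : ℕ) : ℝ)⁻¹ • ∑ k ∈ Finset.Icc 1 (N + 1), z ^ k)
      atTop (𝓝 0) := by
  have hinv : Tendsto (fun N : ℕ => ((N + 1 : ℕ) : ℝ)⁻¹) atTop (𝓝 0) :=
    (tendsto_inv_atTop_nhds_zero_nat (𝕜 := ℝ)).comp (tendsto_add_atTop_nat 1)
  refine hinv.zero_smul_isBoundedUnder_le (isBoundedUnder_of ⟨2 / ‖z - 1‖, fun N => ?_⟩)
  have hsum : ∑ k ∈ Finset.Icc 1 (N + 1), z ^ k = (z ^ (N + 1 + 1) - z ^ 1) / (z - 1) := by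
    rw [← geom_sum_Ico hz1 (by omega)]
    rfl
  simp only [Function.comp_apply, hsum, norm_div]
  gcongr
  calc ‖z ^ (N + 1 + 1) - z ^ 1‖ ≤ ‖z ^ (N + 1 + 1)‖ + ‖z ^ 1‖ := norm_sub_le _ _
    _ ≤ 1 + 1 := by
      rw [norm_pow, norm_pow]
      exact add_le_add (pow_le_one₀ (norm_nonneg z) hz) (pow_le_one₀ (norm_nonneg z) hz)
    _ = 2 := one_add_one_eq_two

/-- The multiples of an irrational number equidistribute on the unit circle. -/
theorem Irrational.tendsto_empiricalMeasure {x : ℝ} (hx : Irrational x) :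
    Tendsto (empiricalMeasure fun k : ℕ => ((k * x : ℝ) : UnitAddCircle)) atTop
      (𝓝 ⟨volume, inferInstance⟩) := by
  refine tendsto_probabilityMeasure_of_topologicalClosure_span_eq_top
    (span_fourier_closure_eq_top (T := 1)) ?_
  rintro _ ⟨n, rfl⟩
  simp only [integral_empiricalMeasure, fourier_coe_natCast_mul, ProbabilityMeasure.coe_mk]
  rcases eq_or_ne n 0 with rfl | hn
  · refine tendsto_const_nhds.congr fun N => ?_
    have : (N : ℂ) + 1 ≠ 0 := by exact_mod_cast N.succ_ne_zero
    simp [← mul_add_one, inv_mul_cancel₀ this]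
  · rw [UnitAddCircle.integral_fourier_of_ne_zero hn]
    exact tendsto_inv_smul_sum_pow_of_ne_one (Circle.norm_coe _).le (hx.fourier_coe_ne_one hn)

theorem UnitAddCircle.coe_mem_image_Ico_iff {a b y : ℝ} (ha : 0 ≤ a) (hb : b ≤ 1) :
    (y : UnitAddCircle) ∈ ((↑) : ℝ → UnitAddCircle) '' Set.Ico a b ↔
      Int.fract y ∈ Set.Ico a b := by
  constructor
  · rintro ⟨t, ht, hty⟩
    have : t = Int.fract y := (AddCircle.coe_eq_coe_iff_of_mem_Ico (p := (1 : ℝ)) (a := 0)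
      ⟨ha.trans ht.1, by simpa using ht.2.trans_le hb⟩
      ⟨Int.fract_nonneg y, by simpa using Int.fract_lt_one y⟩).1 (by simpa using hty)
    rwa [← this]
  · exact fun h => ⟨_, h, AddCircle.coe_fract y⟩

theorem UnitAddCircle.volume_frontier_image_Ico (a b : ℝ) :
    volume (frontier (((↑) : ℝ → UnitAddCircle) '' Set.Ico a b)) = 0 := by
  have hcl : closure (((↑) : ℝ → UnitAddCircle) '' Set.Ico a b) ⊆ (↑) '' Set.Icc a b :=
    closure_minimal (Set.image_mono Set.Ico_subset_Icc_self)
      (isCompact_Icc.image (AddCircle.continuous_mk' 1)).isClosed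
  have hIoo : ((↑) : ℝ → UnitAddCircle) '' Set.Ioo a b ⊆ interior ((↑) '' Set.Ico a b) :=
    interior_maximal (Set.image_mono Set.Ioo_subset_Ico_self)
      (QuotientAddGroup.isOpenMap_coe _ isOpen_Ioo)
  have : Nontrivial (Set.Ico (0 : ℝ) (0 + 1)) :=
    Set.nontrivial_coe_sort.2 (Set.Ico_infinite (by norm_num)).nontrivial
  have : Nontrivial UnitAddCircle := (AddCircle.equivIco (1 : ℝ) 0).symm.injective.nontrivial
  have : (𝓝[≠] (0 : UnitAddCircle)).NeBot :=
    ConnectedSpace.neBot_nhdsWithin_compl_of_nontrivial_of_t1space 0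
  refine measure_mono_null (t := ((↑) : ℝ → UnitAddCircle) '' {a, b}) ?_
    (((Set.toFinite _).image _).measure_zero _)
  rintro _ ⟨hy, hy'⟩
  obtain ⟨t, ht, rfl⟩ := hcl hy
  refine ⟨t, ?_, rfl⟩
  rw [Set.mem_insert_iff, Set.mem_singleton_iff]
  by_contra! h
  exact hy' (hIoo ⟨t, ⟨ht.1.lt_of_ne h.1.symm, ht.2.lt_of_ne h.2⟩, rfl⟩)

theorem UnitAddCircle.volume_image_Ico {a b : ℝ} (ha : 0 ≤ a) (hb : b ≤ 1) :
    volume (((↑) : ℝ → UnitAddCircle) '' Set.Ico a b) = ENNReal.ofReal (b - a) := by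
  have hinj : Set.InjOn ((↑) : ℝ → UnitAddCircle) (Set.Ico a b) := by
    have hmem {s : ℝ} (hs : s ∈ Set.Ico a b) : s ∈ Set.Ico (0 : ℝ) (0 + 1) :=
      ⟨ha.trans hs.1, by simpa using hs.2.trans_le hb⟩
    exact fun s hs t ht => (AddCircle.coe_eq_coe_iff_of_mem_Ico (hmem hs) (hmem ht)).1
  have hmeas : MeasurableSet (((↑) : ℝ → UnitAddCircle) '' Set.Ico a b) :=
    measurableSet_Ico.image_of_measurable_injOn AddCircle.measurable_mk' hinj
  rw [← (UnitAddCircle.measurePreserving_mk 0).measure_preimage hmeas.nullMeasurableSet, zero_add,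
    ← Measure.restrict_congr_set (Ioo_ae_eq_Ioc (μ := volume) (a := (0 : ℝ)) (b := 1)),
    Measure.restrict_apply (AddCircle.measurable_mk' hmeas)]
  have hfract {y : ℝ} (hy : y ∈ Set.Ioo (0 : ℝ) 1) : Int.fract y = y :=
    Int.fract_eq_self.2 ⟨hy.1.le, hy.2⟩
  refine le_antisymm ((measure_mono (t := Set.Ico a b) ?_).trans_eq Real.volume_Ico)
    (Real.volume_Ioo.symm.trans_le (measure_mono (s := Set.Ioo a b) ?_))
  · rintro y ⟨hy, hy'⟩
    rw [← hfract hy']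
    exact (coe_mem_image_Ico_iff ha hb).1 hy
  · exact fun y hy => ⟨⟨y, ⟨hy.1.le, hy.2⟩, rfl⟩, ha.trans_lt hy.1, hy.2.trans_le hb⟩

theorem Irrational.unifDistribMod1 {x : ℝ} (hx : Irrational x) :
    UnifDistribMod1 (fun k : ℕ => Int.fract (k * x)) := by
  intro a b ha hab hb
  have h := ProbabilityMeasure.tendsto_measure_of_null_frontier_of_tendsto'
    hx.tendsto_empiricalMeasure (UnitAddCircle.volume_frontier_image_Ico a b)
  rw [ProbabilityMeasure.coe_mk, UnitAddCircle.volume_image_Ico ha hb] at h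
  replace h := (ENNReal.tendsto_toReal ENNReal.ofReal_ne_top).comp h
  rw [ENNReal.toReal_ofReal (sub_nonneg.2 hab.le)] at h
  rw [← tendsto_add_atTop_iff_nat 1]
  refine h.congr fun N => ?_
  classical
  simp only [Function.comp_apply, coe_empiricalMeasure, Measure.smul_apply,
    Measure.finsetSum_apply, Measure.dirac_apply, Set.indicator_apply,
    UnitAddCircle.coe_mem_image_Ico_iff ha hb, Pi.one_apply, smul_eq_mul, ENNReal.toReal_mul,
    ENNReal.toReal_inv, ENNReal.toReal_natCast]
  rw [ENNReal.toReal_sum fun k _ => by split_ifs <;> simp, div_eq_inv_mul]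
  congr 1
  refine Finset.sum_congr rfl fun k _ => ?_
  split_ifs <;> simp

theorem Rat.not_unifDistribMod1 (q : ℚ) :
    ¬ UnifDistribMod1 (fun k : ℕ => Int.fract (k * (q : ℝ))) := by
  intro h
  have hd : (0 : ℝ) < q.den := by exact_mod_cast q.den_pos
  have hd1 : (1 : ℝ) ≤ q.den := by exact_mod_cast q.den_pos
  have hlt : 1 / (2 * q.den : ℝ) < 1 / q.den := by gcongr; linarith
  have hlim := h (1 / (2 * q.den)) (1 / q.den) (by positivity) hlt ((div_le_one hd).2 hd1)
  have hzero (k : ℕ) : (Set.Ico (1 / (2 * q.den : ℝ)) (1 / q.den)).indicator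
      (fun _ => (1 : ℝ)) (Int.fract (k * (q : ℝ))) = 0 := by
    refine Set.indicator_of_notMem (fun hk => ?_) _
    have hfract : Int.fract (k * (q : ℝ)) * q.den =
        ((k * q.num - ⌊(k * (q : ℝ))⌋ * q.den : ℤ) : ℝ) := by
      have : (q : ℝ) * q.den = q.num := by exact_mod_cast q.mul_den_eq_num
      rw [← Int.self_sub_floor]
      push_cast
      rw [← this]
      ring
    have hpos : 0 < Int.fract (k * (q : ℝ)) * q.den :=
      mul_pos ((by positivity : (0 : ℝ) < 1 / (2 * q.den)).trans_le hk.1) hd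
    have hlt1 : Int.fract (k * (q : ℝ)) * q.den < 1 := (lt_div_iff₀ hd).1 hk.2
    rw [hfract] at hpos hlt1
    norm_cast at hpos hlt1
    omega
  simp only [hzero, Finset.sum_const_zero, zero_div] at hlim
  exact (sub_pos.2 hlt).ne (tendsto_nhds_unique tendsto_const_nhds hlim)

/-- The sequence of fractional parts `(⟨k x⟩)_{k ≥ 1}` is uniformly distributed modulo 1
if and only if `x` is irrational. -/
theorem unifDistribMod1_fract_mul_iff_irrational (x : ℝ) :
    UnifDistribMod1 (fun k : ℕ => Int.fract (k * x)) ↔ Irrational x := by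
  refine ⟨?_, Irrational.unifDistribMod1⟩
  rintro h ⟨q, rfl⟩
  exact q.not_unifDistribMod1 h
end

section
/- Let n_1, …, n_N be distinct positive integers and let h be a nonzero integer. Then ∫_0^1 max_{1 ≤ M ≤ N} ( ∑_{k=1}^M cos(2π h n_k x) )^2 dx ≤ (log_2 N + 2)^2 · N. -/
open MeasureTheory Filter Real

/-- The sum of squares of dyadic block sums that dominates the partial sums of `f` over
`[a, a + 2 ^ m)` in the Rademacher–Menshov argument. -/
def dyadicSquareSum (f : ℕ → ℝ) : ℕ → ℕ → ℝ
  | 0, a => f a ^ 2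
  | m + 1, a => (∑ k ∈ Finset.Ico a (a + 2 ^ m), f k) ^ 2 + dyadicSquareSum f m a +
      dyadicSquareSum f m (a + 2 ^ m)

theorem dyadicSquareSum_nonneg (f : ℕ → ℝ) (m a : ℕ) : 0 ≤ dyadicSquareSum f m a := by
  induction m generalizing a with
  | zero => exact sq_nonneg _
  | succ m ih =>
    have h1 := ih a
    have h2 := ih (a + 2 ^ m)
    simp only [dyadicSquareSum]
    positivity

theorem sq_partial_sum_le_dyadicSquareSum (f : ℕ → ℝ) (m a M : ℕ) (hM : M ≤ 2 ^ m) :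
    (∑ k ∈ Finset.Ico a (a + M), f k) ^ 2 ≤ (m + 1) * dyadicSquareSum f m a := by
  induction m generalizing a M with
  | zero =>
    have hM' : M = 0 ∨ M = 1 := by
      rw [pow_zero] at hM
      omega
    rcases hM' with rfl | rfl
    · simpa [dyadicSquareSum] using sq_nonneg (f a)
    · simp [dyadicSquareSum]
  | succ m ih =>
    have h1 := dyadicSquareSum_nonneg f m a
    have h2 := dyadicSquareSum_nonneg f m (a + 2 ^ m)
    have hm : (0 : ℝ) ≤ m := m.cast_nonneg
    simp only [dyadicSquareSum]
    push_cast
    by_cases hle : M ≤ 2 ^ m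
    · refine (ih a M hle).trans ?_
      gcongr
      · linarith
      · nlinarith [sq_nonneg (∑ k ∈ Finset.Ico a (a + 2 ^ m), f k)]
    · have hT := ih (a + 2 ^ m) (M - 2 ^ m) (by rw [pow_succ] at hM; omega)
      have he : a + 2 ^ m + (M - 2 ^ m) = a + M := by omega
      rw [he] at hT
      rw [← Finset.sum_Ico_consecutive f (by omega : a ≤ a + 2 ^ m)
        (by omega : a + 2 ^ m ≤ a + M)]
      set A := ∑ k ∈ Finset.Ico a (a + 2 ^ m), f k
      set T := ∑ k ∈ Finset.Ico (a + 2 ^ m) (a + M), f k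
      set Q := dyadicSquareSum f m (a + 2 ^ m)
      have hAT : (A + T) ^ 2 ≤ (m + 2) * (A ^ 2 + Q) := by
        refine le_of_mul_le_mul_left ?_ (by positivity : (0 : ℝ) < m + 1)
        nlinarith [sq_nonneg ((m + 1) * A - T),
          mul_le_mul_of_nonneg_left hT (by positivity : (0 : ℝ) ≤ m + 2)]
      nlinarith [mul_nonneg hm h1]

theorem continuous_dyadicSquareSum {f : ℕ → ℝ → ℝ} (hf : ∀ k, Continuous (f k)) (m a : ℕ) :
    Continuous fun x => dyadicSquareSum (fun k => f k x) m a := by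
  induction m generalizing a with
  | zero => exact (hf a).pow 2
  | succ m ih =>
    exact (((continuous_finsetSum _ fun k _ => hf k).pow 2).add (ih a)).add (ih (a + 2 ^ m))

theorem integral_sq_sum_of_orthogonal {f : ℕ → ℝ → ℝ} (hf : ∀ k, Continuous (f k))
    (horth : ∀ i j, i ≠ j → ∫ x in (0 : ℝ)..1, f i x * f j x = 0) (s : Finset ℕ) :
    ∫ x in (0 : ℝ)..1, (∑ k ∈ s, f k x) ^ 2 = ∑ k ∈ s, ∫ x in (0 : ℝ)..1, f k x ^ 2 := by
  have hc (i j : ℕ) : Continuous fun x => f i x * f j x := (hf i).mul (hf j)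
  simp_rw [sq, Finset.sum_mul_sum]
  rw [intervalIntegral.integral_finsetSum fun i _ =>
    (continuous_finsetSum _ fun j _ => hc i j).intervalIntegrable _ _]
  refine Finset.sum_congr rfl fun i hi => ?_
  rw [intervalIntegral.integral_finsetSum fun j _ => (hc i j).intervalIntegrable _ _]
  exact Finset.sum_eq_single_of_mem i hi fun j _ hj => horth i j hj.symm

theorem integral_dyadicSquareSum_le {f : ℕ → ℝ → ℝ} (hf : ∀ k, Continuous (f k))
    (horth : ∀ i j, i ≠ j → ∫ x in (0 : ℝ)..1, f i x * f j x = 0) (m a : ℕ) :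
    ∫ x in (0 : ℝ)..1, dyadicSquareSum (fun k => f k x) m a ≤
      (m + 1) * ∑ k ∈ Finset.Ico a (a + 2 ^ m), ∫ x in (0 : ℝ)..1, f k x ^ 2 := by
  induction m generalizing a with
  | zero => simp [dyadicSquareSum]
  | succ m ih =>
    have hQ := continuous_dyadicSquareSum hf m
    have hA : Continuous fun x => (∑ k ∈ Finset.Ico a (a + 2 ^ m), f k x) ^ 2 :=
      (continuous_finsetSum _ fun k _ => hf k).pow 2
    have h1 := ih a
    have h2 := ih (a + 2 ^ m)
    have he : a + 2 ^ m + 2 ^ m = a + 2 ^ (m + 1) := by ring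
    rw [he] at h2
    have hpos : 0 ≤ ∑ k ∈ Finset.Ico (a + 2 ^ m) (a + 2 ^ (m + 1)),
        ∫ x in (0 : ℝ)..1, f k x ^ 2 :=
      Finset.sum_nonneg fun k _ =>
        intervalIntegral.integral_nonneg zero_le_one fun x _ => sq_nonneg _
    have hsplit := Finset.sum_Ico_consecutive (fun k => ∫ x in (0 : ℝ)..1, f k x ^ 2)
      (Nat.le_add_right a (2 ^ m)) (Nat.le_add_right (a + 2 ^ m) (2 ^ m))
    rw [he] at hsplit
    simp only [dyadicSquareSum]
    have hAQ : Continuous fun x => (∑ k ∈ Finset.Ico a (a + 2 ^ m), f k x) ^ 2 +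
        dyadicSquareSum (fun k => f k x) m a := hA.add (hQ a)
    rw [intervalIntegral.integral_add (hAQ.intervalIntegrable _ _)
      ((hQ _).intervalIntegrable _ _),
      intervalIntegral.integral_add (hA.intervalIntegrable _ _) ((hQ a).intervalIntegrable _ _),
      integral_sq_sum_of_orthogonal hf horth,
      ← hsplit]
    push_cast
    linarith

theorem integral_cos_two_pi_int_mul {m : ℤ} (hm : m ≠ 0) :
    ∫ x in (0 : ℝ)..1, Real.cos (2 * π * m * x) = 0 := by
  have hc : 2 * π * (m : ℝ) ≠ 0 :=
    mul_ne_zero two_pi_pos.ne' (Int.cast_ne_zero.mpr hm)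
  rw [intervalIntegral.integral_comp_mul_left _ hc, integral_cos]
  have hs : Real.sin (2 * π * m) = 0 := by
    have := Real.sin_int_mul_pi (2 * m)
    rw [← this]
    push_cast
    ring_nf
  rw [mul_one, mul_zero, hs, Real.sin_zero, sub_zero, smul_zero]

theorem integral_cos_mul_cos_eq_zero {h : ℤ} (hh : h ≠ 0) {p q : ℕ} (hp : 0 < p) (hpq : p ≠ q) :
    ∫ x in (0 : ℝ)..1, Real.cos (2 * π * h * p * x) * Real.cos (2 * π * h * q * x) = 0 := by
  have hsub : h * ((p : ℤ) - q) ≠ 0 := mul_ne_zero hh (by omega)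
  have hadd : h * ((p : ℤ) + q) ≠ 0 := mul_ne_zero hh (by omega)
  have key (x : ℝ) : Real.cos (2 * π * h * p * x) * Real.cos (2 * π * h * q * x) =
      (Real.cos (2 * π * (h * ((p : ℤ) - q) : ℤ) * x) +
        Real.cos (2 * π * (h * ((p : ℤ) + q) : ℤ) * x)) / 2 := by
    have e1 : 2 * π * (h * ((p : ℤ) - q) : ℤ) * x =
        2 * π * h * p * x - 2 * π * h * q * x := by push_cast; ring
    have e2 : 2 * π * (h * ((p : ℤ) + q) : ℤ) * x =
        2 * π * h * p * x + 2 * π * h * q * x := by push_cast; ring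
    rw [e1, e2, Real.cos_sub, Real.cos_add]
    ring
  simp_rw [key]
  rw [intervalIntegral.integral_div, intervalIntegral.integral_add
    (Continuous.intervalIntegrable (by fun_prop) _ _)
    (Continuous.intervalIntegrable (by fun_prop) _ _),
    integral_cos_two_pi_int_mul hsub, integral_cos_two_pi_int_mul hadd]
  simp

/-- For distinct positive integers `n_1, …, n_N` and a nonzero integer `h`,
`∫₀¹ max_{1 ≤ M ≤ N} (∑_{k=1}^M cos(2π h n_k x))² dx ≤ (log₂ N + 2)² · N`. -/
theorem maximal_cosine_sum_bound (N : ℕ) (hN : 1 ≤ N) (n : ℕ → ℕ)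
    (hpos : ∀ k ∈ Finset.Icc 1 N, 0 < n k)
    (hinj : ∀ k ∈ Finset.Icc 1 N, ∀ l ∈ Finset.Icc 1 N, n k = n l → k = l)
    (h : ℤ) (hh : h ≠ 0) :
    (∫ x in (0:ℝ)..1,
        (Finset.Icc 1 N).sup' (Finset.nonempty_Icc.mpr hN)
          (fun M => (∑ k ∈ Finset.Icc 1 M,
            Real.cos (2 * Real.pi * (h : ℝ) * (n k : ℝ) * x)) ^ 2))
      ≤ (Real.logb 2 N + 2) ^ 2 * N := by
  set f : ℕ → ℝ → ℝ := fun k x =>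
    if k ∈ Finset.Icc 1 N then Real.cos (2 * π * h * n k * x) else 0 with hf_def
  have hf (k : ℕ) : Continuous (f k) := by
    by_cases hk : k ∈ Finset.Icc 1 N
    · simp only [hf_def, if_pos hk]
      fun_prop
    · simp only [hf_def, if_neg hk]
      exact continuous_const
  have horth (i j : ℕ) (hij : i ≠ j) : ∫ x in (0 : ℝ)..1, f i x * f j x = 0 := by
    by_cases hi : i ∈ Finset.Icc 1 N
    · by_cases hj : j ∈ Finset.Icc 1 N
      · simp only [hf_def, if_pos hi, if_pos hj]
        exact integral_cos_mul_cos_eq_zero hh (hpos i hi) fun e => hij (hinj i hi j hj e)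
      · simp only [hf_def, if_neg hj, mul_zero, intervalIntegral.integral_zero]
    · simp only [hf_def, if_neg hi, zero_mul, intervalIntegral.integral_zero]
  set m := Nat.clog 2 N
  have hNm : N ≤ 2 ^ m := Nat.le_pow_clog one_lt_two N
  have hlog0 : 0 ≤ Real.logb 2 N := Real.logb_nonneg one_lt_two (by exact_mod_cast hN)
  have hm : (m : ℝ) + 1 ≤ Real.logb 2 N + 2 := by
    have h1 := Nat.ceil_lt_add_one hlog0
    have h2 : ⌈Real.logb 2 N⌉₊ = m := by
      have := Real.natCeil_logb_natCast 2 N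
      exact_mod_cast this
    rw [h2] at h1
    linarith
  have hsq (k : ℕ) : ∫ x in (0 : ℝ)..1, f k x ^ 2 ≤ if k ∈ Finset.Icc 1 N then 1 else 0 := by
    by_cases hk : k ∈ Finset.Icc 1 N
    · simp only [hf_def, if_pos hk]
      have := intervalIntegral.integral_mono_on (μ := volume) (zero_le_one' ℝ)
        (Continuous.intervalIntegrable
          (by fun_prop : Continuous fun x => Real.cos (2 * π * h * n k * x) ^ 2) _ _)
        (intervalIntegrable_const (c := (1 : ℝ))) fun x _ => Real.cos_sq_le_one _
      simpa using this
    · simp only [hf_def, if_neg hk]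
      simp
  have hsum : ∑ k ∈ Finset.Ico 1 (1 + 2 ^ m), ∫ x in (0 : ℝ)..1, f k x ^ 2 ≤ N := by
    refine (Finset.sum_le_sum fun k _ => hsq k).trans ?_
    rw [← Finset.sum_filter, Finset.sum_const, nsmul_eq_mul, mul_one]
    have : (Finset.filter (· ∈ Finset.Icc 1 N) (Finset.Ico 1 (1 + 2 ^ m))).card ≤
        (Finset.Icc 1 N).card :=
      Finset.card_le_card fun k hk => (Finset.mem_filter.mp hk).2
    rw [Nat.card_Icc, Nat.add_sub_cancel] at this
    exact_mod_cast this
  have hQ := continuous_dyadicSquareSum hf m 1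
  calc _ ≤ ∫ x in (0 : ℝ)..1, (m + 1) * dyadicSquareSum (fun k => f k x) m 1 := by
        refine intervalIntegral.integral_mono_on zero_le_one ?_
          ((continuous_const.mul hQ).intervalIntegrable _ _) fun x _ => ?_
        · exact (Continuous.finset_sup'_apply _ fun M _ => by fun_prop).intervalIntegrable _ _
        · refine Finset.sup'_le _ _ fun M hM => ?_
          have hMN := (Finset.mem_Icc.mp hM).2
          refine le_trans (le_of_eq ?_) (sq_partial_sum_le_dyadicSquareSum (fun k => f k x) m 1 M
            (hMN.trans hNm))
          congr 1
          refine Finset.sum_congr (by ext; simp only [Finset.mem_Icc, Finset.mem_Ico]; omega)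
            fun k hk => ?_
          simp only [Finset.mem_Ico] at hk
          rw [hf_def]
          exact (if_pos (Finset.mem_Icc.mpr ⟨by omega, by omega⟩)).symm
    _ = (m + 1) * ∫ x in (0 : ℝ)..1, dyadicSquareSum (fun k => f k x) m 1 :=
        intervalIntegral.integral_const_mul _ _
    _ ≤ (m + 1) * ((m + 1) * N) := by
        gcongr
        exact (integral_dyadicSquareSum_le hf horth m 1).trans (by gcongr)
    _ = ((m : ℝ) + 1) ^ 2 * N := by ring
    _ ≤ _ := by gcongr
end

section
/- (Borel's normal number theorem) Let b ≥ 2 be an integer. Then for Lebesgue-almost all x ∈ [0,1], for every integer d ≥ 1 and every integer a with 0 ≤ a ≤ b^d − 1, one has lim_{N → ∞} (1/N) ∑_{k=1}^N 1_{[a b^{−d}, (a+1) b^{−d})}(⟨b^{k−1} x⟩) = b^{−d}. -/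
open MeasureTheory Filter

open ProbabilityTheory

/-- The integral of a dilated `1`-periodic function over an interval whose dilated length is
an integer multiple of the period. -/
lemma intervalIntegral_periodic_comp_mul {f : ℝ → ℝ} (hf : Function.Periodic f 1)
    (hint : ∀ s t, IntervalIntegrable f volume s t) {D K : ℕ} (hD : 0 < D) (hK : 0 < K) (a : ℕ) :
    ∫ x in (a / D : ℝ)..((a + 1) / D), f ((K * D : ℕ) * x) =
      (D : ℝ)⁻¹ * ∫ x in (0 : ℝ)..1, f x := by
  have hD' : (D : ℝ) ≠ 0 := by positivity
  have hK' : (K : ℝ) ≠ 0 := by positivity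
  rw [intervalIntegral.integral_comp_mul_left _ (by positivity)]
  have h1 : ((K * D : ℕ) : ℝ) * (a / D) = (K * a : ℕ) := by push_cast; field_simp
  have h2 : ((K * D : ℕ) : ℝ) * ((a + 1) / D) = (K * a : ℕ) + (K : ℤ) • (1 : ℝ) := by
    push_cast; simp; field_simp
  rw [h1, h2, hf.intervalIntegral_add_zsmul_eq _ _ hint, hf.intervalIntegral_add_eq _ 0]
  simp only [Nat.cast_mul, zsmul_eq_mul, Int.cast_natCast, smul_eq_mul, zero_add]
  field_simp

/-- Multiplication by a positive integer preserves the distribution of `1`-periodic functions. -/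
lemma identDistrib_periodic_comp_mul {β : Type*} [MeasurableSpace β] {g : ℝ → β}
    (hg : Function.Periodic g 1) (hm : Measurable g) {n : ℕ} (hn : 0 < n) :
    IdentDistrib (fun x => g (n * x)) g (volume.restrict (Set.Ico (0 : ℝ) 1))
      (volume.restrict (Set.Ico (0 : ℝ) 1)) := by
  have hm' : Measurable fun x : ℝ => g (n * x) := hm.comp (measurable_const_mul _)
  refine ⟨hm'.aemeasurable, hm.aemeasurable, ?_⟩
  ext s hs
  rw [Measure.map_apply hm' hs, Measure.map_apply hm hs]
  have hB : MeasurableSet (g ⁻¹' s) := hm hs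
  have hper : Function.Periodic ((g ⁻¹' s).indicator (fun _ => (1 : ℝ))) 1 :=
    hg.comp (s.indicator fun _ => (1 : ℝ))
  have hint : ∀ u v, IntervalIntegrable ((g ⁻¹' s).indicator (fun _ => (1 : ℝ))) volume u v :=
    fun u v => ⟨(integrable_const _).indicator hB, (integrable_const _).indicator hB⟩
  have key := intervalIntegral_periodic_comp_mul hper hint one_pos hn 0
  have hB' : MeasurableSet ((fun x : ℝ => g (n * x)) ⁻¹' s) := hm' hs
  have e : ∀ x : ℝ, (g ⁻¹' s).indicator (fun _ => (1 : ℝ)) (n * x) =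
    ((fun x : ℝ => g (n * x)) ⁻¹' s).indicator 1 x := fun x => rfl
  simp only [mul_one, Nat.cast_zero, Nat.cast_one, div_one, zero_add, inv_one, one_mul, e,
    intervalIntegral.integral_of_le zero_le_one, ← restrict_Ico_eq_restrict_Ioc] at key
  rw [integral_indicator_one hB', integral_indicator_const _ hB, smul_eq_mul, mul_one] at key
  exact (measureReal_eq_measureReal_iff).1 key

/-- Averages along residue classes modulo `d` determine the average of the sequence. -/
lemma tendsto_average_of_residue_classes {u : ℕ → ℝ} {d : ℕ} {L : ℝ} (hd : 0 < d)
    (h : ∀ r < d, Tendsto (fun n : ℕ => (∑ j ∈ Finset.range n, u (r + j * d)) / n) atTop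
      (nhds L)) :
    Tendsto (fun n : ℕ => (∑ k ∈ Finset.range n, u k) / n) atTop (nhds L) := by
  have split : ∀ N, ∑ k ∈ Finset.range N, u k =
      ∑ r ∈ Finset.range d, ∑ j ∈ Finset.range ((N + (d - 1 - r)) / d), u (r + j * d) := by
    intro N
    induction N with
    | zero =>
      symm
      simp only [Finset.range_zero, Finset.sum_empty, zero_add]
      refine Finset.sum_eq_zero fun r hr => ?_
      rw [Nat.div_eq_of_lt (by omega)]; simp
    | succ N ih =>
      have step : ∀ r ∈ Finset.range d,
          ∑ j ∈ Finset.range ((N + 1 + (d - 1 - r)) / d), u (r + j * d) =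
          ∑ j ∈ Finset.range ((N + (d - 1 - r)) / d), u (r + j * d) +
            if r = N % d then u N else 0 := by
        intro r hr
        rw [Finset.mem_range] at hr
        have hN := Nat.mod_add_div N d
        have hlt := Nat.mod_lt N hd
        split_ifs with hc
        · have e1 : (N + (d - 1 - r)) / d = N / d := by
            rw [Nat.div_eq_iff hd]; rw [mul_comm]; omega
          have e2 : (N + 1 + (d - 1 - r)) / d = N / d + 1 := by
            rw [Nat.div_eq_iff hd, Nat.add_mul, mul_comm]; omega
          rw [e1, e2, Finset.sum_range_succ, hc, mul_comm (N / d), hN]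
        · rw [add_zero]
          congr 2
          rw [show N + 1 + (d - 1 - r) = (N + (d - 1 - r)) + 1 by omega,
            Nat.succ_div_of_not_dvd]
          rintro ⟨c, hc'⟩
          apply hc
          have : N + d = r + d * c := by omega
          rw [← Nat.add_mod_right, this, Nat.add_mul_mod_self_left, Nat.mod_eq_of_lt hr]
      rw [Finset.sum_range_succ, ih, Finset.sum_congr rfl step, Finset.sum_add_distrib]
      simp [Nat.mod_lt N hd]
  have hd' : (0 : ℝ) < d := by exact_mod_cast hd
  have count : ∀ r, Tendsto (fun N : ℕ => (((N + (d - 1 - r)) / d : ℕ) : ℝ) / N) atTop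
      (nhds (1 / d)) := by
    intro r
    have lo : Tendsto (fun N : ℕ => (1 / d : ℝ) - 1 / N) atTop (nhds (1 / d)) := by
      simpa using tendsto_const_nhds.sub (tendsto_one_div_atTop_nhds_zero_nat (𝕜 := ℝ))
    have hi : Tendsto (fun N : ℕ => (1 / d : ℝ) + 1 / N) atTop (nhds (1 / d)) := by
      simpa using tendsto_const_nhds.add (tendsto_one_div_atTop_nhds_zero_nat (𝕜 := ℝ))
    refine tendsto_of_tendsto_of_tendsto_of_le_of_le' lo hi ?_ ?_ <;>
      filter_upwards [eventually_gt_atTop 0] with N hN <;>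
      have hN' : (0 : ℝ) < N := by exact_mod_cast hN
    · have h1 : N ≤ d * ((N + (d - 1 - r)) / d) + d := by
        have := Nat.lt_mul_div_succ (N + (d - 1 - r)) hd
        rw [mul_add] at this; omega
      have h2 : (N : ℝ) ≤ d * (((N + (d - 1 - r)) / d : ℕ) : ℝ) + d := by exact_mod_cast h1
      rw [div_sub_div _ _ hd'.ne' hN'.ne', div_le_div_iff₀ (by positivity) hN']
      nlinarith
    · have h1 : d * ((N + (d - 1 - r)) / d) ≤ N + d := by
        have := Nat.mul_div_le (N + (d - 1 - r)) d
        omega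
      have h2 : d * (((N + (d - 1 - r)) / d : ℕ) : ℝ) ≤ N + d := by exact_mod_cast h1
      rw [div_add_div _ _ hd'.ne' hN'.ne', div_le_div_iff₀ hN' (by positivity)]
      nlinarith
  have lim : Tendsto (fun N : ℕ => ∑ r ∈ Finset.range d,
      (∑ j ∈ Finset.range ((N + (d - 1 - r)) / d), u (r + j * d)) /
        (((N + (d - 1 - r)) / d : ℕ) : ℝ) * ((((N + (d - 1 - r)) / d : ℕ) : ℝ) / N)) atTop
      (nhds (∑ r ∈ Finset.range d, L * (1 / d))) := by
    refine tendsto_finsetSum _ fun r hr => Tendsto.mul ?_ (count r)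
    refine (h r (Finset.mem_range.1 hr)).comp ?_
    exact (Nat.tendsto_div_const_atTop hd.ne').comp (tendsto_add_atTop_nat _)
  have hL : ∑ r ∈ Finset.range d, L * (1 / (d : ℝ)) = L := by
    simp; field_simp
  rw [hL] at lim
  refine lim.congr fun N => ?_
  rw [split, Finset.sum_div]
  refine Finset.sum_congr rfl fun r _ => ?_
  rcases Nat.eq_zero_or_pos ((N + (d - 1 - r)) / d) with h0 | h0
  · simp [h0]
  · have : (((N + (d - 1 - r)) / d : ℕ) : ℝ) ≠ 0 := by positivity
    field_simp

/-- The indicator of `⟨x⟩ ∈ [a / D, (a + 1) / D)` is independent of every `1`-periodic function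
of `K D x`. -/
lemma indepFun_indicator_fract_periodic_comp_mul {β : Type*} [MeasurableSpace β] {h : ℝ → β}
    (hper : Function.Periodic h 1) (hm : Measurable h) {D K a : ℕ} (ha : a < D) (hK : 0 < K) :
    IndepFun
      (fun x : ℝ => (Set.Ico (a / D : ℝ) ((a + 1) / D)).indicator (fun _ => (1 : ℝ)) (Int.fract x))
      (fun x : ℝ => h ((K * D : ℕ) * x)) (volume.restrict (Set.Ico (0 : ℝ) 1)) := by
  have hD : 0 < D := by omega
  have hD' : (0 : ℝ) < D := by exact_mod_cast hD
  have : IsProbabilityMeasure (volume.restrict (Set.Ico (0 : ℝ) 1)) := ⟨by simp⟩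
  set A := Set.Ico (a / D : ℝ) ((a + 1) / D)
  have hA : MeasurableSet A := measurableSet_Ico
  have hA' : MeasurableSet (Int.fract ⁻¹' A : Set ℝ) := measurable_fract hA
  have hle : (a / D : ℝ) ≤ (a + 1) / D := by gcongr; linarith
  have hsub : A ⊆ Set.Ico 0 1 := by
    refine Set.Ico_subset_Ico (by positivity) ?_
    rw [div_le_one hD']
    exact_mod_cast ha
  have hinter : (Int.fract ⁻¹' A : Set ℝ) ∩ Set.Ico 0 1 = A := by
    ext x
    constructor
    · rintro ⟨h1, h2⟩
      rwa [Set.mem_preimage, Int.fract_eq_self.2 h2] at h1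
    · intro hx
      exact ⟨by rwa [Set.mem_preimage, Int.fract_eq_self.2 (hsub hx)], hsub hx⟩
  have hm' : Measurable fun x : ℝ => h ((K * D : ℕ) * x) := hm.comp (measurable_const_mul _)
  have hmg : Measurable fun x : ℝ => A.indicator (fun _ => (1 : ℝ)) (Int.fract x) :=
    (measurable_const.indicator hA).comp measurable_fract
  rw [indepFun_iff_indepSet_preimage hmg hm']
  intro s t hs ht
  suffices hind : IndepSet (Int.fract ⁻¹' A : Set ℝ) ((fun x : ℝ => h ((K * D : ℕ) * x)) ⁻¹' t)
      (volume.restrict (Set.Ico (0 : ℝ) 1)) by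
    rw [IndepSet_iff_Indep] at hind ⊢
    refine indep_of_indep_of_le_left hind (MeasurableSpace.generateFrom_le ?_)
    rintro _ rfl
    exact (measurable_const.indicator (MeasurableSpace.measurableSet_generateFrom rfl) :
      Measurable[MeasurableSpace.generateFrom {(Int.fract ⁻¹' A : Set ℝ)}]
        ((Int.fract ⁻¹' A : Set ℝ).indicator fun _ => (1 : ℝ))) hs
  have hB : MeasurableSet (h ⁻¹' t) := hm ht
  have hB' : MeasurableSet ((fun x : ℝ => h ((K * D : ℕ) * x)) ⁻¹' t) := hm' ht
  rw [indepSet_iff_measure_inter_eq_mul hA' hB' (volume.restrict (Set.Ico (0 : ℝ) 1)),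
    (identDistrib_periodic_comp_mul hper hm (Nat.mul_pos hK hD)).measure_mem_eq ht,
    Measure.restrict_apply hA', Measure.restrict_apply (hA'.inter hB'),
    Set.inter_right_comm, hinter]
  have hperB : Function.Periodic ((h ⁻¹' t).indicator (fun _ => (1 : ℝ))) 1 :=
    hper.comp (t.indicator fun _ => (1 : ℝ))
  have hint : ∀ u v, IntervalIntegrable ((h ⁻¹' t).indicator (fun _ => (1 : ℝ))) volume u v :=
    fun u v => ⟨(integrable_const _).indicator hB, (integrable_const _).indicator hB⟩
  have key := intervalIntegral_periodic_comp_mul hperB hint hD hK a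
  have e : ∀ x : ℝ, (h ⁻¹' t).indicator (fun _ => (1 : ℝ)) ((K * D : ℕ) * x) =
      ((fun x : ℝ => h ((K * D : ℕ) * x)) ⁻¹' t).indicator 1 x := fun x => rfl
  simp only [e, intervalIntegral.integral_of_le zero_le_one, intervalIntegral.integral_of_le hle,
    ← restrict_Ico_eq_restrict_Ioc] at key
  rw [integral_indicator_one hB', integral_indicator_const _ hB, smul_eq_mul, mul_one] at key
  have hvol : volume A = ENNReal.ofReal (D : ℝ)⁻¹ := by
    rw [Real.volume_Ico]; congr 1; field_simp; ring
  have hfin : volume (A ∩ (fun x : ℝ => h ((K * D : ℕ) * x)) ⁻¹' t) ≠ ⊤ :=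
    measure_ne_top_of_subset Set.inter_subset_left (by rw [hvol]; exact ENNReal.ofReal_ne_top)
  rw [hvol, ← ENNReal.ofReal_toReal hfin,
    ← ENNReal.ofReal_toReal (measure_ne_top (volume.restrict (Set.Ico (0 : ℝ) 1)) (h ⁻¹' t)),
    ← ENNReal.ofReal_mul (by positivity)]
  congr 1
  rw [measureReal_restrict_apply hB', Set.inter_comm] at key
  exact key

/-- For fixed `d` and `a`, the block of `d` base-`b` digits encoded by `a` has asymptotic frequency
`b ^ (-d)` along each residue class of positions modulo `d`, almost surely. -/
lemma ae_tendsto_block_frequency_residue_class {b d a : ℕ} (hb : 0 < b) (ha : a < b ^ d) (r : ℕ) :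
    ∀ᵐ x ∂(volume.restrict (Set.Ico (0 : ℝ) 1)),
      Tendsto (fun n : ℕ => (∑ j ∈ Finset.range n,
        (Set.Ico ((a : ℝ) / (b ^ d : ℕ)) ((a + 1) / (b ^ d : ℕ))).indicator (fun _ => (1 : ℝ))
          (Int.fract ((b ^ (r + j * d) : ℕ) * x))) / n) atTop (nhds ((b ^ d : ℕ) : ℝ)⁻¹) := by
  have : IsProbabilityMeasure (volume.restrict (Set.Ico (0 : ℝ) 1)) := ⟨by simp⟩
  set D := b ^ d with hDdef
  have hD : 0 < D := by positivity
  set g : ℝ → ℝ := fun x =>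
    (Set.Ico ((a : ℝ) / D) ((a + 1) / D)).indicator (fun _ => (1 : ℝ)) (Int.fract x)
  have hmg : Measurable g := (measurable_const.indicator measurableSet_Ico).comp measurable_fract
  have hgper : Function.Periodic g 1 := fun x => by simp [g]
  have hident : ∀ m : ℕ, IdentDistrib (fun x => g ((b ^ m : ℕ) * x)) g
      (volume.restrict (Set.Ico (0 : ℝ) 1)) (volume.restrict (Set.Ico (0 : ℝ) 1)) :=
    fun m => identDistrib_periodic_comp_mul hgper hmg (by positivity)
  have hbdd : Integrable g (volume.restrict (Set.Ico (0 : ℝ) 1)) := by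
    refine Integrable.of_bound hmg.aestronglyMeasurable 1 (Eventually.of_forall fun x => ?_)
    simp only [g, Set.indicator]
    split_ifs <;> simp
  have hindep : ∀ i j : ℕ, i < j → IndepFun (fun x => g ((b ^ (r + i * d) : ℕ) * x))
      (fun x => g ((b ^ (r + j * d) : ℕ) * x)) (volume.restrict (Set.Ico (0 : ℝ) 1)) := by
    intro i j hij
    obtain ⟨k, rfl⟩ := Nat.exists_eq_add_of_lt hij
    have h0 := indepFun_indicator_fract_periodic_comp_mul hgper hmg ha
      (K := b ^ (k * d)) (by positivity)
    have hpair : IdentDistrib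
        (fun x => (fun y : ℝ => (g y, g ((b ^ (k * d) * D : ℕ) * y))) ((b ^ (r + i * d) : ℕ) * x))
        (fun y : ℝ => (g y, g ((b ^ (k * d) * D : ℕ) * y)))
        (volume.restrict (Set.Ico (0 : ℝ) 1)) (volume.restrict (Set.Ico (0 : ℝ) 1)) := by
      refine identDistrib_periodic_comp_mul (fun x => ?_)
        (hmg.prodMk (hmg.comp (measurable_const_mul _))) (by positivity)
      have := hgper.nat_mul (b ^ (k * d) * D) (((b ^ (k * d) * D : ℕ) : ℝ) * x)
      rw [mul_one] at this
      simp only [Function.comp_apply, mul_add, mul_one, this, hgper x]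
    have := indepFun_of_identDistrib_pair h0 hpair.symm
    convert this using 3 with x
    rw [← mul_assoc, ← Nat.cast_mul, hDdef]
    congr 3
    ring
  have hslln := strong_law_ae_real (μ := volume.restrict (Set.Ico (0 : ℝ) 1))
    (fun j x => g ((b ^ (r + j * d) : ℕ) * x)) ((hident _).symm.integrable_snd hbdd)
    (fun i j hij => (lt_or_gt_of_ne hij).elim (hindep i j) fun h => (hindep j i h).symm)
    (fun i => (hident _).trans (hident _).symm)
  have hmean : ∫ x in Set.Ico (0 : ℝ) 1, g ((b ^ (r + 0 * d) : ℕ) * x) = (D : ℝ)⁻¹ := by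
    have hD' : (0 : ℝ) < D := by exact_mod_cast hD
    have hsub : Set.Ico ((a : ℝ) / D) ((a + 1) / D) ⊆ Set.Ico 0 1 := by
      refine Set.Ico_subset_Ico (by positivity) ?_
      rw [div_le_one hD']
      exact_mod_cast ha
    rw [(hident _).integral_eq, setIntegral_congr_fun measurableSet_Ico
      (g := (Set.Ico ((a : ℝ) / D) ((a + 1) / D)).indicator fun _ => (1 : ℝ))
      (fun x hx => by simp only [g, Int.fract_eq_self.2 hx]),
      integral_indicator_const _ measurableSet_Ico,
      measureReal_restrict_apply measurableSet_Ico, Set.inter_eq_left.2 hsub,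
      Real.volume_real_Ico_of_le (by gcongr; linarith)]
    simp only [smul_eq_mul, mul_one]
    field_simp
    ring
  rw [hmean] at hslln
  exact hslln

/-- (Borel's normal number theorem) Let `b ≥ 2` be an integer. For almost all `x ∈ [0,1]`,
for every `d ≥ 1` and every integer `a` with `0 ≤ a ≤ b^d - 1`, the proportion of
`k ∈ {1, …, N}` with `⟨b^(k-1) x⟩ ∈ [a b^(-d), (a+1) b^(-d))` tends to `b^(-d)`. -/
theorem borel_normal_numbers (b : ℕ) (hb : 2 ≤ b) :
    ∀ᵐ x ∂(volume.restrict (Set.Icc (0 : ℝ) 1)),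
      ∀ d : ℕ, 1 ≤ d → ∀ a : ℕ, a < b ^ d →
        Tendsto
          (fun N : ℕ =>
            (∑ k ∈ Finset.Icc 1 N,
              (Set.Ico ((a : ℝ) / (b : ℝ) ^ d) (((a : ℝ) + 1) / (b : ℝ) ^ d)).indicator
                (fun _ => (1 : ℝ)) (Int.fract ((b : ℝ) ^ (k - 1) * x))) / N)
          atTop (nhds (((b : ℝ) ^ d)⁻¹)) := by
  rw [← restrict_Ico_eq_restrict_Icc]
  simp only [ae_all_iff]
  intro d hd a ha
  have hres := ae_all_iff.2 fun r =>
    ae_tendsto_block_frequency_residue_class (by omega : 0 < b) ha r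
  filter_upwards [hres] with x hx
  have hlim := tendsto_average_of_residue_classes (u := fun k =>
    (Set.Ico ((a : ℝ) / (b ^ d : ℕ)) ((a + 1) / (b ^ d : ℕ))).indicator (fun _ => (1 : ℝ))
      (Int.fract ((b ^ k : ℕ) * x))) hd fun r _ => hx r
  simp only [Nat.cast_pow] at hlim
  refine hlim.congr fun N => ?_
  rw [← Finset.Ico_add_one_right_eq_Icc, Finset.sum_Ico_eq_sum_range _ 1]
  simp
end

section
/- (Wall's theorem) Let b ≥ 2 be an integer and let x ∈ [0,1]. Then x is normal in base b if and only if the sequence of fractional parts (⟨b^k x⟩)_{k ≥ 1} is uniformly distributed modulo 1. -/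
open MeasureTheory Filter

/-- `x ∈ [0,1]` is normal in the integer base `b ≥ 2` if every block of `d` digits appears
with asymptotic frequency `b^(-d)` in the base-`b` expansion of `x`. -/
def IsNormalInBase (b : ℕ) (x : ℝ) : Prop :=
  ∀ d : ℕ, 1 ≤ d → ∀ a : ℕ, a < b ^ d →
    Tendsto
      (fun N : ℕ =>
        (∑ k ∈ Finset.Icc 1 N,
          (Set.Ico ((a : ℝ) / (b : ℝ) ^ d) (((a : ℝ) + 1) / (b : ℝ) ^ d)).indicator
            (fun _ => (1 : ℝ)) (Int.fract ((b : ℝ) ^ (k - 1) * x))) / N)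
      atTop (nhds (((b : ℝ) ^ d)⁻¹))

/-- The proportion of the terms `u 1, …, u N` that lie in `S`. -/
noncomputable def visitFreq (u : ℕ → ℝ) (S : Set ℝ) (N : ℕ) : ℝ :=
  (∑ k ∈ Finset.Icc 1 N, S.indicator (fun _ => (1 : ℝ)) (u k)) / N

theorem visitFreq_mono (u : ℕ → ℝ) {S T : Set ℝ} (h : S ⊆ T) (N : ℕ) :
    visitFreq u S N ≤ visitFreq u T N := by
  unfold visitFreq
  gcongr

theorem visitFreq_Ico_add (u : ℕ → ℝ) {r s t : ℝ} (hrs : r ≤ s) (hst : s ≤ t) (N : ℕ) :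
    visitFreq u (Set.Ico r s) N + visitFreq u (Set.Ico s t) N = visitFreq u (Set.Ico r t) N := by
  unfold visitFreq
  rw [← add_div, ← Finset.sum_add_distrib, ← Set.Ico_union_Ico_eq_Ico hrs hst]
  congr 1
  refine Finset.sum_congr rfl fun k _ => ?_
  rw [Set.indicator_union_of_disjoint (Set.Ico_disjoint_Ico_same)]

theorem tendsto_visitFreq_shift (u : ℕ → ℝ) (S : Set ℝ) :
    Tendsto (fun N => visitFreq (fun k => u (k - 1)) S N - visitFreq u S N) atTop (nhds 0) := by
  have key : ∀ (f : ℕ → ℝ) (N : ℕ),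
      ∑ k ∈ Finset.Icc 1 N, f (k - 1) - ∑ k ∈ Finset.Icc 1 N, f k = f 0 - f N := by
    intro f N
    induction N with
    | zero => simp
    | succ n ih =>
      rw [Finset.sum_Icc_succ_top (by omega), Finset.sum_Icc_succ_top (by omega)]
      simp only [Nat.add_sub_cancel]
      linarith
  have hS : ∀ y, 0 ≤ S.indicator (fun _ => (1 : ℝ)) y ∧ S.indicator (fun _ => (1 : ℝ)) y ≤ 1 := by
    intro y
    by_cases hy : y ∈ S <;> simp [hy]
  refine squeeze_zero_norm (fun N => ?_) tendsto_one_div_atTop_nhds_zero_nat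
  unfold visitFreq
  rw [← sub_div, key (fun k => S.indicator (fun _ => (1 : ℝ)) (u k)) N, norm_div, Real.norm_natCast]
  gcongr
  rw [Real.norm_eq_abs, abs_le]
  constructor <;> linarith [hS (u 0), hS (u N)]

theorem tendsto_visitFreq_shift_iff (u : ℕ → ℝ) (S : Set ℝ) (c : ℝ) :
    Tendsto (visitFreq (fun k => u (k - 1)) S) atTop (nhds c) ↔
      Tendsto (visitFreq u S) atTop (nhds c) := by
  have h := tendsto_visitFreq_shift u S
  constructor <;> intro h'
  · simpa using h'.sub h
  · simpa using h.add h'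

/-- If the visit frequencies of all `b`-adic intervals converge to their lengths, so do those of
the initial intervals with `b`-adic right endpoint. -/
theorem tendsto_visitFreq_Ico_zero_adic {b : ℕ} {u : ℕ → ℝ} {d : ℕ}
    (h : ∀ a : ℕ, a < b ^ d → Tendsto
      (visitFreq u (Set.Ico ((a : ℝ) / (b : ℝ) ^ d) (((a : ℝ) + 1) / (b : ℝ) ^ d)))
      atTop (nhds (((b : ℝ) ^ d)⁻¹)))
    (n : ℕ) (hn : n ≤ b ^ d) :
    Tendsto (visitFreq u (Set.Ico 0 ((n : ℝ) / (b : ℝ) ^ d))) atTop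
      (nhds ((n : ℝ) / (b : ℝ) ^ d)) := by
  induction n with
  | zero => exact tendsto_const_nhds.congr fun N => by simp [visitFreq]
  | succ n ih =>
    have hsum := (ih (by omega)).add (h n (by omega))
    rw [← one_div, ← add_div] at hsum
    push_cast
    refine hsum.congr fun N => visitFreq_Ico_add u (by positivity) ?_ N
    gcongr
    linarith

theorem tendsto_visitFreq_Ico_zero {b : ℕ} (hb : 2 ≤ b) {u : ℕ → ℝ}
    (h : ∀ d : ℕ, 1 ≤ d → ∀ a : ℕ, a < b ^ d → Tendsto
      (visitFreq u (Set.Ico ((a : ℝ) / (b : ℝ) ^ d) (((a : ℝ) + 1) / (b : ℝ) ^ d)))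
      atTop (nhds (((b : ℝ) ^ d)⁻¹)))
    {t : ℝ} (ht0 : 0 ≤ t) (ht1 : t ≤ 1) :
    Tendsto (visitFreq u (Set.Ico 0 t)) atTop (nhds t) := by
  have hb1 : (1 : ℝ) < b := by exact_mod_cast (show 1 < b by omega)
  have small : ∀ ε : ℝ, 0 < ε → ∃ d : ℕ, 1 ≤ d ∧ ((b : ℝ) ^ d)⁻¹ < ε := by
    intro ε hε
    obtain ⟨d, hd⟩ := exists_pow_lt_of_lt_one (lt_min hε one_pos) (inv_lt_one_of_one_lt₀ hb1)
    rw [inv_pow, lt_min_iff] at hd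
    refine ⟨d, Nat.one_le_iff_ne_zero.2 ?_, hd.1⟩
    rintro rfl
    simp at hd
  have hpos : ∀ d : ℕ, (0 : ℝ) < (b : ℝ) ^ d := fun d => by positivity
  rw [tendsto_order]
  constructor
  · intro c hc
    obtain ⟨d, hd, hlt⟩ := small (t - c) (by linarith)
    have hfl : (⌊t * (b : ℝ) ^ d⌋₊ : ℝ) ≤ t * (b : ℝ) ^ d :=
      Nat.floor_le (mul_nonneg ht0 (hpos d).le)
    have hn : ⌊t * (b : ℝ) ^ d⌋₊ ≤ b ^ d := by
      have : (⌊t * (b : ℝ) ^ d⌋₊ : ℝ) ≤ (b : ℝ) ^ d :=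
        hfl.trans (mul_le_of_le_one_left (hpos d).le ht1)
      exact_mod_cast this
    have hct : c < (⌊t * (b : ℝ) ^ d⌋₊ : ℝ) / (b : ℝ) ^ d := by
      rw [lt_div_iff₀ (hpos d)]
      rw [inv_lt_iff_one_lt_mul₀ (hpos d)] at hlt
      nlinarith [Nat.lt_floor_add_one (t * (b : ℝ) ^ d)]
    filter_upwards [(tendsto_visitFreq_Ico_zero_adic (h d hd) _ hn).eventually_const_lt hct]
      with N hN
    exact hN.trans_le
      (visitFreq_mono u (Set.Ico_subset_Ico_right ((div_le_iff₀ (hpos d)).2 hfl)) N)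
  · intro c hc
    obtain ⟨d, hd, hlt⟩ := small (c - t) (by linarith)
    have hn : ⌈t * (b : ℝ) ^ d⌉₊ ≤ b ^ d := by
      rw [Nat.ceil_le]
      push_cast
      exact mul_le_of_le_one_left (hpos d).le ht1
    have htc : (⌈t * (b : ℝ) ^ d⌉₊ : ℝ) / (b : ℝ) ^ d < c := by
      rw [div_lt_iff₀ (hpos d)]
      rw [inv_lt_iff_one_lt_mul₀ (hpos d)] at hlt
      nlinarith [Nat.ceil_lt_add_one (mul_nonneg ht0 (hpos d).le)]
    filter_upwards [(tendsto_visitFreq_Ico_zero_adic (h d hd) _ hn).eventually_lt_const htc]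
      with N hN
    exact (visitFreq_mono u
      (Set.Ico_subset_Ico_right ((le_div_iff₀ (hpos d)).2 (Nat.le_ceil _))) N).trans_lt hN

/-- (Wall's theorem) For an integer `b ≥ 2` and `x ∈ [0,1]`, the number `x` is normal in base `b`
if and only if the sequence `(⟨b^k x⟩)_{k ≥ 1}` is uniformly distributed modulo 1. -/
theorem wall_normal_iff_unifDistribMod1 (b : ℕ) (hb : 2 ≤ b) (x : ℝ)
    (hx : x ∈ Set.Icc (0 : ℝ) 1) :
    IsNormalInBase b x ↔ UnifDistribMod1 (fun k : ℕ => Int.fract ((b : ℝ) ^ k * x)) := by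
  set u : ℕ → ℝ := fun k => Int.fract ((b : ℝ) ^ k * x)
  constructor
  · intro h r s hr hrs hs
    have hadic : ∀ d : ℕ, 1 ≤ d → ∀ a : ℕ, a < b ^ d → Tendsto
        (visitFreq u (Set.Ico ((a : ℝ) / (b : ℝ) ^ d) (((a : ℝ) + 1) / (b : ℝ) ^ d)))
        atTop (nhds (((b : ℝ) ^ d)⁻¹)) :=
      fun d hd a ha => (tendsto_visitFreq_shift_iff u _ _).1 (h d hd a ha)
    refine ((tendsto_visitFreq_Ico_zero hb hadic (hr.trans hrs.le) hs).sub
      (tendsto_visitFreq_Ico_zero hb hadic hr (hrs.le.trans hs))).congr fun N => ?_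
    exact sub_eq_of_eq_add' (visitFreq_Ico_add u hr hrs.le N).symm
  · intro h d _ a ha
    have hpos : (0 : ℝ) < (b : ℝ) ^ d := by positivity
    refine (tendsto_visitFreq_shift_iff u _ _).2 ?_
    have hlim := h ((a : ℝ) / (b : ℝ) ^ d) (((a : ℝ) + 1) / (b : ℝ) ^ d) (by positivity)
      (by gcongr; linarith) (by rw [div_le_one hpos]; exact_mod_cast ha)
    rwa [← sub_div, add_sub_cancel_left, one_div] at hlim
end

section
/- (Koksma's inequality) Let f : [0,1] → ℝ be a function of bounded variation with total variation Var(f), and let x_1, …, x_N be points in [0,1]. Then | (1/N) ∑_{k=1}^N f(x_k) − ∫_0^1 f(x) dx | ≤ Var(f) · D_N^*(x_1, …, x_N). -/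
open MeasureTheory Filter

/-- The star-discrepancy of the points `x 1, …, x N` in the unit interval:
`D_N^* = sup_{0 ≤ a ≤ 1} | (1/N) ∑_{k=1}^N 1_{[0,a)}(x_k) - a |`. -/
noncomputable def starDiscrepancy (N : ℕ) (x : ℕ → ℝ) : ℝ :=
  ⨆ a : Set.Icc (0 : ℝ) 1,
    |(∑ k ∈ Finset.Icc 1 N,
        (Set.Ico (0 : ℝ) (a : ℝ)).indicator (fun _ => (1 : ℝ)) (x k)) / N - (a : ℝ)|

lemma starDiscrepancy_bddAbove (N : ℕ) (x : ℕ → ℝ) :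
    BddAbove (Set.range fun a : Set.Icc (0 : ℝ) 1 =>
      |(∑ k ∈ Finset.Icc 1 N,
        (Set.Ico (0 : ℝ) (a : ℝ)).indicator (fun _ => (1 : ℝ)) (x k)) / N - (a : ℝ)|) := by
  refine ⟨1, ?_⟩
  rintro _ ⟨⟨a, ha0, ha1⟩, rfl⟩
  have h0 : 0 ≤ (∑ k ∈ Finset.Icc 1 N,
      (Set.Ico (0 : ℝ) a).indicator (fun _ => (1 : ℝ)) (x k)) / N :=
    div_nonneg (Finset.sum_nonneg fun k _ => Set.indicator_nonneg (fun _ _ => zero_le_one) _)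
      N.cast_nonneg
  have h1 : (∑ k ∈ Finset.Icc 1 N,
      (Set.Ico (0 : ℝ) a).indicator (fun _ => (1 : ℝ)) (x k)) / N ≤ 1 := by
    refine div_le_one_of_le₀ ?_ N.cast_nonneg
    calc _ ≤ ∑ k ∈ Finset.Icc 1 N, (1 : ℝ) :=
          Finset.sum_le_sum fun k _ => Set.indicator_le_self' (fun _ _ => zero_le_one) _
      _ = N := by simp
  exact abs_le.2 ⟨by dsimp only; linarith, by dsimp only; linarith⟩

lemma abs_count_lt_div_sub_le_starDiscrepancy {N : ℕ} {x : ℕ → ℝ}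
    (hx : ∀ k ∈ Finset.Icc 1 N, 0 ≤ x k) {a : ℝ} (ha : a ∈ Set.Icc (0 : ℝ) 1) :
    |(∑ k ∈ Finset.Icc 1 N, if x k < a then (1 : ℝ) else 0) / N - a| ≤ starDiscrepancy N x := by
  refine le_of_eq_of_le ?_ (le_ciSup (starDiscrepancy_bddAbove N x) ⟨a, ha⟩)
  congr 3
  refine Finset.sum_congr rfl fun k hk => ?_
  simp [Set.indicator_apply, hx k hk]

/-- Summation by parts over an interval on which the counting function is a constant `C`. -/
lemma abs_sub_integral_add_le_of_count_const {f w : ℝ → ℝ} {C D a b : ℝ} (hab : a ≤ b)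
    (hf : IntervalIntegrable f volume a b)
    (hwa : ∀ t ∈ Set.Icc a b, |f t - f a| ≤ w t - w a)
    (hwb : ∀ t ∈ Set.Icc a b, |f b - f t| ≤ w b - w t)
    (hD : ∀ t ∈ Set.Ioc a b, |C - t| ≤ D) :
    |C * (f a - f b) - (∫ t in a..b, f t) + f b * b - f a * a| ≤ D * (w b - w a) := by
  rcases hab.eq_or_lt with rfl | hlt
  · simp
  have hDb : |C - b| ≤ D := hD b ⟨hlt, le_rfl⟩
  have hDa : |C - a| ≤ D := by
    refine le_of_forall_gt_imp_ge_of_dense fun d hd => ?_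
    have ht : min b (a + (d - D)) ∈ Set.Ioc a b :=
      ⟨lt_min hlt (by linarith), min_le_left _ _⟩
    have h1 := abs_le.1 (hD _ ht)
    have h2 : min b (a + (d - D)) ≤ a + (d - D) := min_le_right _ _
    have h3 := ht.1
    exact abs_le.2 ⟨by linarith, by linarith⟩
  have hD0 : 0 ≤ D := (abs_nonneg _).trans hDb
  have hbound : ∀ t ∈ Set.uIoc a b,
      ‖(C - a) * (f a - f t) + (C - b) * (f t - f b)‖ ≤ D * (w b - w a) := by
    intro t ht
    rw [Set.uIoc_of_le hab] at ht
    have ht' : t ∈ Set.Icc a b := ⟨ht.1.le, ht.2⟩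
    calc ‖(C - a) * (f a - f t) + (C - b) * (f t - f b)‖
        ≤ |C - a| * |f a - f t| + |C - b| * |f t - f b| := by
          rw [Real.norm_eq_abs, ← abs_mul, ← abs_mul]
          exact abs_add_le _ _
      _ ≤ D * (w t - w a) + D * (w b - w t) := by
          rw [abs_sub_comm (f a) (f t), abs_sub_comm (f t) (f b)]
          exact add_le_add (mul_le_mul hDa (hwa t ht') (abs_nonneg _) hD0)
            (mul_le_mul hDb (hwb t ht') (abs_nonneg _) hD0)
      _ = D * (w b - w a) := by ring
  have hfi := intervalIntegral.norm_integral_le_of_norm_le_const hbound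
  have hval : ∫ t in a..b, ((C - a) * (f a - f t) + (C - b) * (f t - f b)) =
      (b - a) * (C * (f a - f b) - (∫ t in a..b, f t) + f b * b - f a * a) := by
    have : ∀ t, (C - a) * (f a - f t) + (C - b) * (f t - f b) =
        ((C - a) * f a - (C - b) * f b) - (b - a) * f t := fun t => by ring
    simp_rw [this]
    rw [intervalIntegral.integral_sub intervalIntegrable_const (hf.const_mul _),
      intervalIntegral.integral_const, intervalIntegral.integral_const_mul, smul_eq_mul]
    ring
  rw [hval, Real.norm_eq_abs, abs_mul, mul_comm] at hfi
  exact le_of_mul_le_mul_right hfi (abs_pos.2 (sub_pos.2 hlt).ne')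

/-- The signed error of the quadrature rule on `[0, t)`, relative to the value of `f` at `t`. -/
noncomputable def quadratureError (N : ℕ) (x : ℕ → ℝ) (f : ℝ → ℝ) (t : ℝ) : ℝ :=
  (∑ k ∈ Finset.Icc 1 N, if x k < t then f (x k) - f t else 0) / N -
    (∫ s in (0 : ℝ)..t, f s) + f t * t

lemma abs_quadratureError_sub_le {N : ℕ} {x : ℕ → ℝ} {f w : ℝ → ℝ}
    (hx : ∀ k ∈ Finset.Icc 1 N, 0 ≤ x k)
    (hf : IntervalIntegrable f volume 0 1)
    (hw : ∀ s t, 0 ≤ s → s ≤ t → t ≤ 1 → |f t - f s| ≤ w t - w s)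
    (a b : ℝ) (ha : 0 ≤ a) (hab : a ≤ b) (hb : b ≤ 1) :
    |quadratureError N x f b - quadratureError N x f a| ≤
      starDiscrepancy N x * (w b - w a) := by
  induction hn : ((Finset.Icc 1 N).filter fun k => a < x k ∧ x k < b).card using
    Nat.strong_induction_on generalizing a b with
  | _ n ih =>
    subst hn
    by_cases hp : ∃ k ∈ Finset.Icc 1 N, a < x k ∧ x k < b
    · obtain ⟨k, hk, hak, hkb⟩ := hp
      have h1 := ih _ (Finset.card_lt_card (by
        refine Finset.ssubset_iff_of_subset (fun i hi => ?_) |>.2 ⟨k, ?_, ?_⟩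
        · simp only [Finset.mem_filter] at hi ⊢
          exact ⟨hi.1, hi.2.1, hi.2.2.trans hkb⟩
        · exact Finset.mem_filter.2 ⟨hk, hak, hkb⟩
        · simp)) a (x k) ha hak.le (hkb.le.trans hb) rfl
      have h2 := ih _ (Finset.card_lt_card (by
        refine Finset.ssubset_iff_of_subset (fun i hi => ?_) |>.2 ⟨k, ?_, ?_⟩
        · simp only [Finset.mem_filter] at hi ⊢
          exact ⟨hi.1, hak.trans hi.2.1, hi.2.2⟩
        · exact Finset.mem_filter.2 ⟨hk, hak, hkb⟩
        · simp)) (x k) b (ha.trans hak.le) hkb.le hb rfl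
      calc _ ≤ _ := abs_sub_le _ (quadratureError N x f (x k)) _
        _ ≤ _ := add_le_add h2 h1
        _ = _ := by ring
    · push Not at hp
      rcases hab.eq_or_lt with rfl | hlt
      · simp
      have hiff : ∀ t ∈ Set.Ioc a b, ∀ k ∈ Finset.Icc 1 N, (x k < t ↔ x k ≤ a) := by
        intro t ht k hk
        refine ⟨fun h => ?_, fun h => h.trans_lt ht.1⟩
        by_contra! h'
        exact absurd (hp k hk h') (not_le.2 (h.trans_le ht.2))
      have hfab : ∀ {c d : ℝ}, 0 ≤ c → c ≤ d → d ≤ 1 → IntervalIntegrable f volume c d :=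
        fun {c d} hc hcd hd => hf.mono_set (by
          rw [Set.uIcc_of_le hcd, Set.uIcc_of_le zero_le_one]
          exact Set.Icc_subset_Icc hc hd)
      have key := abs_sub_integral_add_le_of_count_const
        (C := (∑ k ∈ Finset.Icc 1 N, if x k ≤ a then (1 : ℝ) else 0) / N)
        (D := starDiscrepancy N x) (f := f) (w := w) hab (hfab ha hab hb)
        (fun t ht => hw a t ha ht.1 (ht.2.trans hb))
        (fun t ht => hw t b (ha.trans ht.1) ht.2 hb)
        (fun t ht => by
          rw [← Finset.sum_congr rfl fun k hk => if_congr (hiff t ht k hk) rfl rfl]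
          exact abs_count_lt_div_sub_le_starDiscrepancy hx
            ⟨ha.trans ht.1.le, ht.2.trans hb⟩)
      refine le_of_eq_of_le ?_ key
      congr 1
      have hsum : (∑ k ∈ Finset.Icc 1 N, if x k < b then f (x k) - f b else 0) -
          (∑ k ∈ Finset.Icc 1 N, if x k < a then f (x k) - f a else 0) =
          (∑ k ∈ Finset.Icc 1 N, if x k ≤ a then (1 : ℝ) else 0) * (f a - f b) := by
        rw [← Finset.sum_sub_distrib, Finset.sum_mul]
        refine Finset.sum_congr rfl fun k hk => ?_
        rw [if_congr (hiff b ⟨hlt, le_rfl⟩ k hk) rfl rfl]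
        rcases lt_trichotomy (x k) a with h | h | h
        · simp [h, h.le]
        · simp [h]
        · simp [h.not_ge, h.not_gt]
      have hI := intervalIntegral.integral_add_adjacent_intervals
        (hfab le_rfl ha (hab.trans hb)) (hfab ha hab hb)
      rw [quadratureError, quadratureError, ← hI, div_mul_eq_mul_div, ← hsum]
      ring

/-- (Koksma's inequality) For `f : [0,1] → ℝ` of bounded variation and points
`x_1, …, x_N ∈ [0,1]`,
`| (1/N) ∑_{k=1}^N f(x_k) - ∫₀¹ f | ≤ Var(f) · D_N^*(x_1, …, x_N)`. -/
theorem koksma_inequality (f : ℝ → ℝ) (hf : BoundedVariationOn f (Set.Icc (0 : ℝ) 1))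
    (N : ℕ) (hN : 1 ≤ N) (x : ℕ → ℝ)
    (hx : ∀ k ∈ Finset.Icc 1 N, x k ∈ Set.Icc (0 : ℝ) 1) :
    |(∑ k ∈ Finset.Icc 1 N, f (x k)) / N - ∫ t in (0:ℝ)..1, f t|
      ≤ (eVariationOn f (Set.Icc (0 : ℝ) 1)).toReal * starDiscrepancy N x := by
  have hloc := hf.locallyBoundedVariationOn
  have h0 : (0 : ℝ) ∈ Set.Icc (0 : ℝ) 1 := by simp
  have hfi : IntervalIntegrable f volume 0 1 := by
    obtain ⟨p, q, hp, hq, rfl⟩ := hloc.exists_monotoneOn_sub_monotoneOn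
    rw [← Set.uIcc_of_le zero_le_one] at hp hq
    exact hp.intervalIntegrable.sub hq.intervalIntegrable
  set w := variationOnFromTo f (Set.Icc (0 : ℝ) 1) 0 with hwdef
  have hw : ∀ s t, 0 ≤ s → s ≤ t → t ≤ 1 → |f t - f s| ≤ w t - w s := by
    intro s t hs hst ht
    have hs' : s ∈ Set.Icc (0 : ℝ) 1 := ⟨hs, hst.trans ht⟩
    have ht' : t ∈ Set.Icc (0 : ℝ) 1 := ⟨hs.trans hst, ht⟩
    have h1 := variationOnFromTo.add_self_monotoneOn hloc h0 hs' ht' hst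
    have h2 := variationOnFromTo.sub_self_monotoneOn hloc h0 hs' ht' hst
    simp only [Pi.add_apply, Pi.sub_apply, ← hwdef] at h1 h2
    exact abs_le.2 ⟨by linarith, by linarith⟩
  have key := abs_quadratureError_sub_le (fun k hk => (hx k hk).1) hfi hw 0 1
    le_rfl zero_le_one le_rfl
  have hE0 : quadratureError N x f 0 = 0 := by
    have : ∑ k ∈ Finset.Icc 1 N, (if x k < 0 then f (x k) - f 0 else 0) = 0 :=
      Finset.sum_eq_zero fun k hk => if_neg (hx k hk).1.not_gt
    simp [quadratureError, this]
  have hE1 : quadratureError N x f 1 =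
      (∑ k ∈ Finset.Icc 1 N, f (x k)) / N - ∫ t in (0:ℝ)..1, f t := by
    have hsum : ∑ k ∈ Finset.Icc 1 N, (if x k < 1 then f (x k) - f 1 else 0) =
        (∑ k ∈ Finset.Icc 1 N, f (x k)) - N * f 1 := by
      have : (N : ℝ) * f 1 = ∑ k ∈ Finset.Icc 1 N, f 1 := by simp
      rw [this, ← Finset.sum_sub_distrib]
      refine Finset.sum_congr rfl fun k hk => ?_
      rcases (hx k hk).2.lt_or_eq with h | h <;> simp [h]
    have hN0 : (N : ℝ) ≠ 0 := by positivity
    rw [quadratureError, hsum, sub_div, mul_div_cancel_left₀ _ hN0]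
    ring
  have hw1 : w 1 - w 0 = (eVariationOn f (Set.Icc (0 : ℝ) 1)).toReal := by
    rw [hwdef, variationOnFromTo.self, variationOnFromTo.eq_of_le _ _ zero_le_one,
      Set.inter_self, sub_zero]
  rwa [hE0, hE1, hw1, sub_zero, mul_comm] at key
end

section
/- (Schmidt's theorem) There exists a positive constant c such that for every infinite sequence (x_k)_{k ≥ 1} of points in the unit interval, the inequality D_N^*(x_1, …, x_N) > c (log N)/N holds for infinitely many positive integers N. -/
open MeasureTheory Filter

/-- The number of `k ≤ n` with `0 ≤ x k < y`. -/
noncomputable def countBelow (x : ℕ → ℝ) (n : ℕ) (y : ℝ) : ℝ :=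
  ∑ k ∈ Finset.Icc 1 n, (Set.Ico (0 : ℝ) y).indicator (fun _ => (1 : ℝ)) (x k)

/-- The signed, unnormalised discrepancy of the first `n` points at `y`. -/
noncomputable def signedDisc (x : ℕ → ℝ) (y : ℝ) (n : ℕ) : ℝ :=
  countBelow x n y - n * y

/-- The maximum of `d` over a Cantor-like subset of `[a, a + 3 ^ t]`: at each scale only the
first and the last third are kept. -/
noncomputable def cantorMax (d : ℕ → ℝ) : ℕ → ℕ → ℝ
  | 0, a => d a
  | t + 1, a => max (cantorMax d t a) (cantorMax d t (a + 2 * 3 ^ t))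

lemma exists_eq_cantorMax (d : ℕ → ℝ) (t a : ℕ) :
    ∃ n, a ≤ n ∧ n ≤ a + 3 ^ t ∧ cantorMax d t a = d n := by
  induction t generalizing a with
  | zero => exact ⟨a, le_rfl, by simp, rfl⟩
  | succ t ih =>
    have hp : (3 : ℕ) ^ (t + 1) = 3 * 3 ^ t := by ring
    rcases max_choice (cantorMax d t a) (cantorMax d t (a + 2 * 3 ^ t)) with h | h
    · obtain ⟨n, h1, h2, h3⟩ := ih a
      exact ⟨n, h1, by omega, by rw [cantorMax, h, h3]⟩
    · obtain ⟨n, h1, h2, h3⟩ := ih (a + 2 * 3 ^ t)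
      exact ⟨n, by omega, by omega, by rw [cantorMax, h, h3]⟩

lemma cantorMax_le_add (d e : ℕ → ℝ) (u : ℝ) (t a : ℕ)
    (h : ∀ n, a ≤ n → n ≤ a + 3 ^ t → d n ≤ e n + u) :
    cantorMax d t a ≤ cantorMax e t a + u := by
  induction t generalizing a with
  | zero => exact h a le_rfl (by simp)
  | succ t ih =>
    have hp : (3 : ℕ) ^ (t + 1) = 3 * 3 ^ t := by ring
    have h1 := ih a fun n hn hn' => h n hn (by omega)
    have h2 := ih (a + 2 * 3 ^ t) fun n hn hn' => h n (by omega) (by omega)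
    simp only [cantorMax]
    rw [← max_add_add_right]
    exact max_le_max h1 h2

lemma countBelow_succ (x : ℕ → ℝ) (n : ℕ) (y : ℝ) :
    countBelow x (n + 1) y =
      countBelow x n y + (Set.Ico (0 : ℝ) y).indicator (fun _ => (1 : ℝ)) (x (n + 1)) := by
  unfold countBelow
  rw [Finset.sum_Icc_succ_top (by omega)]

lemma countBelow_sub_eq (x : ℕ → ℝ) {a b : ℕ} {y z : ℝ} (hyz : y ≤ z)
    (h : ∀ k, a < k → k ≤ b → ¬ (y ≤ x k ∧ x k < z)) (n : ℕ) (han : a ≤ n) (hnb : n ≤ b) :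
    countBelow x n z - countBelow x n y = countBelow x a z - countBelow x a y := by
  induction n, han using Nat.le_induction with
  | base => rfl
  | succ n hn ih =>
    have h1 := h (n + 1) (by omega) hnb
    have h2 : (Set.Ico (0 : ℝ) z).indicator (fun _ => (1 : ℝ)) (x (n + 1)) =
        (Set.Ico (0 : ℝ) y).indicator (fun _ => (1 : ℝ)) (x (n + 1)) := by
      have h3 : x (n + 1) ∈ Set.Ico 0 z ↔ x (n + 1) ∈ Set.Ico 0 y := by
        simp only [Set.mem_Ico]
        constructor
        · rintro ⟨h4, h5⟩
          exact ⟨h4, by by_contra! h6; exact h1 ⟨h6, h5⟩⟩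
        · rintro ⟨h4, h5⟩
          exact ⟨h4, h5.trans_le hyz⟩
      by_cases h4 : x (n + 1) ∈ Set.Ico 0 z
      · rw [Set.indicator_of_mem h4, Set.indicator_of_mem (h3.1 h4)]
      · rw [Set.indicator_of_notMem h4, Set.indicator_of_notMem (fun h5 => h4 (h3.2 h5))]
    rw [countBelow_succ, countBelow_succ, h2, ← ih (by omega)]
    ring

/-- The difference between the maxima over the two outer thirds. -/
noncomputable def thirdsGap (x : ℕ → ℝ) (t a : ℕ) (y : ℝ) : ℝ :=
  cantorMax (signedDisc x y) t a - cantorMax (signedDisc x y) t (a + 2 * 3 ^ t)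

lemma thirdsGap_increase (x : ℕ → ℝ) {t a : ℕ} {y z : ℝ} (hyz : y ≤ z)
    (h : ∀ k, a < k → k ≤ a + 3 ^ (t + 1) → ¬ (y ≤ x k ∧ x k < z)) :
    3 ^ t * (z - y) ≤ |thirdsGap x t a y| + |thirdsGap x t a z| := by
  have hp : (3 : ℕ) ^ (t + 1) = 3 * 3 ^ t := by ring
  have hdiff := fun n h1 h2 => countBelow_sub_eq x hyz h n h1 h2
  set C := countBelow x a z - countBelow x a y
  have h1 : cantorMax (signedDisc x y) t a
      ≤ cantorMax (signedDisc x z) t a + (((a : ℝ) + 3 ^ t) * (z - y) - C) := by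
    apply cantorMax_le_add
    intro n hn hn'
    have h2 := hdiff n hn (by omega)
    have h3 : (n : ℝ) ≤ a + 3 ^ t := by exact_mod_cast hn'
    have h4 := mul_le_mul_of_nonneg_right h3 (sub_nonneg.2 hyz)
    simp only [signedDisc]
    linarith
  have h2 : cantorMax (signedDisc x z) t (a + 2 * 3 ^ t)
      ≤ cantorMax (signedDisc x y) t (a + 2 * 3 ^ t)
        + (C - ((a : ℝ) + 2 * 3 ^ t) * (z - y)) := by
    apply cantorMax_le_add
    intro n hn hn'
    have h2 := hdiff n (by omega) (by omega)
    have h3 : (a : ℝ) + 2 * 3 ^ t ≤ n := by exact_mod_cast hn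
    have h4 := mul_le_mul_of_nonneg_right h3 (sub_nonneg.2 hyz)
    simp only [signedDisc]
    linarith
  have h3 : 3 ^ t * (z - y) ≤ thirdsGap x t a z - thirdsGap x t a y := by
    unfold thirdsGap
    linarith
  linarith [le_abs_self (thirdsGap x t a z), neg_abs_le (thirdsGap x t a y)]

lemma card_grid_window_le (u : ℝ) (Q q R : ℕ) (hQ : 0 < Q) :
    ((Finset.range R).filter fun j : ℕ =>
      (j : ℝ) / Q ≤ u ∧ u < ((j + q : ℕ) : ℝ) / Q).card ≤ q := by
  have hQ' : (0 : ℝ) < Q := by exact_mod_cast hQ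
  have hsub : ((Finset.range R).filter fun j : ℕ =>
      (j : ℝ) / Q ≤ u ∧ u < ((j + q : ℕ) : ℝ) / Q) ⊆
      Finset.Ico (⌊u * Q⌋₊ + 1 - q) (⌊u * Q⌋₊ + 1) := by
    intro j hj
    obtain ⟨-, h1, h2⟩ := Finset.mem_filter.1 hj
    rw [div_le_iff₀ hQ'] at h1
    rw [lt_div_iff₀ hQ'] at h2
    have h3 : j ≤ ⌊u * Q⌋₊ := Nat.le_floor h1
    have h4 : ⌊u * Q⌋₊ < j + q :=
      (Nat.floor_lt ((Nat.cast_nonneg j).trans h1)).2 h2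
    rw [Finset.mem_Ico]
    omega
  refine (Finset.card_le_card hsub).trans ?_
  rw [Nat.card_Ico]
  omega

lemma sum_abs_thirdsGap (x : ℕ → ℝ) {t T : ℕ} (a : ℕ) (ht : t < T) :
    (3 : ℝ) ^ (T + 1) / 54 ≤
      ∑ j ∈ Finset.range (3 ^ (T + 1)),
        |thirdsGap x t a ((j : ℝ) / (3 ^ (T + 1) : ℕ))| := by
  obtain ⟨s, rfl⟩ : ∃ s, T = t + 1 + s := ⟨T - (t + 1), by omega⟩
  set Q : ℕ := 3 ^ (t + 1 + s + 1) with hQ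
  set q : ℕ := 3 ^ s with hq
  have hQ0 : 0 < Q := by positivity
  have hq0 : 0 < q := by positivity
  have hQq : Q = 9 * 3 ^ t * q := by rw [hQ, hq]; ring
  have ht1 : 1 ≤ 3 ^ t := Nat.one_le_pow _ _ (by norm_num)
  have hqQ : 9 * q ≤ Q := by rw [hQq]; nlinarith
  have hQ' : (0 : ℝ) < Q := by exact_mod_cast hQ0
  have hcast : (3 : ℝ) ^ (t + 1 + s + 1) = Q := by rw [hQ]; push_cast; ring
  set F : ℕ → ℝ := fun j => |thirdsGap x t a ((j : ℝ) / Q)| with hF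
  let window : ℕ → Finset ℕ := fun k => (Finset.range (Q - q)).filter fun j : ℕ =>
      (j : ℝ) / Q ≤ x k ∧ x k < ((j + q : ℕ) : ℝ) / Q
  set bad := (Finset.Ioc a (a + 3 ^ (t + 1))).biUnion window with hbad
  have hbadcard : bad.card ≤ 3 ^ (t + 1) * q := by
    refine (Finset.card_biUnion_le_card_mul _ _ q fun k _ =>
      card_grid_window_le (x k) Q q (Q - q) hQ0).trans ?_
    simp
  have hgood : Q ≤ 3 * (Finset.range (Q - q) \ bad).card := by
    have h1 := Finset.le_card_sdiff bad (Finset.range (Q - q))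
    rw [Finset.card_range] at h1
    have h2 : 3 ^ (t + 1) * q = 3 * (3 ^ t * q) := by ring
    have h3 : Q = 9 * (3 ^ t * q) := by rw [hQq]; ring
    have h4 : q ≤ 3 ^ t * q := Nat.le_mul_of_pos_left _ (by omega)
    omega
  have hpair : ∀ j ∈ Finset.range (Q - q) \ bad, (1 : ℝ) / 9 ≤ F j + F (j + q) := by
    intro j hj
    rw [Finset.mem_sdiff] at hj
    have h1 : (j : ℝ) / Q ≤ ((j + q : ℕ) : ℝ) / Q := by gcongr; omega
    have h2 := thirdsGap_increase x (t := t) (a := a) h1 (by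
      intro k hk hk' hkj
      exact hj.2 (Finset.mem_biUnion.2 ⟨k, Finset.mem_Ioc.2 ⟨hk, hk'⟩,
        Finset.mem_filter.2 ⟨hj.1, hkj⟩⟩))
    have h3 : (3 : ℝ) ^ t * (((j + q : ℕ) : ℝ) / Q - (j : ℝ) / Q) = 1 / 9 := by
      have h4 : (Q : ℝ) = 9 * 3 ^ t * q := by exact_mod_cast hQq
      have h5 : (0 : ℝ) < q := by exact_mod_cast hq0
      rw [← sub_div, h4]
      push_cast
      field_simp
      ring
    rw [h3] at h2
    exact h2
  have hF0 : ∀ j, 0 ≤ F j := fun j => abs_nonneg _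
  have hlow : (Q : ℝ) / 27 ≤ ∑ j ∈ Finset.range (Q - q), (F j + F (j + q)) := by
    have h1 : ((Finset.range (Q - q) \ bad).card : ℝ) * (1 / 9)
        ≤ ∑ j ∈ Finset.range (Q - q) \ bad, (F j + F (j + q)) := by
      rw [← nsmul_eq_mul]
      exact Finset.card_nsmul_le_sum _ _ _ hpair
    have h2 : ∑ j ∈ Finset.range (Q - q) \ bad, (F j + F (j + q))
        ≤ ∑ j ∈ Finset.range (Q - q), (F j + F (j + q)) :=
      Finset.sum_le_sum_of_subset_of_nonneg Finset.sdiff_subset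
        fun j _ _ => add_nonneg (hF0 _) (hF0 _)
    have h3 : (Q : ℝ) ≤ 3 * (Finset.range (Q - q) \ bad).card := by exact_mod_cast hgood
    linarith
  have hup1 : ∑ j ∈ Finset.range (Q - q), F j ≤ ∑ j ∈ Finset.range Q, F j :=
    Finset.sum_le_sum_of_subset_of_nonneg (Finset.range_mono (by omega)) fun j _ _ => hF0 _
  have hup2 : ∑ j ∈ Finset.range (Q - q), F (j + q) ≤ ∑ j ∈ Finset.range Q, F j := by
    have h1 := Finset.sum_range_add_sum_Ico F (show q ≤ Q by omega)
    have h2 : ∑ j ∈ Finset.Ico q Q, F j = ∑ j ∈ Finset.range (Q - q), F (j + q) := by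
      rw [Finset.sum_Ico_eq_sum_range]
      simp only [add_comm]
    have h3 : 0 ≤ ∑ j ∈ Finset.range q, F j := Finset.sum_nonneg fun j _ => hF0 j
    linarith
  rw [Finset.sum_add_distrib] at hlow
  rw [hcast]
  linarith

/-- The oscillation of the signed discrepancy at `y` along the Cantor-like index set. -/
noncomputable def cantorOsc (x : ℕ → ℝ) (t a : ℕ) (y : ℝ) : ℝ :=
  cantorMax (signedDisc x y) t a + cantorMax (-signedDisc x y) t a

lemma cantorOsc_succ (x : ℕ → ℝ) (t a : ℕ) (y : ℝ) :
    (cantorOsc x t a y + cantorOsc x t (a + 2 * 3 ^ t) y + |thirdsGap x t a y|) / 2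
      ≤ cantorOsc x (t + 1) a y := by
  simp only [cantorOsc, thirdsGap, cantorMax]
  generalize cantorMax (signedDisc x y) t a = p
  generalize cantorMax (signedDisc x y) t (a + 2 * 3 ^ t) = r
  have h := le_max_left (cantorMax (-signedDisc x y) t a)
    (cantorMax (-signedDisc x y) t (a + 2 * 3 ^ t))
  have h' := le_max_right (cantorMax (-signedDisc x y) t a)
    (cantorMax (-signedDisc x y) t (a + 2 * 3 ^ t))
  have h1 := le_max_left p r
  have h2 := le_max_right p r
  rcases abs_cases (p - r) with ⟨h3, -⟩ | ⟨h3, -⟩ <;> linarith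

lemma sum_cantorOsc (x : ℕ → ℝ) {t T : ℕ} (a : ℕ) (ht : t ≤ T) :
    (t : ℝ) * (3 ^ (T + 1) / 108) ≤
      ∑ j ∈ Finset.range (3 ^ (T + 1)), cantorOsc x t a ((j : ℝ) / (3 ^ (T + 1) : ℕ)) := by
  induction t generalizing a with
  | zero => simp [cantorOsc, cantorMax]
  | succ t ih =>
    have h1 := ih a (by omega)
    have h2 := ih (a + 2 * 3 ^ t) (by omega)
    have h3 := sum_abs_thirdsGap x a (show t < T by omega)
    have h4 := Finset.sum_le_sum fun j (_ : j ∈ Finset.range (3 ^ (T + 1))) =>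
      cantorOsc_succ x t a ((j : ℝ) / (3 ^ (T + 1) : ℕ))
    rw [← Finset.sum_div, Finset.sum_add_distrib, Finset.sum_add_distrib] at h4
    push_cast at *
    linarith

lemma exists_large_signedDisc (x : ℕ → ℝ) (a T : ℕ) :
    ∃ n, a ≤ n ∧ n ≤ a + 3 ^ T ∧
      ∃ y ∈ Set.Icc (0 : ℝ) 1, (T : ℝ) / 216 ≤ |signedDisc x y n| := by
  have hQ0 : 0 < 3 ^ (T + 1) := by positivity
  have hsum := sum_cantorOsc x a (le_refl T)
  obtain ⟨j, hj, hjle⟩ : ∃ j ∈ Finset.range (3 ^ (T + 1)),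
      (T : ℝ) / 108 ≤ cantorOsc x T a ((j : ℝ) / (3 ^ (T + 1) : ℕ)) := by
    apply Finset.exists_le_of_sum_le ⟨0, Finset.mem_range.2 hQ0⟩
    refine le_trans (le_of_eq ?_) hsum
    simp
    ring
  set y : ℝ := (j : ℝ) / (3 ^ (T + 1) : ℕ) with hy
  have hyI : y ∈ Set.Icc (0 : ℝ) 1 := by
    refine ⟨by positivity, div_le_one_of_le₀ ?_ (by positivity)⟩
    exact_mod_cast (Finset.mem_range.1 hj).le
  obtain ⟨n, h1, h2, h3⟩ := exists_eq_cantorMax (signedDisc x y) T a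
  obtain ⟨m, h4, h5, h6⟩ := exists_eq_cantorMax (-signedDisc x y) T a
  rw [cantorOsc, h3, h6, Pi.neg_apply] at hjle
  by_cases h : (T : ℝ) / 216 ≤ |signedDisc x y n|
  · exact ⟨n, h1, h2, y, hyI, h⟩
  · refine ⟨m, h4, h5, y, hyI, ?_⟩
    linarith [le_abs_self (signedDisc x y n), neg_abs_le (signedDisc x y m)]

lemma abs_signedDisc_div_le_starDiscrepancy (x : ℕ → ℝ) {n : ℕ} (hn : 0 < n) {y : ℝ}
    (hy : y ∈ Set.Icc (0 : ℝ) 1) : |signedDisc x y n| / n ≤ starDiscrepancy n x := by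
  have hn' : (0 : ℝ) < n := by exact_mod_cast hn
  have hbdd : BddAbove (Set.range fun a : Set.Icc (0 : ℝ) 1 =>
      |(∑ k ∈ Finset.Icc 1 n,
        (Set.Ico (0 : ℝ) (a : ℝ)).indicator (fun _ => (1 : ℝ)) (x k)) / n - (a : ℝ)|) := by
    refine ⟨1, ?_⟩
    rintro _ ⟨⟨a, ha0, ha1⟩, rfl⟩
    have h0 : 0 ≤ ∑ k ∈ Finset.Icc 1 n,
        (Set.Ico (0 : ℝ) a).indicator (fun _ => (1 : ℝ)) (x k) :=
      Finset.sum_nonneg fun k _ => Set.indicator_nonneg (fun _ _ => zero_le_one) _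
    have h1 : ∑ k ∈ Finset.Icc 1 n,
        (Set.Ico (0 : ℝ) a).indicator (fun _ => (1 : ℝ)) (x k) ≤ n := by
      refine (Finset.sum_le_card_nsmul _ _ 1 fun k _ =>
        Set.indicator_le_self' (fun _ _ => zero_le_one) _).trans ?_
      simp
    have h2 := div_nonneg h0 hn'.le
    have h3 := div_le_one_of_le₀ h1 hn'.le
    rw [abs_le]
    constructor <;> simp only <;> linarith
  refine le_trans (le_of_eq ?_) (le_ciSup hbdd ⟨y, hy⟩)
  rw [signedDisc, countBelow, ← abs_of_pos hn', ← abs_div, abs_of_pos hn']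
  congr 1
  field_simp

/-- (Schmidt's theorem) There is a constant `c > 0` such that for every infinite sequence
`(x_k)_{k ≥ 1}` of points in the unit interval, `D_N^*(x_1, …, x_N) > c (log N)/N` for
infinitely many `N`. -/
theorem schmidt_lower_bound :
    ∃ c : ℝ, 0 < c ∧ ∀ x : ℕ → ℝ, (∀ k, 1 ≤ k → x k ∈ Set.Icc (0 : ℝ) 1) →
      ∃ᶠ N : ℕ in atTop, c * Real.log N / N < starDiscrepancy N x := by
  refine ⟨1 / 1000, by norm_num, fun x _ => ?_⟩
  rw [frequently_atTop]
  intro N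
  set a := N + 1 with ha
  obtain ⟨n, h1, h2, y, hy, h3⟩ := exists_large_signedDisc x a a
  have hn : 0 < n := by omega
  have hn' : (0 : ℝ) < n := by exact_mod_cast hn
  refine ⟨n, by omega, lt_of_lt_of_le ?_ (abs_signedDisc_div_le_starDiscrepancy x hn hy)⟩
  have h4 : n ≤ 3 ^ (2 * a) := by
    have h5 : a < 3 ^ a := Nat.lt_pow_self (by norm_num)
    have h6 : (3 : ℕ) ^ (2 * a) = 3 ^ a * 3 ^ a := by ring
    nlinarith
  have h5 : Real.log n ≤ 2 * a * 2 := by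
    have h6 : Real.log n ≤ Real.log (3 ^ (2 * a)) :=
      Real.log_le_log hn' (by exact_mod_cast h4)
    rw [Real.log_pow] at h6
    have h7 : Real.log 3 ≤ 2 := by
      linarith [Real.log_le_sub_one_of_pos (show (0 : ℝ) < 3 by norm_num)]
    push_cast at h6
    nlinarith [(Nat.cast_nonneg a : (0 : ℝ) ≤ a)]
  have h6 : (0 : ℝ) < a := by exact_mod_cast Nat.succ_pos N
  gcongr
  linarith
end

section
/- (Kolmogorov's convergence theorem for lacunary trigonometric series) Let (n_k)_{k ≥ 1} be a sequence of positive integers satisfying the Hadamard gap condition n_{k+1}/n_k ≥ q for all k ≥ 1, for some q > 1, and let (a_k)_{k ≥ 1}, (b_k)_{k ≥ 1} be real sequences. Then the series ∑_{k=1}^∞ ( a_k cos(2π n_k x) + b_k sin(2π n_k x) ) converges for Lebesgue-almost every x ∈ [0,1] if and only if ∑_{k=1}^∞ (a_k^2 + b_k^2) < ∞. -/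
open MeasureTheory Filter Real

open scoped ComplexConjugate

namespace LacunarySeries

/-- The character `x ↦ exp (2πimx)`. -/
noncomputable def mode (m : ℤ) (x : ℝ) : ℂ :=
  Complex.exp (((2 * π * m * x : ℝ) : ℂ) * Complex.I)

/-- Lebesgue measure on the unit interval. -/
noncomputable abbrev unitMeasure : Measure ℝ := volume.restrict (Set.Icc (0 : ℝ) 1)

instance : IsProbabilityMeasure unitMeasure := ⟨by simp⟩

lemma mode_zero (x : ℝ) : mode 0 x = 1 := by simp [mode]

lemma mode_add (m l : ℤ) (x : ℝ) : mode (m + l) x = mode m x * mode l x := by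
  rw [mode, mode, mode, ← Complex.exp_add]
  congr 1
  push_cast
  ring

lemma conj_mode (m : ℤ) (x : ℝ) : conj (mode m x) = mode (-m) x := by
  rw [mode, mode, ← Complex.exp_conj]
  congr 1
  rw [map_mul, Complex.conj_ofReal, Complex.conj_I]
  push_cast
  ring

lemma norm_mode (m : ℤ) (x : ℝ) : ‖mode m x‖ = 1 := Complex.norm_exp_ofReal_mul_I _

lemma continuous_mode (m : ℤ) : Continuous (mode m) := by
  unfold mode
  fun_prop

lemma integrable_of_continuous {E : Type*} [NormedAddCommGroup E] {f : ℝ → E}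
    (hf : Continuous f) : Integrable f unitMeasure :=
  hf.continuousOn.integrableOn_compact isCompact_Icc

lemma intervalIntegral_mode {m : ℤ} (hm : m ≠ 0) (x y : ℝ) :
    ∫ t in x..y, mode m t = (mode m y - mode m x) / (2 * π * m * Complex.I) := by
  have h := integral_exp_mul_complex (a := x) (b := y) (c := 2 * π * m * Complex.I) (by
    simp [hm, Real.pi_ne_zero])
  have hmode (t : ℝ) : mode m t = Complex.exp (2 * π * m * Complex.I * t) := by
    rw [mode]
    congr 1
    push_cast
    ring
  simpa only [hmode] using h

lemma integral_mode (m : ℤ) : ∫ x, mode m x ∂unitMeasure = if m = 0 then 1 else 0 := by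
  split_ifs with hm
  · simp [hm, mode_zero]
  · rw [integral_Icc_eq_integral_Ioc, ← intervalIntegral.integral_of_le zero_le_one,
      intervalIntegral_mode hm]
    have : mode m 1 = 1 := by
      rw [mode, Complex.exp_eq_one_iff]
      exact ⟨m, by push_cast; ring⟩
    rw [this]
    simp [mode]

lemma integral_norm_sq_sum_mode {ι : Type*} (s : Finset ι) (d : ι → ℂ) (ν : ι → ℤ) :
    ∫ x, ‖∑ i ∈ s, d i * mode (ν i) x‖ ^ 2 ∂unitMeasure =
      ∑ i ∈ s, ∑ j ∈ s, if ν i = ν j then (d i * conj (d j)).re else 0 := by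
  have hpt (x : ℝ) : ‖∑ i ∈ s, d i * mode (ν i) x‖ ^ 2 =
      RCLike.re (∑ i ∈ s, ∑ j ∈ s, d i * conj (d j) * mode (ν i - ν j) x) := by
    rw [← RCLike.ofReal_re (K := ℂ) (‖_‖ ^ 2), RCLike.ofReal_pow, ← RCLike.mul_conj, map_sum,
      Finset.sum_mul_sum]
    congr 1
    refine Finset.sum_congr rfl fun i _ => Finset.sum_congr rfl fun j _ => ?_
    rw [map_mul, conj_mode, sub_eq_add_neg, mode_add]
    ring
  have hint (i j : ι) :
      Integrable (fun x => d i * conj (d j) * mode (ν i - ν j) x) unitMeasure :=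
    integrable_of_continuous ((continuous_mode _).const_mul _)
  simp_rw [hpt]
  rw [integral_re (integrable_finsetSum _ fun i _ => integrable_finsetSum _ fun j _ => hint i j),
    integral_finsetSum _ fun i _ => integrable_finsetSum _ fun j _ => hint i j, map_sum]
  refine Finset.sum_congr rfl fun i _ => ?_
  rw [integral_finsetSum _ fun j _ => hint i j, map_sum]
  refine Finset.sum_congr rfl fun j _ => ?_
  rw [integral_const_mul, integral_mode]
  simp only [sub_eq_zero]
  split_ifs <;> simp

lemma integral_norm_sq_sum_mode_of_injective {ν : ℕ → ℤ} (hν : Function.Injective ν)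
    (s : Finset ℕ) (c : ℕ → ℂ) :
    ∫ x, ‖∑ i ∈ s, c i * mode (ν i) x‖ ^ 2 ∂unitMeasure = ∑ i ∈ s, ‖c i‖ ^ 2 := by
  rw [integral_norm_sq_sum_mode]
  refine Finset.sum_congr rfl fun i hi => ?_
  simp only [hν.eq_iff]
  rw [Finset.sum_ite_eq, if_pos hi, Complex.mul_conj, Complex.ofReal_re, Complex.normSq_eq_norm_sq]

lemma integral_norm_sq_sum_mode_le {ι : Type*} (s : Finset ι) (d : ι → ℂ) (ν : ι → ℤ) (R : ℕ)
    (hR : ∀ i ∈ s, (s.filter fun j => ν i = ν j).card ≤ R) :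
    ∫ x, ‖∑ i ∈ s, d i * mode (ν i) x‖ ^ 2 ∂unitMeasure ≤ R * ∑ i ∈ s, ‖d i‖ ^ 2 := by
  rw [integral_norm_sq_sum_mode]
  have hre (i j : ι) : (d i * conj (d j)).re ≤ (‖d i‖ ^ 2 + ‖d j‖ ^ 2) / 2 := by
    have h := (Complex.re_le_norm (d i * conj (d j)))
    rw [norm_mul, RCLike.norm_conj] at h
    nlinarith [sq_nonneg (‖d i‖ - ‖d j‖)]
  have hdiag : ∑ i ∈ s, ∑ j ∈ s, (if ν i = ν j then ‖d i‖ ^ 2 else 0) ≤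
      R * ∑ i ∈ s, ‖d i‖ ^ 2 := by
    rw [Finset.mul_sum]
    refine Finset.sum_le_sum fun i hi => ?_
    rw [← Finset.sum_filter, Finset.sum_const, nsmul_eq_mul]
    exact mul_le_mul_of_nonneg_right (by exact_mod_cast hR i hi) (sq_nonneg _)
  have hsymm : ∑ i ∈ s, ∑ j ∈ s, (if ν i = ν j then ‖d j‖ ^ 2 else 0) =
      ∑ i ∈ s, ∑ j ∈ s, (if ν i = ν j then ‖d i‖ ^ 2 else 0) := by
    rw [Finset.sum_comm]
    simp only [eq_comm]
  calc _ ≤ ∑ i ∈ s, ∑ j ∈ s, ((if ν i = ν j then ‖d i‖ ^ 2 else 0) +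
        (if ν i = ν j then ‖d j‖ ^ 2 else 0)) / 2 := by
        refine Finset.sum_le_sum fun i _ => Finset.sum_le_sum fun j _ => ?_
        split_ifs
        · exact hre i j
        · simp
    _ ≤ _ := by
        simp only [← Finset.sum_div, Finset.sum_add_distrib]
        linarith

lemma integral_norm_pow_four_sum_mode_le (s : Finset ℕ) (c : ℕ → ℂ) (ν : ℕ → ℤ) (R : ℕ)
    (hR : ∀ u : ℤ, ((s ×ˢ s).filter fun p => u = ν p.1 + ν p.2).card ≤ R) :
    ∫ x, ‖∑ i ∈ s, c i * mode (ν i) x‖ ^ 4 ∂unitMeasure ≤ R * (∑ i ∈ s, ‖c i‖ ^ 2) ^ 2 := by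
  have h := integral_norm_sq_sum_mode_le (s ×ˢ s) (fun p => c p.1 * c p.2)
    (fun p => ν p.1 + ν p.2) R fun p _ => hR _
  have hsq (x : ℝ) : ∑ p ∈ s ×ˢ s, c p.1 * c p.2 * mode (ν p.1 + ν p.2) x =
      (∑ i ∈ s, c i * mode (ν i) x) ^ 2 := by
    rw [sq, Finset.sum_mul_sum, ← Finset.sum_product']
    refine Finset.sum_congr rfl fun p _ => ?_
    rw [mode_add]
    ring
  have hcoef : ∑ p ∈ s ×ˢ s, ‖c p.1 * c p.2‖ ^ 2 = (∑ i ∈ s, ‖c i‖ ^ 2) ^ 2 := by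
    rw [sq, Finset.sum_mul_sum, ← Finset.sum_product']
    exact Finset.sum_congr rfl fun p _ => by rw [norm_mul, mul_pow]
  simp only [hsq, hcoef, norm_pow, ← pow_mul] at h
  exact h

lemma integral_re_sq_sum_mode {ν : ℕ → ℤ} (hν : Function.Injective ν) (hpos : ∀ k, 0 < ν k)
    (s : Finset ℕ) (c : ℕ → ℂ) :
    ∫ x, (∑ i ∈ s, c i * mode (ν i) x).re ^ 2 ∂unitMeasure = (∑ i ∈ s, ‖c i‖ ^ 2) / 2 := by
  have hcont : Continuous fun x => ∑ i ∈ s, c i * mode (ν i) x :=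
    continuous_finsetSum _ fun i _ => (continuous_mode _).const_mul _
  have hre (z : ℂ) : z.re ^ 2 = (‖z‖ ^ 2 + RCLike.re (z ^ 2)) / 2 := by
    rw [← Complex.normSq_eq_norm_sq, Complex.normSq_apply, RCLike.re_to_complex, sq z,
      Complex.mul_re]
    ring
  have hzero : ∫ x, (∑ i ∈ s, c i * mode (ν i) x) ^ 2 ∂unitMeasure = 0 := by
    have hint (i j : ℕ) :
        Integrable (fun x => c i * c j * mode (ν i + ν j) x) unitMeasure :=
      integrable_of_continuous ((continuous_mode _).const_mul _)
    have hsq (x : ℝ) : (∑ i ∈ s, c i * mode (ν i) x) ^ 2 =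
        ∑ i ∈ s, ∑ j ∈ s, c i * c j * mode (ν i + ν j) x := by
      rw [sq, Finset.sum_mul_sum]
      refine Finset.sum_congr rfl fun i _ => Finset.sum_congr rfl fun j _ => ?_
      rw [mode_add]
      ring
    simp_rw [hsq]
    rw [integral_finsetSum _ fun i _ => integrable_finsetSum _ fun j _ => hint i j]
    refine Finset.sum_eq_zero fun i _ => ?_
    rw [integral_finsetSum _ fun j _ => hint i j]
    refine Finset.sum_eq_zero fun j _ => ?_
    rw [integral_const_mul, integral_mode, if_neg (by linarith [hpos i, hpos j]), mul_zero]
  have hint_sq : Integrable (fun x => (∑ i ∈ s, c i * mode (ν i) x) ^ 2) unitMeasure :=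
    integrable_of_continuous (hcont.pow 2)
  have hint_norm : Integrable (fun x => ‖∑ i ∈ s, c i * mode (ν i) x‖ ^ 2) unitMeasure :=
    integrable_of_continuous (hcont.norm.pow 2)
  simp_rw [hre]
  rw [integral_div, integral_add hint_norm hint_sq.re, integral_re hint_sq, hzero,
    integral_norm_sq_sum_mode_of_injective hν]
  simp

lemma pow_mul_le_of_gap {m : ℕ → ℕ} {q : ℝ} (hq : 1 < q)
    (hgap : ∀ k, q * m k ≤ m (k + 1)) (k j : ℕ) : q ^ j * m k ≤ m (k + j) := by
  induction j with
  | zero => simp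
  | succ j ih =>
    calc q ^ (j + 1) * m k = q * (q ^ j * m k) := by ring
      _ ≤ q * m (k + j) := by gcongr
      _ ≤ m (k + (j + 1)) := hgap (k + j)

lemma strictMono_of_gap {m : ℕ → ℕ} {q : ℝ} (hq : 1 < q) (hpos : ∀ k, 0 < m k)
    (hgap : ∀ k, q * m k ≤ m (k + 1)) : StrictMono m := by
  refine strictMono_nat_of_lt_succ fun k => ?_
  have hk : (0 : ℝ) < m k := by exact_mod_cast hpos k
  have h : (m k : ℝ) < m (k + 1) := by nlinarith [hgap k]
  exact_mod_cast h

lemma exists_card_add_eq_le {m : ℕ → ℕ} {q : ℝ} (hq : 1 < q) (hpos : ∀ k, 0 < m k)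
    (hgap : ∀ k, q * m k ≤ m (k + 1)) :
    ∃ R : ℕ, ∀ (s : Finset ℕ) (u : ℤ),
      ((s ×ˢ s).filter fun p => u = (m p.1 : ℤ) + (m p.2 : ℤ)).card ≤ R := by
  obtain ⟨M, hM⟩ := pow_unbounded_of_one_lt 2 hq
  have hmono := strictMono_of_gap hq hpos hgap
  refine ⟨M + M, fun s u => ?_⟩
  set A := s.filter fun k => (m k : ℤ) ≤ u ∧ u ≤ 2 * m k with hA
  have hcard : A.card ≤ M := by
    rcases A.eq_empty_or_nonempty with h | h
    · simp [h]
    · suffices hsub : A ⊆ Finset.Ico (A.min' h) (A.min' h + M) by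
        simpa using Finset.card_le_card hsub
      intro k hk
      refine Finset.mem_Ico.2 ⟨A.min'_le k hk, ?_⟩
      by_contra! hle
      have h0 := (Finset.mem_filter.1 (A.min'_mem h)).2.2
      have hk' := (Finset.mem_filter.1 hk).2.1
      have h1 := pow_mul_le_of_gap hq hgap (A.min' h) M
      have h2 : (m (A.min' h + M) : ℝ) ≤ m k := by exact_mod_cast hmono.monotone hle
      have h3 : (m k : ℝ) ≤ 2 * m (A.min' h) := by exact_mod_cast hk'.trans h0
      have h4 : (0 : ℝ) < m (A.min' h) := by exact_mod_cast hpos _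
      nlinarith
  set F := (s ×ˢ s).filter fun p => u = (m p.1 : ℤ) + (m p.2 : ℤ) with hF
  have hsplit : F ⊆ (F.filter fun p => p.1 ∈ A) ∪ (F.filter fun p => p.2 ∈ A) := by
    intro p hp
    simp only [Finset.mem_union, Finset.mem_filter, hp, true_and, hA]
    simp only [hF, Finset.mem_filter, Finset.mem_product] at hp
    rcases le_total (m p.1) (m p.2) with h | h
    · exact Or.inr ⟨hp.1.2, by lia, by lia⟩
    · exact Or.inl ⟨hp.1.1, by lia, by lia⟩
  have hfst : (F.filter fun p => p.1 ∈ A).card ≤ A.card := by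
    refine Finset.card_le_card_of_injOn Prod.fst (fun p hp => (Finset.mem_filter.1 hp).2) ?_
    intro p hp p' hp' h
    simp only [hF, Finset.coe_filter, Finset.mem_filter, Set.mem_ofPred_eq] at hp hp'
    refine Prod.ext h (hmono.injective ?_)
    rw [h] at hp
    lia
  have hsnd : (F.filter fun p => p.2 ∈ A).card ≤ A.card := by
    refine Finset.card_le_card_of_injOn Prod.snd (fun p hp => (Finset.mem_filter.1 hp).2) ?_
    intro p hp p' hp' h
    simp only [hF, Finset.coe_filter, Finset.mem_filter, Set.mem_ofPred_eq] at hp hp'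
    refine Prod.ext (hmono.injective ?_) h
    rw [h] at hp
    lia
  calc F.card ≤ _ := Finset.card_le_card hsplit
    _ ≤ _ := Finset.card_union_le _ _
    _ ≤ M + M := by lia

lemma exists_measureReal_exceed_le {S : ℕ → ℝ → ℝ} (hS : ∀ N, Continuous (S N))
    (hbdd : ∀ᵐ x ∂unitMeasure, ∃ B : ℝ, ∀ N, |S N x| ≤ B) {δ : ℝ} (hδ : 0 < δ) :
    ∃ B : ℕ, unitMeasure.real {x | ∃ N, (B : ℝ) < |S N x|} ≤ δ := by
  set E : ℕ → Set ℝ := fun B => {x | ∃ N, (B : ℝ) < |S N x|} with hE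
  have hmeas (B : ℕ) : MeasurableSet (E B) := by
    simp only [hE, Set.ofPred_exists]
    exact MeasurableSet.iUnion fun N => measurableSet_lt measurable_const (hS N).abs.measurable
  have hanti : Antitone E := fun B B' h x ⟨N, hN⟩ =>
    ⟨N, lt_of_le_of_lt (by exact_mod_cast h) hN⟩
  have hnull : unitMeasure (⋂ B, E B) = 0 := by
    rw [← compl_compl (⋂ B, E B)]
    refine mem_ae_iff.1 ?_
    filter_upwards [hbdd] with x ⟨B, hB⟩ hx
    obtain ⟨B', hB'⟩ := exists_nat_ge B
    obtain ⟨N, hN⟩ := Set.mem_iInter.1 hx B'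
    linarith [hB N]
  have hlim := tendsto_measure_iInter_atTop (μ := unitMeasure)
    (fun B => (hmeas B).nullMeasurableSet) hanti ⟨0, measure_ne_top _ _⟩
  rw [hnull] at hlim
  obtain ⟨B, hB⟩ := (hlim.eventually_le_const (ENNReal.ofReal_pos.2 hδ)).exists
  exact ⟨B, ENNReal.toReal_le_of_le_ofReal hδ.le hB⟩

/-- A lacunary series whose real partial sums are almost everywhere bounded has square-summable
coefficients. -/
theorem summable_of_ae_bounded {m : ℕ → ℕ} {q : ℝ} (hq : 1 < q) (hpos : ∀ k, 0 < m k)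
    (hgap : ∀ k, q * m k ≤ m (k + 1)) (c : ℕ → ℂ)
    (hbdd : ∀ᵐ x ∂unitMeasure, ∃ B : ℝ, ∀ N,
      |(∑ k ∈ Finset.range N, c k * mode (m k) x).re| ≤ B) :
    Summable fun k => ‖c k‖ ^ 2 := by
  obtain ⟨R, hR⟩ := exists_card_add_eq_le hq hpos hgap
  have hinj : Function.Injective fun k => (m k : ℤ) :=
    Nat.cast_injective.comp (strictMono_of_gap hq hpos hgap).injective
  set P : ℕ → ℝ → ℂ := fun N x => ∑ k ∈ Finset.range N, c k * mode (m k) x with hP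
  have hcont (N : ℕ) : Continuous (P N) :=
    continuous_finsetSum _ fun i _ => (continuous_mode _).const_mul _
  obtain ⟨B, hB⟩ := exists_measureReal_exceed_le (S := fun N x => (P N x).re)
    (fun N => Complex.continuous_re.comp (hcont N)) hbdd (δ := 1 / (16 * (R + 1))) (by positivity)
  set E : Set ℝ := {x | ∃ N, (B : ℝ) < |(P N x).re|} with hE
  have hEmeas : MeasurableSet E := by
    simp only [hE, Set.ofPred_exists]
    exact MeasurableSet.iUnion fun N => measurableSet_lt measurable_const
      (Complex.continuous_re.comp (hcont N)).abs.measurable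
  refine summable_of_sum_range_le (c := 4 * (B : ℝ) ^ 2) (fun _ => sq_nonneg _) fun N => ?_
  set A := ∑ k ∈ Finset.range N, ‖c k‖ ^ 2 with hA
  rcases (show 0 ≤ A by positivity).eq_or_lt with hA0 | hA0
  · rw [← hA0]
    positivity
  set t : ℝ := 1 / (4 * (R + 1) * A) with ht
  have ht0 : 0 < t := by positivity
  have hpt (x : ℝ) : (P N x).re ^ 2 ≤
      (B : ℝ) ^ 2 + t / 2 * ‖P N x‖ ^ 4 + E.indicator (fun _ => 1 / (2 * t)) x := by
    by_cases hx : x ∈ E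
    · rw [Set.indicator_of_mem hx]
      have h1 : (P N x).re ^ 2 ≤ ‖P N x‖ ^ 2 := by
        rw [← sq_abs]
        gcongr
        exact Complex.abs_re_le_norm _
      have h2 : ‖P N x‖ ^ 2 ≤ t / 2 * ‖P N x‖ ^ 4 + 1 / (2 * t) := by
        have h3 : t / 2 * ‖P N x‖ ^ 4 + 1 / (2 * t) - ‖P N x‖ ^ 2 =
            (t * ‖P N x‖ ^ 2 - 1) ^ 2 / (2 * t) := by
          field_simp
          ring
        have h4 : 0 ≤ (t * ‖P N x‖ ^ 2 - 1) ^ 2 / (2 * t) := by positivity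
        linarith
      nlinarith [sq_nonneg (B : ℝ)]
    · rw [Set.indicator_of_notMem hx]
      have h1 : |(P N x).re| ≤ B := not_lt.1 fun h => hx ⟨N, h⟩
      have h2 : (P N x).re ^ 2 ≤ (B : ℝ) ^ 2 := by
        rw [← sq_abs]
        gcongr
      have h3 : 0 ≤ t / 2 * ‖P N x‖ ^ 4 := by positivity
      linarith
  have hint4 : Integrable (fun x => t / 2 * ‖P N x‖ ^ 4) unitMeasure :=
    integrable_of_continuous (((hcont N).norm.pow 4).const_mul _)
  have hintE : Integrable (E.indicator fun _ => 1 / (2 * t)) unitMeasure :=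
    (integrable_const _).indicator hEmeas
  have hint04 : Integrable (fun x => (B : ℝ) ^ 2 + t / 2 * ‖P N x‖ ^ 4) unitMeasure :=
    (integrable_const _).add hint4
  have hint : ∫ x, (P N x).re ^ 2 ∂unitMeasure ≤ ∫ x, ((B : ℝ) ^ 2 + t / 2 * ‖P N x‖ ^ 4 +
      E.indicator (fun _ => 1 / (2 * t)) x) ∂unitMeasure :=
    integral_mono (integrable_of_continuous ((Complex.continuous_re.comp (hcont N)).pow 2))
      (hint04.add hintE) hpt
  have hsum : ∫ x, ((B : ℝ) ^ 2 + t / 2 * ‖P N x‖ ^ 4 + E.indicator (fun _ => 1 / (2 * t)) x)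
      ∂unitMeasure = (B : ℝ) ^ 2 + t / 2 * ∫ x, ‖P N x‖ ^ 4 ∂unitMeasure +
        unitMeasure.real E * (1 / (2 * t)) := by
    rw [integral_add hint04 hintE, integral_add (integrable_const _) hint4,
      integral_const_mul, integral_indicator_const _ hEmeas]
    simp
  have hsq : ∫ x, (P N x).re ^ 2 ∂unitMeasure = A / 2 :=
    integral_re_sq_sum_mode hinj (fun k => by exact_mod_cast hpos k) _ c
  have hfour : ∫ x, ‖P N x‖ ^ 4 ∂unitMeasure ≤ (R + 1) * A ^ 2 := by
    refine (integral_norm_pow_four_sum_mode_le _ c _ R (hR _)).trans ?_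
    gcongr
    linarith
  have h1 : t / 2 * ∫ x, ‖P N x‖ ^ 4 ∂unitMeasure ≤ A / 8 := by
    calc _ ≤ t / 2 * ((R + 1) * A ^ 2) := by gcongr
      _ = A / 8 := by rw [ht]; field_simp; norm_num
  have h2 : unitMeasure.real E * (1 / (2 * t)) ≤ A / 8 := by
    calc _ ≤ 1 / (16 * (R + 1)) * (1 / (2 * t)) := by gcongr
      _ = A / 8 := by rw [ht]; field_simp; norm_num
  have h3 : A / 2 ≤ (B : ℝ) ^ 2 + A / 8 + A / 8 := by
    calc A / 2 = _ := hsq.symm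
      _ ≤ _ := hint
      _ = _ := hsum
      _ ≤ _ := by gcongr
  linarith

lemma memLp_mode (m : ℤ) : MemLp (mode m) 2 unitMeasure :=
  MemLp.of_bound (continuous_mode m).aestronglyMeasurable 1 (ae_of_all _ fun x => (norm_mode m x).le)

lemma orthonormal_mode : Orthonormal ℂ fun m : ℤ => (memLp_mode m).toLp := by
  rw [orthonormal_iff_ite]
  intro i j
  have h : ∫ x, inner ℂ ((memLp_mode i).toLp (mode i) x) ((memLp_mode j).toLp (mode j) x)
      ∂unitMeasure = ∫ x, mode (-i + j) x ∂unitMeasure := by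
    refine integral_congr_ae ?_
    filter_upwards [(memLp_mode i).coeFn_toLp, (memLp_mode j).coeFn_toLp] with x hi hj
    rw [hi, hj, RCLike.inner_apply', conj_mode, mode_add]
  rw [L2.inner_def, h, integral_mode]
  simp only [neg_add_eq_zero]

/-- The Riesz–Fischer theorem, in terms of the integrals of the sum over subintervals. -/
lemma exists_hasSum_integral {ν : ℕ → ℤ} (hν : Function.Injective ν) {c : ℕ → ℂ}
    (hc : Summable fun k => ‖c k‖ ^ 2) :
    ∃ g : ℝ → ℂ, Integrable g unitMeasure ∧ ∀ x y, 0 ≤ x → x ≤ y → y ≤ 1 →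
      HasSum (fun k => c k * ∫ t in x..y, mode (ν k) t) (∫ t in x..y, g t) := by
  have hsum : Summable fun k => c k • (memLp_mode (ν k)).toLp :=
    ((orthonormal_mode.comp ν hν).orthogonalFamily.summable_iff_norm_sq_summable c).2 hc
  obtain ⟨g, hg⟩ := hsum
  refine ⟨g, (Lp.memLp g).integrable (by norm_num), fun x y hx hxy hy => ?_⟩
  have hsub : Set.Ioc x y ⊆ Set.Icc 0 1 := fun t ht => ⟨hx.trans ht.1.le, ht.2.trans hy⟩
  have hres : unitMeasure.restrict (Set.Ioc x y) = volume.restrict (Set.Ioc x y) :=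
    Measure.restrict_restrict_of_subset hsub
  have h := hg.mapL (innerSL ℂ (indicatorConstLp 2 (measurableSet_Ioc (a := x) (b := y))
    (measure_ne_top unitMeasure _) (1 : ℂ)))
  simp only [innerSL_apply_apply, inner_smul_right, L2.inner_indicatorConstLp_one, hres] at h
  simp only [intervalIntegral.integral_of_le hxy]
  refine h.congr_fun fun k => ?_
  congr 1
  rw [← hres]
  exact integral_congr_ae (ae_restrict_of_ae (memLp_mode (ν k)).coeFn_toLp.symm)

lemma tendsto_tsum_mul_pow {d : ℕ → ℝ} (hd : Tendsto d atTop (nhds 0)) {ρ : ℝ} (hρ0 : 0 ≤ ρ)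
    (hρ1 : ρ < 1) {σ : ℕ → ℕ → ℕ} (hσ : ∀ j, Tendsto (fun N => σ N j) atTop atTop) :
    Tendsto (fun N => ∑' j, d (σ N j) * ρ ^ j) atTop (nhds 0) := by
  obtain ⟨C, hC⟩ := hd.norm.bddAbove_range
  have h := tendsto_tsum_of_dominated_convergence (𝓕 := atTop)
    (f := fun N j => d (σ N j) * ρ ^ j) (g := fun _ => 0) (bound := fun j => C * ρ ^ j)
    ((summable_geometric_of_lt_one hρ0 hρ1).mul_left C)
    (fun j => by simpa using (hd.comp (hσ j)).mul_const (ρ ^ j))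
    (Eventually.of_forall fun N j => by
      rw [norm_mul, norm_pow, Real.norm_of_nonneg hρ0]
      exact mul_le_mul_of_nonneg_right (hC ⟨_, rfl⟩) (by positivity))
  simpa using h

/-- The average of `mode m` over an interval of length `1 / (2πM)` starting at `x`. -/
lemma average_mode {m M : ℕ} (hm : 0 < m) (hM : 0 < M) (x : ℝ) :
    ((1 / (2 * π * M) : ℝ) : ℂ)⁻¹ * ∫ t in x..x + 1 / (2 * π * M), mode m t =
      mode m x * ((Complex.exp (Complex.I * (m / M : ℝ)) - 1) / (Complex.I * (m / M : ℝ))) := by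
  have hM' : (M : ℂ) ≠ 0 := by exact_mod_cast hM.ne'
  have hMr : (M : ℝ) ≠ 0 := by exact_mod_cast hM.ne'
  have hm' : (m : ℂ) ≠ 0 := by exact_mod_cast hm.ne'
  have hπ : (π : ℂ) ≠ 0 := by exact_mod_cast pi_ne_zero
  have hshift : mode m (x + 1 / (2 * π * M)) =
      mode m x * Complex.exp (Complex.I * (m / M : ℝ)) := by
    rw [mode, mode, ← Complex.exp_add]
    congr 1
    push_cast
    field_simp
  rw [intervalIntegral_mode (by exact_mod_cast hm.ne'), hshift]
  push_cast
  field_simp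

lemma norm_average_mode_sub_le {m M : ℕ} (hm : 0 < m) (hmM : m ≤ M) (x : ℝ) :
    ‖((1 / (2 * π * M) : ℝ) : ℂ)⁻¹ * (∫ t in x..x + 1 / (2 * π * M), mode m t) - mode m x‖ ≤
      (m : ℝ) / M := by
  have hm' : (0 : ℝ) < m := by exact_mod_cast hm
  have hM' : (0 : ℝ) < M := by exact_mod_cast hm.trans_le hmM
  rw [average_mode hm (hm.trans_le hmM)]
  set r : ℝ := m / M with hr
  have hr0 : 0 < r := by positivity
  have hr1 : r ≤ 1 := (div_le_one hM').2 (by exact_mod_cast hmM)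
  have hnorm : ‖Complex.I * (r : ℂ)‖ = r := by simp [abs_of_pos hr0]
  have hne : Complex.I * (r : ℂ) ≠ 0 := norm_ne_zero_iff.1 (by rw [hnorm]; exact hr0.ne')
  have h := Complex.norm_exp_sub_one_sub_id_le (x := Complex.I * r) (by rw [hnorm]; exact hr1)
  rw [← mul_sub_one, norm_mul, norm_mode, one_mul, div_sub_one hne, norm_div, hnorm,
    div_le_iff₀ hr0, ← sq]
  rwa [hnorm] at h

lemma norm_average_mode_le {m M : ℕ} (hm : 0 < m) (hM : 0 < M) (x : ℝ) :
    ‖((1 / (2 * π * M) : ℝ) : ℂ)⁻¹ * (∫ t in x..x + 1 / (2 * π * M), mode m t)‖ ≤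
      2 * ((M : ℝ) / m) := by
  have hm' : (0 : ℝ) < m := by exact_mod_cast hm
  have hM' : (0 : ℝ) < M := by exact_mod_cast hM
  rw [average_mode hm hM, norm_mul, norm_mode, one_mul, norm_div, norm_mul, Complex.norm_I,
    one_mul, Complex.norm_real, Real.norm_of_nonneg (by positivity), div_div_eq_mul_div,
    mul_div_assoc]
  gcongr
  refine (norm_sub_le _ _).trans ?_
  rw [Complex.norm_exp_I_mul_ofReal, norm_one]
  norm_num

/-- A lacunary series with square-summable coefficients converges at almost every point. -/
theorem ae_tendsto_of_summable {m : ℕ → ℕ} {q : ℝ} (hq : 1 < q) (hpos : ∀ k, 0 < m k)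
    (hgap : ∀ k, q * m k ≤ m (k + 1)) {c : ℕ → ℂ} (hc : Summable fun k => ‖c k‖ ^ 2) :
    ∀ᵐ x ∂unitMeasure, ∃ L : ℂ,
      Tendsto (fun N => ∑ k ∈ Finset.range N, c k * mode (m k) x) atTop (nhds L) := by
  have hmono := strictMono_of_gap hq hpos hgap
  have hq0 : 0 < q := one_pos.trans hq
  obtain ⟨g, hgint, hg⟩ := exists_hasSum_integral (ν := fun k => (m k : ℤ))
    (Nat.cast_injective.comp hmono.injective) hc
  have hg' : IntervalIntegrable g volume 0 1 := by
    rw [intervalIntegrable_iff_integrableOn_Icc_of_le zero_le_one]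
    exact hgint
  have hd : Tendsto (fun k => ‖c k‖) atTop (nhds 0) := by
    simpa using hc.tendsto_atTop_zero.sqrt
  set ρ : ℝ := q⁻¹ with hρ
  have hρ0 : 0 ≤ ρ := by positivity
  have hρ1 : ρ < 1 := inv_lt_one_of_one_lt₀ hq
  have hratio (k j : ℕ) : (m k : ℝ) / m (k + j) ≤ ρ ^ j := by
    have h1 : (0 : ℝ) < m (k + j) := by exact_mod_cast hpos _
    rw [hρ, inv_pow, div_le_iff₀ h1, inv_mul_eq_div, le_div_iff₀' (by positivity)]
    exact pow_mul_le_of_gap hq hgap k j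
  obtain ⟨C, hC⟩ := hd.bddAbove_range
  have hsummable (τ : ℕ → ℕ) : Summable fun j => ‖c (τ j)‖ * ρ ^ j :=
    Summable.of_nonneg_of_le (fun j => by positivity)
      (fun j => mul_le_mul_of_nonneg_right (hC ⟨_, rfl⟩) (by positivity))
      ((summable_geometric_of_lt_one hρ0 hρ1).mul_left C)
  have hhead := tendsto_tsum_mul_pow hd hρ0 hρ1 (σ := fun N j => N - j)
    fun j => tendsto_sub_atTop_nat j
  have htail := tendsto_tsum_mul_pow hd hρ0 hρ1 (σ := fun N j => j + (N + 1))
    fun j => tendsto_atTop_mono (fun N => show N ≤ j + (N + 1) by lia) tendsto_id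
  set h : ℕ → ℝ := fun N => 1 / (2 * π * m N) with hh
  have hh0 (N : ℕ) : 0 < h N := by
    have : (0 : ℝ) < m N := by exact_mod_cast hpos N
    positivity
  have hhlim : Tendsto h atTop (nhds 0) :=
    tendsto_const_nhds.div_atTop
      ((tendsto_natCast_atTop_atTop.comp hmono.tendsto_atTop).const_mul_atTop (by positivity))
  rw [ae_restrict_iff' measurableSet_Icc]
  filter_upwards [hg'.ae_hasDerivAt_integral, Measure.ae_ne volume (1 : ℝ)] with x hx hx1 hxI
  rw [Set.uIcc_of_le zero_le_one] at hx
  have hderiv := hasDerivAt_iff_tendsto_slope_zero.1 (hx hxI x hxI)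
  have hlim := hderiv.comp (tendsto_nhdsWithin_iff.2
    ⟨hhlim, Eventually.of_forall fun N => (hh0 N).ne'⟩)
  refine ⟨g x, (tendsto_add_atTop_iff_nat 1).1 ?_⟩
  refine hlim.congr_dist ?_
  have hbound : Tendsto (fun N => (∑' j, ‖c (N - j)‖ * ρ ^ j) +
      2 * ∑' j, ‖c (j + (N + 1))‖ * ρ ^ j) atTop (nhds 0) := by
    simpa using hhead.add (htail.const_mul 2)
  refine squeeze_zero' (Eventually.of_forall fun _ => dist_nonneg) ?_ hbound
  have hx1' : 0 < 1 - x := sub_pos.2 (lt_of_le_of_ne hxI.2 hx1)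
  filter_upwards [hhlim.eventually_le_const hx1'] with N hN
  have hsum := (hg x (x + h N) hxI.1 (by linarith [hh0 N]) (by linarith)).mul_left ((h N : ℂ)⁻¹)
  set W : ℕ → ℂ := fun k => (h N : ℂ)⁻¹ * ∫ t in x..x + h N, mode (m k) t with hW
  have hsum' : HasSum (fun k => c k * W k) ((h N : ℂ)⁻¹ * ∫ t in x..x + h N, g t) :=
    hsum.congr_fun fun k => by simp only [hW]; ring
  have hWhead : ‖∑ k ∈ Finset.range (N + 1), (c k * W k - c k * mode (m k) x)‖ ≤
      ∑' j, ‖c (N - j)‖ * ρ ^ j := by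
    calc _ ≤ ∑ k ∈ Finset.range (N + 1), ‖c k‖ * ρ ^ (N - k) := by
          refine norm_sum_le_of_le _ fun k hk => ?_
          have hkN : k ≤ N := Nat.lt_succ_iff.1 (Finset.mem_range.1 hk)
          rw [← mul_sub, norm_mul]
          gcongr
          refine (norm_average_mode_sub_le (hpos k) (hmono.monotone hkN) x).trans ?_
          simpa [Nat.add_sub_cancel' hkN] using hratio k (N - k)
      _ = ∑ j ∈ Finset.range (N + 1), ‖c (N - j)‖ * ρ ^ j := by
          rw [← Finset.sum_range_reflect]
          refine Finset.sum_congr rfl fun j hj => ?_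
          have hjN : j ≤ N := Nat.lt_succ_iff.1 (Finset.mem_range.1 hj)
          simp [Nat.sub_sub_self hjN]
      _ ≤ _ := (hsummable fun j => N - j).sum_le_tsum _ fun j _ => by positivity
  have hWtail : ‖∑' j, c (j + (N + 1)) * W (j + (N + 1))‖ ≤
      2 * ∑' j, ‖c (j + (N + 1))‖ * ρ ^ j := by
    refine tsum_of_norm_bounded ((hsummable fun j => j + (N + 1)).hasSum.mul_left 2) fun j => ?_
    have h1 := norm_average_mode_le (hpos (j + (N + 1))) (hpos N) x
    have h2 := hratio N (j + 1)
    rw [show N + (j + 1) = j + (N + 1) by ring] at h2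
    have h3 : ρ ^ (j + 1) ≤ ρ ^ j := pow_le_pow_of_le_one hρ0 hρ1.le (Nat.le_succ j)
    rw [norm_mul]
    calc _ ≤ ‖c (j + (N + 1))‖ * (2 * ρ ^ j) := by
          gcongr
          exact h1.trans (by linarith)
      _ = _ := by ring
  have hsplit : (h N)⁻¹ • ((∫ t in x..x + h N, g t) - ∫ t in x..x, g t) -
      ∑ k ∈ Finset.range (N + 1), c k * mode (m k) x =
      ∑ k ∈ Finset.range (N + 1), (c k * W k - c k * mode (m k) x) +
        ∑' j, c (j + (N + 1)) * W (j + (N + 1)) := by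
    rw [intervalIntegral.integral_same, sub_zero, Complex.real_smul, Complex.ofReal_inv,
      ← hsum'.tsum_eq, ← hsum'.summable.sum_add_tsum_nat_add (N + 1), Finset.sum_sub_distrib]
    ring
  rw [dist_eq_norm]
  calc _ = _ := congrArg norm hsplit
    _ ≤ _ := norm_add_le _ _
    _ ≤ _ := add_le_add hWhead hWtail

lemma norm_sq_coeff (a b : ℝ) : ‖(a : ℂ) - b * Complex.I‖ ^ 2 = a ^ 2 + b ^ 2 := by
  rw [← Complex.normSq_eq_norm_sq, Complex.normSq_apply]
  simp
  ring

lemma re_coeff_mul_mode (a b : ℝ) (m : ℕ) (x : ℝ) :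
    (((a : ℂ) - b * Complex.I) * mode m x).re =
      a * Real.cos (2 * π * m * x) + b * Real.sin (2 * π * m * x) := by
  rw [mode, Complex.mul_re, Complex.exp_ofReal_mul_I_re, Complex.exp_ofReal_mul_I_im]
  simp

end LacunarySeries

/-- (Kolmogorov's convergence theorem for lacunary trigonometric series) If `(n_k)_{k ≥ 1}` is a
sequence of positive integers with `n_{k+1}/n_k ≥ q > 1` and `(a_k), (b_k)` are real sequences,
then `∑_{k=1}^∞ (a_k cos(2π n_k x) + b_k sin(2π n_k x))` converges for almost every `x ∈ [0,1]`
if and only if `∑_{k=1}^∞ (a_k² + b_k²) < ∞`. -/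
theorem kolmogorov_lacunary_convergence (n : ℕ → ℕ) (q : ℝ) (hq : 1 < q)
    (hpos : ∀ k, 1 ≤ k → 0 < n k)
    (hgap : ∀ k, 1 ≤ k → q ≤ (n (k + 1) : ℝ) / (n k : ℝ))
    (a b : ℕ → ℝ) :
    (∀ᵐ x ∂(volume.restrict (Set.Icc (0 : ℝ) 1)),
        ∃ L : ℝ, Tendsto
          (fun N : ℕ => ∑ k ∈ Finset.Icc 1 N,
            (a k * Real.cos (2 * Real.pi * (n k : ℝ) * x)
              + b k * Real.sin (2 * Real.pi * (n k : ℝ) * x)))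
          atTop (nhds L))
      ↔ Summable (fun k : ℕ => a k ^ 2 + b k ^ 2) := by
  set m : ℕ → ℕ := fun k => n (k + 1) with hm
  set c : ℕ → ℂ := fun k => (a (k + 1) : ℂ) - b (k + 1) * Complex.I with hc
  have hmpos (k : ℕ) : 0 < m k := hpos _ (Nat.le_add_left 1 k)
  have hmgap (k : ℕ) : q * m k ≤ m (k + 1) :=
    (le_div_iff₀ (by exact_mod_cast hmpos k)).1 (hgap (k + 1) (Nat.le_add_left 1 k))
  have hsum : (Summable fun k => a k ^ 2 + b k ^ 2) ↔ Summable fun k => ‖c k‖ ^ 2 := by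
    rw [← summable_nat_add_iff 1]
    simp only [hc, LacunarySeries.norm_sq_coeff]
  have hpartial (x : ℝ) (N : ℕ) : ∑ k ∈ Finset.Icc 1 N,
      (a k * Real.cos (2 * Real.pi * (n k : ℝ) * x) +
        b k * Real.sin (2 * Real.pi * (n k : ℝ) * x)) =
      (∑ k ∈ Finset.range N, c k * LacunarySeries.mode (m k) x).re := by
    simp only [Complex.re_sum, hc, hm, LacunarySeries.re_coeff_mul_mode]
    rw [Finset.range_eq_Ico, Finset.sum_Ico_add' (fun k => a k * Real.cos (2 * π * n k * x) +
      b k * Real.sin (2 * π * n k * x)) 0 N 1, zero_add, Finset.Ico_add_one_right_eq_Icc]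
  rw [hsum]
  simp only [hpartial]
  constructor
  · intro h
    refine LacunarySeries.summable_of_ae_bounded hq hmpos hmgap c ?_
    filter_upwards [h] with x ⟨L, hL⟩
    obtain ⟨B, hB⟩ := hL.abs.bddAbove_range
    exact ⟨B, fun N => hB ⟨N, rfl⟩⟩
  · intro h
    filter_upwards [LacunarySeries.ae_tendsto_of_summable hq hmpos hmgap h] with x ⟨L, hL⟩
    exact ⟨L.re, (Complex.continuous_re.tendsto L).comp hL⟩
end

section
/- (Salem–Zygmund central limit theorem) Let (n_k)_{k ≥ 1} be a sequence of positive integers satisfying the Hadamard gap condition n_{k+1}/n_k ≥ q for all k ≥ 1, for some q > 1. Then for every real number t, λ( { x ∈ [0,1] : ∑_{k=1}^N cos(2π n_k x) < t √(N/2) } ) → Φ(t) as N → ∞, where λ is Lebesgue measure and Φ is the standard normal distribution function. -/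
open MeasureTheory Filter Real

namespace SalemZygmund

/-- Trigonometric polynomials whose frequencies have absolute value in `[a, b]`. -/
def trigBand (a b : ℝ) : Submodule ℂ (ℝ → ℂ) :=
  Submodule.span ℂ ((fun (k : ℤ) (x : ℝ) => Complex.exp (2 * π * Complex.I * k * x)) ''
    {k : ℤ | a ≤ |(k : ℝ)| ∧ |(k : ℝ)| ≤ b})

lemma trigBand_mono {a b a' b' : ℝ} (ha : a' ≤ a) (hb : b ≤ b') :
    trigBand a b ≤ trigBand a' b' :=
  Submodule.span_mono (Set.image_mono fun _ hk => ⟨ha.trans hk.1, hk.2.trans hb⟩)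

lemma exp_mem_trigBand {a b : ℝ} {k : ℤ} (ha : a ≤ |(k : ℝ)|) (hb : |(k : ℝ)| ≤ b) :
    (fun x : ℝ => Complex.exp (2 * π * Complex.I * k * x)) ∈ trigBand a b :=
  Submodule.subset_span ⟨k, ⟨ha, hb⟩, rfl⟩

lemma continuous_of_mem_trigBand {a b : ℝ} {f : ℝ → ℂ} (hf : f ∈ trigBand a b) :
    Continuous f := by
  induction hf using Submodule.span_induction with
  | mem f h => obtain ⟨k, -, rfl⟩ := h; fun_prop
  | zero => exact continuous_const
  | add f g _ _ hf hg => exact hf.add hg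
  | smul c f _ hf => exact hf.const_smul c

lemma integral_eq_zero_of_mem_trigBand {a b : ℝ} (ha : 0 < a) {f : ℝ → ℂ}
    (hf : f ∈ trigBand a b) : ∫ x in (0 : ℝ)..1, f x = 0 := by
  induction hf using Submodule.span_induction with
  | mem f h =>
    obtain ⟨k, ⟨hk, -⟩, rfl⟩ := h
    have hk0 : k ≠ 0 := by
      rintro rfl
      simp at hk
      linarith
    have hne : 2 * (π : ℂ) * Complex.I * k ≠ 0 :=
      mul_ne_zero Complex.two_pi_I_ne_zero (by exact_mod_cast hk0)
    have h1 : Complex.exp (2 * π * Complex.I * k) = 1 := by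
      rw [mul_comm]
      exact Complex.exp_int_mul_two_pi_mul_I k
    simp only
    rw [integral_exp_mul_complex hne]
    simp [h1]
  | zero => simp
  | add f g hf' hg' hf hg =>
    have := intervalIntegral.integral_add (μ := volume)
      ((continuous_of_mem_trigBand hf').intervalIntegrable 0 1)
      ((continuous_of_mem_trigBand hg').intervalIntegrable 0 1)
    simp only [Pi.add_apply, this, hf, hg, add_zero]
  | smul c f _ hf =>
    simp only [Pi.smul_apply, intervalIntegral.integral_smul, hf, smul_zero]

lemma mul_mem_trigBand {a b a' b' : ℝ} {f g : ℝ → ℂ} (hf : f ∈ trigBand a b)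
    (hg : g ∈ trigBand a' b') : f * g ∈ trigBand (a' - b) (b + b') := by
  have h := Submodule.mul_mem_mul hf hg
  rw [trigBand, trigBand, Submodule.span_mul_span] at h
  refine Submodule.span_mono ?_ h
  rintro _ ⟨_, ⟨k, hk, rfl⟩, _, ⟨l, hl, rfl⟩, rfl⟩
  refine ⟨k + l, ⟨?_, ?_⟩, ?_⟩
  · have := abs_sub_abs_le_abs_sub (l : ℝ) (-k)
    rw [abs_neg, sub_neg_eq_add, add_comm (l : ℝ)] at this
    push_cast
    linarith [hk.2, hl.1]
  · have := abs_add_le (k : ℝ) l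
    push_cast
    linarith [hk.2, hl.2]
  · ext x
    simp only [Pi.mul_apply, ← Complex.exp_add]
    push_cast
    ring_nf

lemma const_mem_trigBand {a b : ℝ} (ha : a ≤ 0) (hb : 0 ≤ b) (c : ℂ) :
    (fun _ => c) ∈ trigBand a b := by
  have := Submodule.smul_mem _ c (exp_mem_trigBand (k := 0) (a := a) (b := b)
    (by simpa using ha) (by simpa using hb))
  convert this using 1
  ext x
  simp

lemma cos_mem_trigBand {a b : ℝ} {k : ℤ} (ha : a ≤ |(k : ℝ)|) (hb : |(k : ℝ)| ≤ b) :
    (fun x : ℝ => (Real.cos (2 * π * k * x) : ℂ)) ∈ trigBand a b := by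
  have h1 := exp_mem_trigBand ha hb
  have h2 := exp_mem_trigBand (k := -k) (a := a) (b := b) (by simpa using ha) (by simpa using hb)
  convert Submodule.smul_mem _ (1 / 2 : ℂ) (Submodule.add_mem _ h1 h2) using 1
  ext x
  simp only [Complex.ofReal_cos, Complex.cos, Pi.smul_apply, Pi.add_apply, smul_eq_mul]
  push_cast
  ring_nf

lemma sq_sum_cos_sub_mem_trigBand {ι : Type*} (s : Finset ι) (f : ι → ℕ) {a b : ℝ}
    (ha : ∀ i ∈ s, a ≤ 2 * f i) (hb : ∀ i ∈ s, 2 * (f i : ℝ) ≤ b)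
    (hsep : ∀ i ∈ s, ∀ j ∈ s, i ≠ j → a ≤ |(f i : ℝ) - f j|) :
    (fun x : ℝ => (((∑ i ∈ s, Real.cos (2 * π * f i * x)) ^ 2 - s.card / 2 : ℝ) : ℂ))
      ∈ trigBand a b := by
  classical
  have hterm : ∀ i ∈ s, ∀ j ∈ s, (fun x : ℝ => ((Real.cos (2 * π * f i * x) *
      Real.cos (2 * π * f j * x) - if i = j then 1 / 2 else 0 : ℝ) : ℂ)) ∈ trigBand a b := by
    intro i hi j hj
    have hfi : (0 : ℝ) ≤ f i := Nat.cast_nonneg _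
    have hfj : (0 : ℝ) ≤ f j := Nat.cast_nonneg _
    have hbi := hb i hi
    have hbj := hb j hj
    have habs : |(f i : ℝ) - f j| ≤ f i + f j := abs_le.2 ⟨by linarith, by linarith⟩
    have hsum : (fun x : ℝ => (Real.cos (2 * π * ((f i + f j : ℤ) : ℝ) * x) : ℂ))
        ∈ trigBand a b := by
      refine cos_mem_trigBand ?_ ?_ <;> push_cast <;>
        rw [abs_of_nonneg (show (0 : ℝ) ≤ f i + f j by positivity)]
      · by_cases hij : i = j
        · subst hij
          linarith [ha i hi]
        · exact (hsep i hi j hj hij).trans habs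
      · linarith
    by_cases hij : i = j
    · subst hij
      convert Submodule.smul_mem _ (1 / 2 : ℂ) hsum using 1
      ext x
      have : Real.cos (2 * π * ((f i + f i : ℤ) : ℝ) * x)
          = 2 * Real.cos (2 * π * f i * x) ^ 2 - 1 := by
        rw [← Real.cos_two_mul]
        push_cast
        ring_nf
      simp only [this, if_true, Pi.smul_apply, smul_eq_mul]
      push_cast
      ring
    · have hdiff : (fun x : ℝ => (Real.cos (2 * π * ((f i - f j : ℤ) : ℝ) * x) : ℂ))
          ∈ trigBand a b := by
        refine cos_mem_trigBand ?_ ?_ <;> push_cast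
        · exact hsep i hi j hj hij
        · linarith
      convert Submodule.smul_mem _ (1 / 2 : ℂ) (Submodule.add_mem _ hsum hdiff) using 1
      ext x
      have : Real.cos (2 * π * f i * x) * Real.cos (2 * π * f j * x)
          = 1 / 2 * (Real.cos (2 * π * ((f i + f j : ℤ) : ℝ) * x)
            + Real.cos (2 * π * ((f i - f j : ℤ) : ℝ) * x)) := by
        push_cast
        rw [show 2 * π * ((f i : ℝ) + f j) * x = 2 * π * f i * x + 2 * π * f j * x by ring,
          show 2 * π * ((f i : ℝ) - f j) * x = 2 * π * f i * x - 2 * π * f j * x by ring,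
          Real.cos_add, Real.cos_sub]
        ring
      simp only [this, if_neg hij, Pi.smul_apply, Pi.add_apply, smul_eq_mul]
      push_cast
      ring
  convert Submodule.sum_mem _ fun i hi => Submodule.sum_mem _ (hterm i hi) using 1
  ext x
  simp only [Finset.sum_apply, ← Complex.ofReal_sum, Finset.sum_sub_distrib, Finset.sum_ite_eq]
  congr 2
  · rw [sq, Finset.sum_mul_sum]
  · simp [div_eq_mul_inv]

lemma integral_prod_one_add_eq_one {Y : ℕ → ℝ → ℂ} {A B : ℕ → ℝ}
    (hY : ∀ j, Y j ∈ trigBand (A j) (B j)) (hA : 0 < A 0) (hAB : ∀ j, A j ≤ B j)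
    (hBA : ∀ j, 2 * B j ≤ A (j + 1)) (m : ℕ) :
    ∫ x in (0 : ℝ)..1, ∏ j ∈ Finset.range m, (1 + Complex.I * Y j x) = 1 := by
  have hpos : ∀ j, 0 < A j := fun j => by
    induction j with
    | zero => exact hA
    | succ j ih => linarith [hAB j, hBA j]
  suffices h : ∃ F < A m, (fun x => ∏ j ∈ Finset.range m, (1 + Complex.I * Y j x))
      ∈ trigBand 0 F ∧ ∫ x in (0 : ℝ)..1, ∏ j ∈ Finset.range m, (1 + Complex.I * Y j x) = 1 by
    obtain ⟨_, _, _, h⟩ := h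
    exact h
  induction m with
  | zero =>
    refine ⟨0, hA, ?_, by simp⟩
    simpa using const_mem_trigBand le_rfl le_rfl 1
  | succ m ih =>
    obtain ⟨F, hF, hT, hintegral⟩ := ih
    have hTY := mul_mem_trigBand hT (hY m)
    have hIT := Submodule.smul_mem _ Complex.I hTY
    have heq : (fun x => ∏ j ∈ Finset.range (m + 1), (1 + Complex.I * Y j x))
        = (fun x => ∏ j ∈ Finset.range m, (1 + Complex.I * Y j x)) +
          Complex.I • ((fun x => ∏ j ∈ Finset.range m, (1 + Complex.I * Y j x)) * Y m) := by
      ext x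
      simp only [Finset.prod_range_succ, Pi.add_apply, Pi.smul_apply, Pi.mul_apply, smul_eq_mul]
      ring
    refine ⟨F + B m, by linarith [hAB m, hBA m], ?_, ?_⟩
    · rw [heq]
      exact Submodule.add_mem _ (trigBand_mono le_rfl (by linarith [hAB m, hpos m]) hT)
        (trigBand_mono (by linarith) le_rfl hIT)
    · simp_rw [congrFun heq]
      simp only [Pi.add_apply]
      rw [intervalIntegral.integral_add ((continuous_of_mem_trigBand hT).intervalIntegrable 0 1)
        ((continuous_of_mem_trigBand hIT).intervalIntegrable 0 1), hintegral,
        integral_eq_zero_of_mem_trigBand (by linarith) hIT, add_zero]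

lemma integral_sq_sum_le {Z : ℕ → ℝ → ℝ} {A B : ℕ → ℝ} {D : ℝ}
    (hZ : ∀ j, (fun x => (Z j x : ℂ)) ∈ trigBand (A j) (B j)) (hA : 0 < A 0)
    (hAB : ∀ j, A j ≤ B j) (hBA : ∀ j, B j < A (j + 1)) (hD : ∀ j x, |Z j x| ≤ D) (m : ℕ) :
    ∫ x in (0 : ℝ)..1, (∑ j ∈ Finset.range m, Z j x) ^ 2 ≤ m * D ^ 2 := by
  have hpos : ∀ j, 0 < A j := fun j => by
    induction j with
    | zero => exact hA
    | succ j ih => linarith [hAB j, hBA j]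
  have hcont : ∀ j, Continuous (Z j) := fun j => by
    exact Complex.continuous_re.comp (continuous_of_mem_trigBand (hZ j))
  suffices h : ∃ F < A m, (fun x => ((∑ j ∈ Finset.range m, Z j x : ℝ) : ℂ))
      ∈ trigBand 0 F ∧ ∫ x in (0 : ℝ)..1, (∑ j ∈ Finset.range m, Z j x) ^ 2 ≤ m * D ^ 2 by
    obtain ⟨_, _, _, h⟩ := h
    exact h
  induction m with
  | zero =>
    refine ⟨0, hA, ?_, by simp⟩
    simpa using const_mem_trigBand le_rfl le_rfl 0
  | succ m ih =>
    obtain ⟨F, hF, hT, hintegral⟩ := ih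
    refine ⟨B m, hBA m, ?_, ?_⟩
    · convert Submodule.add_mem _ (trigBand_mono le_rfl (hF.le.trans (hAB m)) hT)
        (trigBand_mono (hpos m).le le_rfl (hZ m)) using 1
      ext x
      simp [Finset.sum_range_succ]
    · have hcross : ∫ x in (0 : ℝ)..1, (∑ j ∈ Finset.range m, Z j x) * Z m x = 0 := by
        have h := integral_eq_zero_of_mem_trigBand (by linarith) (mul_mem_trigBand hT (hZ m))
        simp only [Pi.mul_apply, ← Complex.ofReal_mul] at h
        rw [intervalIntegral.integral_ofReal] at h
        exact_mod_cast h
      have hlast : ∫ x in (0 : ℝ)..1, Z m x ^ 2 ≤ D ^ 2 := by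
        have h := intervalIntegral.integral_mono_on (μ := volume) (zero_le_one' ℝ)
          (((hcont m).pow 2).intervalIntegrable 0 1) (continuous_const.intervalIntegrable 0 1)
          fun x _ => sq_le_sq' (abs_le.1 (hD m x)).1 (abs_le.1 (hD m x)).2
        simpa using h
      have hsplit : ∀ x, (∑ j ∈ Finset.range (m + 1), Z j x) ^ 2
          = (∑ j ∈ Finset.range m, Z j x) ^ 2 +
            2 * ((∑ j ∈ Finset.range m, Z j x) * Z m x) + Z m x ^ 2 := fun x => by
        rw [Finset.sum_range_succ]
        ring
      simp_rw [hsplit]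
      rw [intervalIntegral.integral_add, intervalIntegral.integral_add,
        intervalIntegral.integral_const_mul, hcross]
      · push_cast
        linarith
      all_goals exact Continuous.intervalIntegrable (by fun_prop) _ _

lemma norm_exp_sub_one_add_le {z : ℝ} (hz : |z| ≤ 1) :
    ‖Complex.exp (Complex.I * z + z ^ 2 / 2) - (1 + Complex.I * z)‖ ≤ 20 * |z| ^ 3 := by
  set w : ℂ := Complex.I * z + z ^ 2 / 2 with hw
  have hI : Complex.I ^ 2 = -1 := Complex.I_sq
  have h := Complex.norm_exp_sub_sum_le_norm_mul_exp w 3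
  have h0 := abs_nonneg z
  have hwn : ‖w‖ ≤ 3 / 2 * |z| := by
    refine (norm_add_le _ _).trans ?_
    simp only [norm_mul, Complex.norm_I, norm_div, norm_pow, Complex.norm_real, Real.norm_eq_abs,
      Complex.norm_ofNat]
    nlinarith
  have hexp : Real.exp ‖w‖ ≤ 5 := by
    have h1 : Real.exp ‖w‖ ≤ Real.exp (3 / 2) := Real.exp_le_exp.2 (by linarith)
    have h2 : Real.exp (3 / 2) ^ 2 ≤ 5 ^ 2 := by
      rw [← Real.exp_nat_mul]
      have : Real.exp ((2 : ℕ) * (3 / 2 : ℝ)) = Real.exp 1 ^ 3 := by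
        rw [← Real.exp_nat_mul]
        norm_num
      rw [this]
      calc Real.exp 1 ^ 3 ≤ 2.72 ^ 3 := by
            gcongr
            linarith [Real.exp_one_lt_d9]
        _ ≤ 5 ^ 2 := by norm_num
    exact h1.trans (le_of_sq_le_sq h2 (by norm_num))
  have hrem : ∑ m ∈ Finset.range 3, w ^ m / (m.factorial : ℂ) - (1 + Complex.I * z)
      = Complex.I * z ^ 3 / 2 + z ^ 4 / 8 := by
    simp [Finset.sum_range_succ, Nat.factorial, hw]
    linear_combination (z : ℂ) ^ 2 / 2 * hI
  have hremn : ‖Complex.I * (z : ℂ) ^ 3 / 2 + (z : ℂ) ^ 4 / 8‖ ≤ |z| ^ 3 := by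
    refine (norm_add_le _ _).trans ?_
    simp only [norm_mul, Complex.norm_I, norm_div, norm_pow, Complex.norm_real, Real.norm_eq_abs,
      Complex.norm_ofNat]
    have : |z| ^ 4 ≤ |z| ^ 3 := pow_le_pow_of_le_one h0 hz (by norm_num)
    nlinarith [pow_nonneg h0 3]
  calc ‖Complex.exp w - (1 + Complex.I * z)‖
      = ‖(Complex.exp w - ∑ m ∈ Finset.range 3, w ^ m / (m.factorial : ℂ)) +
          (Complex.I * z ^ 3 / 2 + z ^ 4 / 8)‖ := by
        rw [← hrem]
        ring_nf
    _ ≤ ‖w‖ ^ 3 * Real.exp ‖w‖ + |z| ^ 3 := (norm_add_le _ _).trans (add_le_add h hremn)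
    _ ≤ (3 / 2 * |z|) ^ 3 * 5 + |z| ^ 3 := by gcongr
    _ ≤ 20 * |z| ^ 3 := by nlinarith [pow_nonneg h0 3]

lemma norm_one_add_I_mul_le (z : ℝ) : ‖1 + Complex.I * (z : ℂ)‖ ≤ Real.exp (z ^ 2 / 2) := by
  refine le_of_sq_le_sq ?_ (Real.exp_pos _).le
  rw [← Complex.normSq_eq_norm_sq, ← Real.exp_nat_mul]
  have : Complex.normSq (1 + Complex.I * (z : ℂ)) = z ^ 2 + 1 := by
    simp [Complex.normSq_apply]
    ring
  rw [this]
  refine (Real.add_one_le_exp (z ^ 2)).trans_eq ?_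
  congr 1
  push_cast
  ring

lemma norm_exp_I_mul_add (z : ℝ) (y : ℝ) :
    ‖Complex.exp (Complex.I * z + y)‖ = Real.exp y := by
  rw [Complex.norm_exp]
  simp

lemma norm_exp_sum_sub_prod_le {z : ℕ → ℝ} {δ : ℝ} (hδ : δ ≤ 1) (hz : ∀ j, |z j| ≤ δ) (m : ℕ) :
    ‖Complex.exp (Complex.I * (∑ j ∈ Finset.range m, z j : ℝ)
        + ((∑ j ∈ Finset.range m, z j ^ 2) / 2 : ℝ))
      - ∏ j ∈ Finset.range m, (1 + Complex.I * (z j : ℂ))‖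
      ≤ Real.exp (m * δ ^ 2 / 2) * (20 * m * δ ^ 3) := by
  have hδ0 : 0 ≤ δ := (abs_nonneg _).trans (hz 0)
  have hsq : ∀ j, z j ^ 2 ≤ δ ^ 2 := fun j => by
    rw [← sq_abs]
    exact pow_le_pow_left₀ (abs_nonneg _) (hz j) 2
  induction m with
  | zero => simp
  | succ m ih =>
    set P := ∏ j ∈ Finset.range m, (1 + Complex.I * (z j : ℂ))
    set E := Complex.exp (Complex.I * (∑ j ∈ Finset.range m, z j : ℝ)
        + ((∑ j ∈ Finset.range m, z j ^ 2) / 2 : ℝ))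
    have hP : ‖P‖ ≤ Real.exp (m * δ ^ 2 / 2) := by
      calc ‖P‖ ≤ ∏ j ∈ Finset.range m, Real.exp (δ ^ 2 / 2) := by
            rw [norm_prod]
            refine Finset.prod_le_prod (fun _ _ => norm_nonneg _) fun j _ => ?_
            exact (norm_one_add_I_mul_le _).trans (Real.exp_le_exp.2 (by linarith [hsq j]))
        _ = Real.exp (m * δ ^ 2 / 2) := by
            rw [Finset.prod_const, Finset.card_range, ← Real.exp_nat_mul]
            ring_nf
    have hE1 : Complex.exp (Complex.I * (∑ j ∈ Finset.range (m + 1), z j : ℝ)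
        + ((∑ j ∈ Finset.range (m + 1), z j ^ 2) / 2 : ℝ))
        = E * Complex.exp (Complex.I * z m + z m ^ 2 / 2) := by
      rw [← Complex.exp_add]
      simp only [Finset.sum_range_succ]
      push_cast
      ring_nf
    have he : ‖Complex.exp (Complex.I * z m + z m ^ 2 / 2)‖ ≤ Real.exp (δ ^ 2 / 2) := by
      have := norm_exp_I_mul_add (z m) (z m ^ 2 / 2)
      push_cast at this
      rw [this]
      exact Real.exp_le_exp.2 (by linarith [hsq m])
    have hd : ‖Complex.exp (Complex.I * z m + z m ^ 2 / 2) - (1 + Complex.I * z m)‖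
        ≤ 20 * δ ^ 3 :=
      (norm_exp_sub_one_add_le ((hz m).trans hδ)).trans (by gcongr; exact hz m)
    have h1 : 1 ≤ Real.exp (δ ^ 2 / 2) := Real.one_le_exp (by positivity)
    rw [hE1, Finset.prod_range_succ]
    calc ‖E * Complex.exp (Complex.I * z m + z m ^ 2 / 2) - P * (1 + Complex.I * z m)‖
        = ‖(E - P) * Complex.exp (Complex.I * z m + z m ^ 2 / 2) +
            P * (Complex.exp (Complex.I * z m + z m ^ 2 / 2) - (1 + Complex.I * z m))‖ := by
          ring_nf
      _ ≤ Real.exp (m * δ ^ 2 / 2) * (20 * m * δ ^ 3) * Real.exp (δ ^ 2 / 2) +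
            Real.exp (m * δ ^ 2 / 2) * (20 * δ ^ 3) := by
          refine (norm_add_le _ _).trans ?_
          rw [norm_mul, norm_mul]
          gcongr
      _ ≤ Real.exp (m * δ ^ 2 / 2) * (20 * m * δ ^ 3) * Real.exp (δ ^ 2 / 2) +
            Real.exp (m * δ ^ 2 / 2) * (20 * δ ^ 3) * Real.exp (δ ^ 2 / 2) := by
          exact add_le_add_right (le_mul_of_one_le_right (by positivity) h1) _
      _ = Real.exp ((m + 1 : ℕ) * δ ^ 2 / 2) * (20 * (m + 1 : ℕ) * δ ^ 3) := by
          have : Real.exp ((m + 1 : ℕ) * δ ^ 2 / 2)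
              = Real.exp (m * δ ^ 2 / 2) * Real.exp (δ ^ 2 / 2) := by
            rw [← Real.exp_add]
            push_cast
            ring_nf
          rw [this]
          push_cast
          ring

lemma integral_abs_le_of_integral_sq_le {f : ℝ → ℝ} (hf : Continuous f) {s : ℝ} (hs : 0 ≤ s)
    (h : ∫ x in (0 : ℝ)..1, f x ^ 2 ≤ s ^ 2) : ∫ x in (0 : ℝ)..1, |f x| ≤ s := by
  set I := ∫ x in (0 : ℝ)..1, |f x| with hI
  have h0 : 0 ≤ ∫ x in (0 : ℝ)..1, (|f x| - I) ^ 2 :=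
    intervalIntegral.integral_nonneg zero_le_one fun x _ => sq_nonneg _
  have h1 : ∀ x, (|f x| - I) ^ 2 = f x ^ 2 - 2 * I * |f x| + I ^ 2 := fun x => by
    rw [← sq_abs (f x)]
    ring
  simp_rw [h1] at h0
  rw [intervalIntegral.integral_add, intervalIntegral.integral_sub,
    intervalIntegral.integral_const_mul, ← hI] at h0
  · simp at h0
    exact le_of_sq_le_sq (by nlinarith) hs
  all_goals exact Continuous.intervalIntegrable (by fun_prop) _ _

lemma norm_integral_exp_sum_sub_le {Y : ℕ → ℝ → ℝ} {A B A' B' : ℕ → ℝ} {δ w : ℝ}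
    (hY : ∀ j, (fun x => (Y j x : ℂ)) ∈ trigBand (A j) (B j)) (hA : 0 < A 0)
    (hAB : ∀ j, A j ≤ B j) (hBA : ∀ j, 2 * B j ≤ A (j + 1))
    (hZ : ∀ j, (fun x => ((Y j x ^ 2 - w : ℝ) : ℂ)) ∈ trigBand (A' j) (B' j)) (hA' : 0 < A' 0)
    (hAB' : ∀ j, A' j ≤ B' j) (hBA' : ∀ j, B' j < A' (j + 1))
    (hδ : δ ≤ 1) (hYδ : ∀ j x, |Y j x| ≤ δ) (hw0 : 0 ≤ w) (hw : w ≤ δ ^ 2) (m : ℕ) :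
    ‖(∫ x in (0 : ℝ)..1, Complex.exp (Complex.I * (∑ j ∈ Finset.range m, Y j x : ℝ)))
        - Real.exp (-(m * w / 2))‖
      ≤ Real.exp (m * δ ^ 2 / 2) * (20 * m * δ ^ 3 + √m * δ ^ 2 / 2) := by
  have hcont : ∀ j, Continuous (Y j) := fun j =>
    Complex.continuous_re.comp (continuous_of_mem_trigBand (hY j))
  have hsq : ∀ j x, Y j x ^ 2 ≤ δ ^ 2 := fun j x => by
    rw [← sq_abs]
    exact pow_le_pow_left₀ (abs_nonneg _) (hYδ j x) 2
  set U : ℝ → ℝ := fun x => ∑ j ∈ Finset.range m, Y j x with hU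
  set Q : ℝ → ℝ := fun x => ∑ j ∈ Finset.range m, Y j x ^ 2 with hQ
  set P : ℝ → ℂ := fun x => ∏ j ∈ Finset.range m, (1 + Complex.I * (Y j x : ℂ)) with hP
  set M := Real.exp (m * δ ^ 2 / 2) with hM
  have hUc : Continuous U := by fun_prop
  have hQc : Continuous Q := by fun_prop
  have hPc : Continuous P := by fun_prop
  have hQle : ∀ x, Q x ≤ m * δ ^ 2 := fun x => by
    simpa using Finset.sum_le_sum fun j (_ : j ∈ Finset.range m) => hsq j x
  have hintegral : ∫ x in (0 : ℝ)..1, P x = 1 := integral_prod_one_add_eq_one hY hA hAB hBA m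
  have hdev : ∫ x in (0 : ℝ)..1, |Q x - m * w| ≤ √m * δ ^ 2 := by
    refine integral_abs_le_of_integral_sq_le (by fun_prop) (by positivity) ?_
    have h := integral_sq_sum_le (D := δ ^ 2) hZ hA' hAB' hBA'
      (fun j x => abs_le.2 ⟨by linarith [sq_nonneg (Y j x)], by linarith [hsq j x]⟩) m
    rw [mul_pow, Real.sq_sqrt (Nat.cast_nonneg m)]
    simpa [hQ, Finset.sum_sub_distrib] using h
  have hpt : ∀ x, ‖Complex.exp (Complex.I * U x) * Real.exp (m * w / 2) - P x‖
      ≤ M * (20 * m * δ ^ 3) + M / 2 * |Q x - m * w| := fun x => by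
    have h1 := norm_exp_sum_sub_prod_le hδ (fun j => hYδ j x) m
    have h2 : ‖Complex.exp (Complex.I * U x) * (Real.exp (m * w / 2) - Real.exp (Q x / 2) : ℝ)‖
        ≤ M / 2 * |Q x - m * w| := by
      rw [norm_mul, Complex.norm_exp_I_mul_ofReal, one_mul, Complex.norm_real, Real.norm_eq_abs]
      have hlip : ∀ a b : ℝ, a ≤ b → b ≤ m * δ ^ 2 / 2 →
          Real.exp b - Real.exp a ≤ M * (b - a) := fun a b hab hb => by
        have h3 := Real.add_one_le_exp (a - b)
        have h4 : Real.exp a = Real.exp b * Real.exp (a - b) := by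
          rw [← Real.exp_add]
          ring_nf
        have h5 : Real.exp b ≤ M := Real.exp_le_exp.2 hb
        have h6 := Real.exp_pos b
        nlinarith
      have hwm : m * w / 2 ≤ m * δ ^ 2 / 2 := by gcongr
      have hQm : Q x / 2 ≤ m * δ ^ 2 / 2 := by linarith [hQle x]
      rcases le_total (Q x) (m * w) with h | h
      · rw [abs_of_nonneg (sub_nonneg.2 (Real.exp_le_exp.2 (by linarith))),
          abs_of_nonpos (sub_nonpos.2 h)]
        linarith [hlip (Q x / 2) (m * w / 2) (by linarith) hwm]
      · rw [abs_of_nonpos (sub_nonpos.2 (Real.exp_le_exp.2 (by linarith))),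
          abs_of_nonneg (sub_nonneg.2 h)]
        linarith [hlip (m * w / 2) (Q x / 2) (by linarith) hQm]
    have h3 : Complex.exp (Complex.I * U x) * Real.exp (m * w / 2) - P x
        = (Complex.exp (Complex.I * U x + ((Q x / 2 : ℝ) : ℂ)) - P x)
          + Complex.exp (Complex.I * U x) *
            (Real.exp (m * w / 2) - Real.exp (Q x / 2) : ℝ) := by
      rw [Complex.exp_add]
      push_cast
      ring
    rw [h3]
    exact (norm_add_le _ _).trans (add_le_add h1 h2)
  have hkey : ‖(∫ x in (0 : ℝ)..1, Complex.exp (Complex.I * U x)) * Real.exp (m * w / 2) - 1‖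
      ≤ M * (20 * m * δ ^ 3 + √m * δ ^ 2 / 2) := by
    rw [← hintegral, ← intervalIntegral.integral_mul_const, ← intervalIntegral.integral_sub]
    · refine (intervalIntegral.norm_integral_le_of_norm_le zero_le_one
        (.of_forall fun x _ => hpt x) ?_).trans ?_
      · exact Continuous.intervalIntegrable (by fun_prop) _ _
      · rw [intervalIntegral.integral_add, intervalIntegral.integral_const_mul]
        · have hM0 : 0 ≤ M / 2 := by positivity
          simp
          nlinarith [mul_le_mul_of_nonneg_left hdev hM0]
        all_goals exact Continuous.intervalIntegrable (by fun_prop) _ _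
    all_goals exact Continuous.intervalIntegrable (by fun_prop) _ _
  have hexp : (Real.exp (m * w / 2) : ℂ) * Real.exp (-(m * w / 2)) = 1 := by
    rw [← Complex.ofReal_mul, ← Real.exp_add]
    simp
  have hfac : (∫ x in (0 : ℝ)..1, Complex.exp (Complex.I * U x)) - Real.exp (-(m * w / 2))
      = ((∫ x in (0 : ℝ)..1, Complex.exp (Complex.I * U x)) * Real.exp (m * w / 2) - 1)
        * Real.exp (-(m * w / 2)) := by
    rw [sub_mul, mul_assoc, hexp]
    ring
  rw [hfac, norm_mul]
  refine (mul_le_of_le_one_right (norm_nonneg _) ?_).trans hkey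
  rw [Complex.norm_real, Real.norm_eq_abs, abs_of_pos (Real.exp_pos _), Real.exp_le_one_iff]
  have : 0 ≤ m * w := by positivity
  linarith

lemma pow_mul_le_of_mul_le_succ {a : ℕ → ℕ} {q : ℝ} (hq : 0 ≤ q)
    (ha : ∀ k, q * a k ≤ a (k + 1)) (k i : ℕ) : q ^ i * a k ≤ a (k + i) := by
  induction i with
  | zero => simp
  | succ i ih =>
    calc q ^ (i + 1) * a k = q * (q ^ i * a k) := by ring
      _ ≤ q * a (k + i) := by gcongr
      _ ≤ a (k + (i + 1)) := ha _

lemma strictMono_of_gap {a : ℕ → ℕ} {q : ℝ} (hq : 1 < q) (hpos : ∀ k, 0 < a k)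
    (ha : ∀ k, q * a k ≤ a (k + 1)) : StrictMono a := by
  refine strictMono_nat_of_lt_succ fun k => ?_
  have : (0 : ℝ) < a k := by exact_mod_cast hpos k
  have h : (a k : ℝ) < a (k + 1) := by nlinarith [ha k]
  exact_mod_cast h

lemma mul_le_abs_sub_of_gap {a : ℕ → ℕ} {q : ℝ} (hq : 1 < q) (hpos : ∀ k, 0 < a k)
    (ha : ∀ k, q * a k ≤ a (k + 1)) {s k l : ℕ} (hk : s ≤ k) (hl : s ≤ l) (hkl : k ≠ l) :
    (q - 1) * a s ≤ |(a k : ℝ) - a l| := by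
  have hmono := strictMono_of_gap hq hpos ha
  wlog h : l < k generalizing k l
  · rw [abs_sub_comm]
    exact this hl hk hkl.symm (lt_of_le_of_ne (not_lt.1 h) hkl)
  have h1 : (a (l + 1) : ℝ) ≤ a k := by exact_mod_cast hmono.monotone h
  have h2 : (a s : ℝ) ≤ a l := by exact_mod_cast hmono.monotone hl
  refine le_trans ?_ (le_abs_self _)
  nlinarith [ha l]

lemma integral_sq_sum_cos {a : ℕ → ℕ} (hpos : ∀ k, 0 < a k) (ha : StrictMono a) (s : Finset ℕ) :
    ∫ x in (0 : ℝ)..1, (∑ k ∈ s, Real.cos (2 * π * a k * x)) ^ 2 = s.card / 2 := by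
  obtain ⟨b, hb⟩ : ∃ b : ℝ, ∀ k ∈ s, 2 * (a k : ℝ) ≤ b :=
    ⟨∑ k ∈ s, 2 * (a k : ℝ), fun k hk =>
      Finset.single_le_sum (f := fun k => 2 * (a k : ℝ)) (fun _ _ => by positivity) hk⟩
  have h := integral_eq_zero_of_mem_trigBand one_pos
    (sq_sum_cos_sub_mem_trigBand s a (a := 1) (b := b) (fun k _ => ?_) hb fun k _ l _ hkl => ?_)
  · rw [intervalIntegral.integral_ofReal] at h
    have h' : ∫ x in (0 : ℝ)..1, ((∑ k ∈ s, Real.cos (2 * π * a k * x)) ^ 2 - s.card / 2) = 0 := by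
      exact_mod_cast h
    rw [intervalIntegral.integral_sub] at h'
    · simp at h'
      linarith
    all_goals exact Continuous.intervalIntegrable (by fun_prop) _ _
  · have : (1 : ℝ) ≤ a k := by exact_mod_cast hpos k
    linarith
  · have : (1 : ℤ) ≤ |(a k : ℤ) - a l| :=
      Int.one_le_abs (sub_ne_zero.2 (by exact_mod_cast ha.injective.ne hkl))
    exact_mod_cast this

lemma norm_integral_exp_blocks_sub_le {a : ℕ → ℕ} {q κ : ℝ} (hq : 1 < q) (hpos : ∀ k, 0 < a k)
    (ha : ∀ k, q * a k ≤ a (k + 1)) (hκ0 : 0 < κ) (hκ1 : κ ≤ 1) (hκq : κ ≤ q - 1) {g : ℕ}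
    (hg : 2 < κ * q ^ g) {p : ℕ} (hp : 0 < p) {c : ℝ} (hc : p * |c| ≤ 1) (m : ℕ) :
    ‖(∫ x in (0 : ℝ)..1, Complex.exp (Complex.I * (∑ j ∈ Finset.range m,
          c * ∑ i ∈ Finset.range p, Real.cos (2 * π * a (j * (p + g) + i) * x) : ℝ)))
        - Real.exp (-(m * (c ^ 2 * p / 2) / 2))‖
      ≤ Real.exp (m * (p * |c|) ^ 2 / 2) *
        (20 * m * (p * |c|) ^ 3 + √m * (p * |c|) ^ 2 / 2) := by
  have hmono := strictMono_of_gap hq hpos ha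
  have hapos : ∀ k, (0 : ℝ) < a k := fun k => by exact_mod_cast hpos k
  have hle : ∀ {k l}, k ≤ l → (a k : ℝ) ≤ a l := fun h => by exact_mod_cast hmono.monotone h
  have hstep : ∀ j, 2 * (a (j * (p + g) + (p - 1)) : ℝ) < κ * a ((j + 1) * (p + g)) := fun j => by
    have h1 := pow_mul_le_of_mul_le_succ (by linarith) ha (j * (p + g) + (p - 1)) g
    have h2 : (a (j * (p + g) + (p - 1) + g) : ℝ) ≤ a ((j + 1) * (p + g)) :=
      hle (by rw [add_mul, one_mul]; omega)
    have h3 := hapos (j * (p + g) + (p - 1))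
    nlinarith
  refine norm_integral_exp_sum_sub_le (A := fun j => a (j * (p + g)))
    (B := fun j => a (j * (p + g) + (p - 1))) (A' := fun j => κ * a (j * (p + g)))
    (B' := fun j => 2 * a (j * (p + g) + (p - 1))) (fun j => ?_) (by simpa using hapos 0)
    (fun j => hle (by omega)) (fun j => ?_) (fun j => ?_) (by simpa using mul_pos hκ0 (hapos 0))
    (fun j => ?_) hstep hc (fun j x => ?_) (by positivity) ?_ m
  · have h : ∀ i ∈ Finset.range p, (fun x : ℝ => (Real.cos (2 * π *
        ((a (j * (p + g) + i) : ℤ) : ℝ) * x) : ℂ)) ∈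
        trigBand (a (j * (p + g))) (a (j * (p + g) + (p - 1))) := fun i hi => by
      have hi' := Finset.mem_range.1 hi
      refine cos_mem_trigBand ?_ ?_ <;>
        rw [Int.cast_natCast, abs_of_pos (hapos _)]
      · exact hle (by omega)
      · exact hle (by omega)
    convert Submodule.smul_mem _ (c : ℂ) (Submodule.sum_mem _ h) using 1
    ext x
    simp
  · have := hstep j
    have := hapos ((j + 1) * (p + g))
    nlinarith
  · have h := sq_sum_cos_sub_mem_trigBand (Finset.range p) (fun i => a (j * (p + g) + i))
      (a := κ * a (j * (p + g))) (b := 2 * a (j * (p + g) + (p - 1))) (fun i _ => ?_)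
      (fun i hi => ?_) fun i _ l _ hil => ?_
    · convert Submodule.smul_mem _ ((c : ℂ) ^ 2) h using 1
      ext x
      simp only [Pi.smul_apply, smul_eq_mul, Finset.card_range]
      push_cast
      ring
    · have h1 : (a (j * (p + g)) : ℝ) ≤ a (j * (p + g) + i) := hle (by omega)
      nlinarith [hapos (j * (p + g))]
    · have hi' := Finset.mem_range.1 hi
      have h1 : (a (j * (p + g) + i) : ℝ) ≤ a (j * (p + g) + (p - 1)) := hle (by omega)
      linarith
    · refine le_trans ?_ (mul_le_abs_sub_of_gap hq hpos ha (s := j * (p + g)) (by omega)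
        (by omega) (by omega))
      exact mul_le_mul_of_nonneg_right hκq (hapos _).le
  · have h1 : (a (j * (p + g)) : ℝ) ≤ a (j * (p + g) + (p - 1)) := hle (by omega)
    nlinarith [hapos (j * (p + g))]
  · rw [abs_mul, mul_comm]
    gcongr
    refine (Finset.abs_sum_le_sum_abs _ _).trans ?_
    simpa using Finset.sum_le_sum fun i (_ : i ∈ Finset.range p) =>
      Real.abs_cos_le_one (2 * π * a (j * (p + g) + i) * x)
  · have h1 : (1 : ℝ) ≤ p := by exact_mod_cast hp
    rw [mul_pow, sq_abs]
    nlinarith [mul_nonneg (sq_nonneg c) (show (0 : ℝ) ≤ p * (p - 1 / 2) by nlinarith)]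

lemma norm_exp_I_mul_sub_exp_I_mul_le (x y : ℝ) :
    ‖Complex.exp (Complex.I * x) - Complex.exp (Complex.I * y)‖ ≤ |x - y| := by
  have h : Complex.exp (Complex.I * x) - Complex.exp (Complex.I * y)
      = Complex.exp (Complex.I * y) * (Complex.exp (Complex.I * (x - y : ℝ)) - 1) := by
    rw [mul_sub, ← Complex.exp_add]
    push_cast
    ring_nf
  rw [h, norm_mul, Complex.norm_exp_I_mul_ofReal, one_mul]
  exact Real.norm_exp_I_mul_ofReal_sub_one_le

lemma abs_exp_neg_sub_exp_neg_le {x y : ℝ} (hx : 0 ≤ x) (hxy : x ≤ y) :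
    |Real.exp (-x) - Real.exp (-y)| ≤ y - x := by
  rw [abs_of_nonneg (sub_nonneg.2 (Real.exp_le_exp.2 (by linarith)))]
  have h1 : Real.exp (-y) = Real.exp (-x) * Real.exp (-(y - x)) := by
    rw [← Real.exp_add]
    ring_nf
  have h2 : Real.exp (-x) ≤ 1 := Real.exp_le_one_iff.2 (by linarith)
  have h3 := Real.add_one_le_exp (-(y - x))
  have h4 := Real.exp_pos (-x)
  nlinarith

/-- The index set of `m` blocks of length `p` separated by gaps of length `g`. -/
def blockIndices (m p g : ℕ) : Finset ℕ :=
  (Finset.range m ×ˢ Finset.range p).image fun ji => ji.1 * (p + g) + ji.2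

lemma injOn_blockIndex (m p g : ℕ) : Set.InjOn (fun ji : ℕ × ℕ => ji.1 * (p + g) + ji.2)
    (Finset.range m ×ˢ Finset.range p : Finset (ℕ × ℕ)) := by
  rintro ⟨j, i⟩ h ⟨j', i'⟩ h' heq
  simp only [Finset.coe_product, Finset.coe_range, Set.mem_prod, Set.mem_Iio] at h h' heq
  rcases lt_trichotomy j j' with hj | rfl | hj
  · have := Nat.mul_le_mul_right (p + g) (Nat.succ_le_of_lt hj)
    rw [Nat.succ_mul] at this
    omega
  · simp only [Prod.mk.injEq, true_and]
    omega
  · have := Nat.mul_le_mul_right (p + g) (Nat.succ_le_of_lt hj)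
    rw [Nat.succ_mul] at this
    omega

lemma card_blockIndices (m p g : ℕ) : (blockIndices m p g).card = m * p := by
  rw [blockIndices, Finset.card_image_of_injOn (injOn_blockIndex m p g)]
  simp

lemma sum_blockIndices (m p g : ℕ) (f : ℕ → ℝ) :
    ∑ k ∈ blockIndices m p g, f k
      = ∑ j ∈ Finset.range m, ∑ i ∈ Finset.range p, f (j * (p + g) + i) := by
  rw [blockIndices, Finset.sum_image (injOn_blockIndex m p g), Finset.sum_product]

lemma blockIndices_subset_range {m p g N : ℕ} (h : m * (p + g) ≤ N) :
    blockIndices m p g ⊆ Finset.range N := by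
  intro k hk
  simp only [blockIndices, Finset.mem_image, Finset.mem_product, Finset.mem_range,
    Prod.exists] at hk ⊢
  obtain ⟨j, i, ⟨hj, hi⟩, rfl⟩ := hk
  have := Nat.mul_le_mul_right (p + g) (Nat.succ_le_of_lt hj)
  rw [Nat.succ_mul] at this
  omega

lemma norm_integral_exp_sum_cos_sub_le {a : ℕ → ℕ} {q κ : ℝ} (hq : 1 < q) (hpos : ∀ k, 0 < a k)
    (ha : ∀ k, q * a k ≤ a (k + 1)) (hκ0 : 0 < κ) (hκ1 : κ ≤ 1) (hκq : κ ≤ q - 1) {g : ℕ}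
    (hg : 2 < κ * q ^ g) {p : ℕ} (hp : 0 < p) {θ : ℝ} {N : ℕ} (hN : 0 < N)
    (hc : p * |θ * √(2 / N)| ≤ 1) :
    ‖(∫ x in (0 : ℝ)..1, Complex.exp (Complex.I * (θ * √(2 / N) *
          ∑ k ∈ Finset.range N, Real.cos (2 * π * a k * x) : ℝ)))
        - Real.exp (-(θ ^ 2 / 2))‖
      ≤ |θ| * √(g / (p + g) + p / N) + θ ^ 2 / 2 * (g / (p + g) + p / N)
        + Real.exp (p ^ 2 * θ ^ 2) * (40 * p ^ 2 * θ ^ 2 + p * |θ|) * (p * |θ * √(2 / N)|) := by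
  have hNr : (0 : ℝ) < N := by exact_mod_cast hN
  have hpr : (0 : ℝ) < p := by exact_mod_cast hp
  set c := θ * √(2 / N) with hcdef
  have hc2 : c ^ 2 * N = 2 * θ ^ 2 := by
    rw [hcdef, mul_pow, Real.sq_sqrt (by positivity)]
    field_simp
  set m := N / (p + g) with hm
  have hmL : m * (p + g) ≤ N := Nat.div_mul_le_self _ _
  have hmN : m ≤ N := Nat.div_le_self _ _
  have hmp : m * p ≤ N := (Nat.mul_le_mul_left m (Nat.le_add_right p g)).trans hmL
  have hmNr : (m : ℝ) ≤ N := by exact_mod_cast hmN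
  have hmpr : (m : ℝ) * p ≤ N := by exact_mod_cast hmp
  set ρ : ℝ := 1 - m * p / N with hρ
  have hρ0 : 0 ≤ ρ := sub_nonneg.2 ((div_le_one hNr).2 hmpr)
  have hρN : ρ * N = N - m * p := by
    rw [hρ]
    field_simp
  have hρle : ρ ≤ g / (p + g) + p / N := by
    have h1 : N < (m + 1) * (p + g) := Nat.lt_mul_of_div_lt (Nat.lt_succ_self _) (by omega)
    have h2 : (N : ℝ) < (m + 1) * (p + g) := by exact_mod_cast h1
    have h3 : (g : ℝ) / (p + g) + p / N - ρ
        = p * ((m + 1) * (p + g) - N) / ((p + g) * N) := by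
      rw [hρ]
      field_simp
      ring
    have h4 : 0 ≤ (p : ℝ) * ((m + 1) * (p + g) - N) / ((p + g) * N) := by
      have : (0 : ℝ) ≤ (m + 1) * (p + g) - N := by linarith
      positivity
    linarith
  set s := Finset.range N \ blockIndices m p g with hs
  have hsub : blockIndices m p g ⊆ Finset.range N := blockIndices_subset_range hmL
  have hscard : (s.card : ℝ) = N - m * p := by
    rw [hs, Finset.card_sdiff_of_subset hsub, card_blockIndices, Finset.card_range,
      Nat.cast_sub hmp]
    push_cast
    ring
  set S : ℝ → ℝ := fun x => c * ∑ k ∈ Finset.range N, Real.cos (2 * π * a k * x) with hS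
  set U : ℝ → ℝ := fun x => ∑ j ∈ Finset.range m,
    c * ∑ i ∈ Finset.range p, Real.cos (2 * π * a (j * (p + g) + i) * x) with hU
  have hSc : Continuous S := by fun_prop
  have hUc : Continuous U := by fun_prop
  have hSU : ∀ x, S x - U x = c * ∑ k ∈ s, Real.cos (2 * π * a k * x) := fun x => by
    have h := Finset.sum_sdiff (f := fun k => Real.cos (2 * π * a k * x)) hsub
    simp only [hS, hU]
    rw [← Finset.mul_sum, ← sum_blockIndices m p g fun k => Real.cos (2 * π * a k * x), ← h]
    ring
  have hdrop : ∫ x in (0 : ℝ)..1, |S x - U x| ≤ |θ| * √ρ := by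
    refine integral_abs_le_of_integral_sq_le (f := fun x => S x - U x) (hSc.sub hUc)
      (by positivity) (le_of_eq ?_)
    simp_rw [hSU, mul_pow]
    rw [intervalIntegral.integral_const_mul,
      integral_sq_sum_cos hpos (strictMono_of_gap hq hpos ha), hscard, ← hρN, sq_abs,
      Real.sq_sqrt hρ0]
    linear_combination ρ / 2 * hc2
  have hA : ‖(∫ x in (0 : ℝ)..1, Complex.exp (Complex.I * S x))
      - ∫ x in (0 : ℝ)..1, Complex.exp (Complex.I * U x)‖ ≤ |θ| * √ρ := by
    rw [← intervalIntegral.integral_sub]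
    · exact (intervalIntegral.norm_integral_le_of_norm_le zero_le_one
        (.of_forall fun x _ => norm_exp_I_mul_sub_exp_I_mul_le _ _)
        ((hSc.sub hUc).abs.intervalIntegrable 0 1)).trans hdrop
    all_goals exact Continuous.intervalIntegrable (by fun_prop) _ _
  have hB := norm_integral_exp_blocks_sub_le hq hpos ha hκ0 hκ1 hκq hg hp hc m
  have hC : ‖((Real.exp (-(m * (c ^ 2 * p / 2) / 2)) : ℝ) : ℂ) - (Real.exp (-(θ ^ 2 / 2)) : ℝ)‖
      ≤ θ ^ 2 / 2 * ρ := by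
    have hv : m * (c ^ 2 * p / 2) / 2 = θ ^ 2 / 2 - θ ^ 2 / 2 * ρ := by
      have h1 : (m : ℝ) * p = N - ρ * N := by linarith
      linear_combination c ^ 2 / 4 * h1 + (1 - ρ) / 4 * hc2
    rw [← Complex.ofReal_sub, Complex.norm_real, Real.norm_eq_abs]
    refine (abs_exp_neg_sub_exp_neg_le (by positivity) ?_).trans_eq (by rw [hv]; ring)
    rw [hv]
    exact sub_le_self _ (by positivity)
  have hE : Real.exp (m * (p * |c|) ^ 2 / 2) *
        (20 * m * (p * |c|) ^ 3 + √m * (p * |c|) ^ 2 / 2)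
      ≤ Real.exp (p ^ 2 * θ ^ 2) * (40 * p ^ 2 * θ ^ 2 + p * |θ|) * (p * |c|) := by
    set u := p * |c| with hu
    have hu0 : 0 ≤ u := by positivity
    have hNu : N * u ^ 2 = 2 * (p ^ 2 * θ ^ 2) := by
      rw [hu, mul_pow, sq_abs]
      linear_combination (p : ℝ) ^ 2 * hc2
    have hmu : m * u ^ 2 ≤ 2 * (p ^ 2 * θ ^ 2) := by
      rw [← hNu]
      gcongr
    have hsu : √m * u ≤ 2 * (p * |θ|) := by
      refine le_of_sq_le_sq ?_ (by positivity)
      have h1 : (√m * u) ^ 2 = m * u ^ 2 := by rw [mul_pow, Real.sq_sqrt (Nat.cast_nonneg m)]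
      have h2 : (2 * (p * |θ|)) ^ 2 = 4 * (p ^ 2 * θ ^ 2) := by
        rw [mul_pow, mul_pow, sq_abs]
        norm_num
      rw [h1, h2]
      linarith [show 0 ≤ (p : ℝ) ^ 2 * θ ^ 2 by positivity]
    have h1 : 20 * m * u ^ 3 + √m * u ^ 2 / 2
        = (20 * (m * u ^ 2) + √m * u / 2) * u := by ring
    have h2 : 20 * (m * u ^ 2) + √m * u / 2 ≤ 40 * p ^ 2 * θ ^ 2 + p * |θ| := by linarith
    have h3 : Real.exp (m * u ^ 2 / 2) ≤ Real.exp (p ^ 2 * θ ^ 2) :=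
      Real.exp_le_exp.2 (by linarith)
    rw [h1, mul_assoc (Real.exp (p ^ 2 * θ ^ 2))]
    exact mul_le_mul h3 (mul_le_mul_of_nonneg_right h2 hu0) (by positivity) (by positivity)
  have hsqrt : |θ| * √ρ ≤ |θ| * √(g / (p + g) + p / N) := by gcongr
  have hlin : θ ^ 2 / 2 * ρ ≤ θ ^ 2 / 2 * (g / (p + g) + p / N) := by gcongr
  calc ‖(∫ x in (0 : ℝ)..1, Complex.exp (Complex.I * S x)) - Real.exp (-(θ ^ 2 / 2))‖
      ≤ ‖(∫ x in (0 : ℝ)..1, Complex.exp (Complex.I * S x))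
          - ∫ x in (0 : ℝ)..1, Complex.exp (Complex.I * U x)‖
        + ‖(∫ x in (0 : ℝ)..1, Complex.exp (Complex.I * U x))
          - Real.exp (-(m * (c ^ 2 * p / 2) / 2))‖
        + ‖((Real.exp (-(m * (c ^ 2 * p / 2) / 2)) : ℝ) : ℂ)
          - (Real.exp (-(θ ^ 2 / 2)) : ℝ)‖ := by
        refine le_trans (le_of_eq ?_) (norm_add₃_le)
        congr 1
        ring
    _ ≤ _ := by linarith [hB.trans hE]

lemma tendsto_integral_exp_sum_cos {a : ℕ → ℕ} {q : ℝ} (hq : 1 < q) (hpos : ∀ k, 0 < a k)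
    (ha : ∀ k, q * a k ≤ a (k + 1)) (θ : ℝ) :
    Tendsto (fun N : ℕ => ∫ x in (0 : ℝ)..1, Complex.exp (Complex.I * (θ * √(2 / N) *
      ∑ k ∈ Finset.range N, Real.cos (2 * π * a k * x) : ℝ))) atTop
      (nhds (Real.exp (-(θ ^ 2 / 2)) : ℝ)) := by
  obtain ⟨κ, hκ0, hκ1, hκq⟩ : ∃ κ : ℝ, 0 < κ ∧ κ ≤ 1 ∧ κ ≤ q - 1 :=
    ⟨min 1 (q - 1), lt_min one_pos (by linarith), min_le_left _ _, min_le_right _ _⟩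
  obtain ⟨g, hg⟩ : ∃ g : ℕ, 2 < κ * q ^ g := by
    obtain ⟨g, hg⟩ := pow_unbounded_of_one_lt (2 / κ) hq
    exact ⟨g, by rwa [div_lt_iff₀' hκ0] at hg⟩
  have hc : Tendsto (fun N : ℕ => |θ * √(2 / N)|) atTop (nhds 0) := by
    have h : Tendsto (fun N : ℕ => (2 : ℝ) / N) atTop (nhds 0) :=
      tendsto_const_div_atTop_nhds_zero_nat 2
    have h2 : Continuous fun y : ℝ => |θ * √y| := by fun_prop
    simpa only [Real.sqrt_zero, mul_zero, abs_zero, Function.comp_def] using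
      (h2.tendsto 0).comp h
  rw [Metric.tendsto_atTop']
  simp_rw [dist_eq_norm]
  intro ε hε
  have hlim : Tendsto (fun p : ℕ => |θ| * √(g / (p + g)) + θ ^ 2 / 2 * (g / (p + g)))
      atTop (nhds 0) := by
    have h : Tendsto (fun p : ℕ => (g : ℝ) / (p + g)) atTop (nhds 0) :=
      tendsto_const_nhds.div_atTop
        (tendsto_atTop_add_const_right _ _ tendsto_natCast_atTop_atTop)
    have h2 : Continuous fun y : ℝ => |θ| * √y + θ ^ 2 / 2 * y := by fun_prop
    simpa only [Real.sqrt_zero, mul_zero, add_zero, Function.comp_def] using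
      (h2.tendsto 0).comp h
  obtain ⟨p, hpε, hp⟩ := ((hlim.eventually_lt_const hε).and (eventually_gt_atTop 0)).exists
  have hbound : Tendsto (fun N : ℕ => |θ| * √(g / (p + g) + p / N)
        + θ ^ 2 / 2 * (g / (p + g) + p / N)
        + Real.exp (p ^ 2 * θ ^ 2) * (40 * p ^ 2 * θ ^ 2 + p * |θ|) * (p * |θ * √(2 / N)|))
      atTop (nhds (|θ| * √(g / (p + g)) + θ ^ 2 / 2 * (g / (p + g)))) := by
    have h : Tendsto (fun N : ℕ => (g : ℝ) / (p + g) + p / N) atTop (nhds (g / (p + g))) := by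
      simpa using (tendsto_const_nhds (x := (g : ℝ) / (p + g))).add
        (tendsto_const_div_atTop_nhds_zero_nat (p : ℝ))
    have h2 : Continuous fun y : ℝ => |θ| * √y + θ ^ 2 / 2 * y := by fun_prop
    have h3 := ((h2.tendsto _).comp h).add ((hc.const_mul (p : ℝ)).const_mul
      (Real.exp (p ^ 2 * θ ^ 2) * (40 * p ^ 2 * θ ^ 2 + p * |θ|)))
    simpa using h3
  have hsmall : ∀ᶠ N : ℕ in atTop, p * |θ * √(2 / N)| < 1 := by
    have := hc.const_mul (p : ℝ)
    rw [mul_zero] at this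
    exact this.eventually_lt_const one_pos
  obtain ⟨N₀, hN₀⟩ := eventually_atTop.1
    ((hbound.eventually_lt_const hpε).and (hsmall.and (eventually_gt_atTop 0)))
  refine ⟨N₀, fun N hN => ?_⟩
  obtain ⟨h1, h2, h3⟩ := hN₀ N hN.le
  exact (norm_integral_exp_sum_cos_sub_le hq hpos ha hκ0 hκ1 hκq hg hp h3 h2.le).trans_lt h1

end SalemZygmund

open SalemZygmund ProbabilityTheory in
/-- (Salem–Zygmund central limit theorem) If `(n_k)_{k ≥ 1}` is a sequence of positive integers
with `n_{k+1}/n_k ≥ q > 1`, then for every real `t`,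
`λ({x ∈ [0,1] : ∑_{k=1}^N cos(2π n_k x) < t √(N/2)}) → Φ(t)` as `N → ∞`, where `Φ` is the
standard normal distribution function. -/
theorem salem_zygmund_clt (n : ℕ → ℕ) (q : ℝ) (hq : 1 < q)
    (hpos : ∀ k, 1 ≤ k → 0 < n k)
    (hgap : ∀ k, 1 ≤ k → q ≤ (n (k + 1) : ℝ) / (n k : ℝ)) (t : ℝ) :
    Tendsto
      (fun N : ℕ =>
        (volume {x ∈ Set.Icc (0 : ℝ) 1 |
          ∑ k ∈ Finset.Icc 1 N, Real.cos (2 * Real.pi * (n k : ℝ) * x)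
            < t * Real.sqrt ((N : ℝ) / 2)}).toReal)
      atTop
      (nhds ((Real.sqrt (2 * Real.pi))⁻¹ * ∫ u in Set.Iio t, Real.exp (-u ^ 2 / 2))) := by
  have hpos' : ∀ k, 0 < n (k + 1) := fun k => hpos _ (by omega)
  have ha : ∀ k, q * n (k + 1) ≤ n (k + 1 + 1) := fun k =>
    (le_div_iff₀ (by exact_mod_cast hpos' k)).1 (hgap (k + 1) (by omega))
  let S : ℕ → ℝ → ℝ := fun N x =>
    √(2 / N) * ∑ k ∈ Finset.range N, Real.cos (2 * π * n (k + 1) * x)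
  have hS : ∀ N, Measurable (S N) := fun N => by fun_prop
  let P : Measure ℝ := volume.restrict (Set.Icc 0 1)
  have : IsProbabilityMeasure P := ⟨by simp [P]⟩
  let μ : ℕ → ProbabilityMeasure ℝ := fun N =>
    ⟨P.map (S N), Measure.isProbabilityMeasure_map (hS N).aemeasurable⟩
  let γ : ProbabilityMeasure ℝ := ⟨gaussianReal 0 1, inferInstance⟩
  have hμγ : Tendsto μ atTop (nhds γ) := by
    refine ProbabilityMeasure.tendsto_of_tendsto_charFun fun θ => ?_
    have hlim := tendsto_integral_exp_sum_cos (a := fun k => n (k + 1)) hq hpos' ha θ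
    have hγ : charFun (γ : Measure ℝ) θ = (Real.exp (-(θ ^ 2 / 2)) : ℝ) := by
      simp [γ, charFun_gaussianReal]
    rw [hγ]
    refine hlim.congr fun N => ?_
    simp only [μ, ProbabilityMeasure.coe_mk, charFun_apply_real]
    rw [integral_map (hS N).aemeasurable (by fun_prop),
      intervalIntegral.integral_of_le zero_le_one, ← integral_Icc_eq_integral_Ioc]
    refine integral_congr_ae (.of_forall fun x => ?_)
    simp only [S]
    rw [mul_comm Complex.I, mul_assoc θ, Complex.ofReal_mul]
  have hfr : (γ : Measure ℝ) (frontier (Set.Iio t)) = 0 := by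
    have := nullSingletonClass_gaussianReal (μ := 0) (v := 1) one_ne_zero
    simp [γ]
  have hmain := ProbabilityMeasure.tendsto_measure_of_null_frontier_of_tendsto' hμγ hfr
  have hγt : ((γ : Measure ℝ) (Set.Iio t)).toReal
      = (√(2 * π))⁻¹ * ∫ u in Set.Iio t, Real.exp (-u ^ 2 / 2) := by
    simp only [γ, ProbabilityMeasure.coe_mk]
    rw [gaussianReal_apply_eq_integral _ one_ne_zero, ENNReal.toReal_ofReal
      (integral_nonneg fun _ => gaussianPDFReal_nonneg _ _ _), ← integral_const_mul]
    simp [gaussianPDFReal]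
  rw [← hγt]
  refine ((ENNReal.tendsto_toReal (measure_ne_top _ _)).comp hmain).congr' ?_
  filter_upwards [eventually_gt_atTop 0] with N hN
  have hNr : (0 : ℝ) < N := by exact_mod_cast hN
  simp only [Function.comp_apply, μ, ProbabilityMeasure.coe_mk]
  rw [Measure.map_apply (hS N) measurableSet_Iio,
    Measure.restrict_apply (hS N measurableSet_Iio)]
  congr 2
  ext x
  have hsum : ∑ k ∈ Finset.Icc 1 N, Real.cos (2 * π * (n k : ℝ) * x)
      = ∑ k ∈ Finset.range N, Real.cos (2 * π * n (k + 1) * x) := by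
    rw [Finset.range_eq_Ico, Finset.sum_Ico_add' (fun k => Real.cos (2 * π * n k * x)) 0 N 1]
    rfl
  have hsqrt : √(2 / N) = (√(N / 2))⁻¹ := by
    rw [← Real.sqrt_inv, inv_div]
  simp only [S, Set.mem_inter_iff, Set.mem_preimage, Set.mem_Iio, Set.mem_ofPred_eq, hsum, hsqrt]
  rw [inv_mul_lt_iff₀ (by positivity), mul_comm t, and_comm]
end
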